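/- Boundary value problem (C) with compatibility condition for 2D steady Euler: Let Ω = 𝕊¹ × (0,L), α ∈ (0,1), and suppose (v₀,p₀) ∈ C^{2,α}(Ω;ℝ²) × C^{2,α}(Ω) solves the steady Euler equations with v̄₀² := inf_{Ω̄} |v₀²| > 0 and curl v₀ = 0; set J₀ := ∫_𝒞 v₀·n dS. There exist ε > 0, M > 0 sufficiently small, and K > 0 (depending only on α, L, v̄₀²) such that: if ‖v₀¹‖_{C^{2,α}(Ω)} ≤ ε and h⁻ ∈ C^{2,α}(∂Ω₋), h⁺ ∈ C^{2,α}(∂Ω₊), f⁻ ∈ C^{2,α}(∂Ω₋), J ∈ ℝ satisfy ‖h⁻‖_{C^{2,α}(∂Ω₋)} + ‖h⁺‖_{C^{2,α}(∂Ω₊)} + ‖f⁻‖_{C^{2,α}(∂Ω₋)} + |J − J₀| ≤ KM, then there exists a unique (v,p) ∈ C^{2,α}(Ω;ℝ²) × C^{2,α}(Ω) solving the steady Euler equations with ‖v − v₀‖_{C^{2,α}(Ω)} ≤ M and satisfying p = p₀ + h⁻ on ∂Ω₋, p = p₀ + h⁺ on ∂Ω₊, v·n = v₀·n + f⁻ on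 ∂Ω₋, and ∫_𝒞 v·n dS = J, if and only if h⁺(0) = Λ(h⁻,h⁺,f⁻,J), where Λ(h⁻,h⁺,f⁻,J) := p̃(0,L) − p₀(0,L) and p̃ is the pressure of the unique solution (ṽ,p̃) with ‖ṽ − v₀‖_{C^{2,α}(Ω)} ≤ M of the steady Euler equations satisfying p̃ = p₀ + h⁻ on ∂Ω₋, ∂ₓp̃ = ∂ₓp₀ + ∂ₓh⁺ on ∂Ω₊, ṽ·n = v₀·n + f⁻ on ∂Ω₋ and ∫_𝒞 ṽ·n dS = J. -/

import Mathlib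

open Set
open scoped ENNReal

noncomputable section

namespace EulerBVP

/-- The closed strip `Ω̄ = ℝ × [0, L]`, modelling `𝕊¹ × [0,L]`
(functions on it are required to be 1-periodic in the first variable). -/
def strip (L : ℝ) : Set (ℝ × ℝ) := Set.univ ×ˢ Set.Icc 0 L

/-- Uniform α-Hölder seminorm of `f` on `s`, valued in `ℝ≥0∞`. -/
def hSemi {E F : Type*} [NormedAddCommGroup E] [NormedAddCommGroup F]
    (a : ℝ) (s : Set E) (f : E → F) : ℝ≥0∞ :=
  ⨆ x ∈ s, ⨆ y ∈ s, ENNReal.ofReal (‖f x - f y‖ / ‖x - y‖ ^ a)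

/-- `C^{k,α}` norm of `f` on `s`: sup norms of the derivatives (within `s`) up to
order `k`, plus the `α`-Hölder seminorm of the order-`k` derivative. -/
def hNorm {E F : Type*} [NormedAddCommGroup E] [NormedSpace ℝ E]
    [NormedAddCommGroup F] [NormedSpace ℝ F]
    (k : ℕ) (a : ℝ) (s : Set E) (f : E → F) : ℝ≥0∞ :=
  (Finset.range (k + 1)).sum
      (fun i => ⨆ x ∈ s, (‖iteratedFDerivWithin ℝ i f s x‖₊ : ℝ≥0∞))
    + hSemi a s (iteratedFDerivWithin ℝ k f s)

/-- Membership in the Hölder space `C^{k,α}(s)`. -/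
def MemC {E F : Type*} [NormedAddCommGroup E] [NormedSpace ℝ E]
    [NormedAddCommGroup F] [NormedSpace ℝ F]
    (k : ℕ) (a : ℝ) (s : Set E) (f : E → F) : Prop :=
  ContDiffOn ℝ k f s ∧ hNorm k a s f < ⊤

/-- 1-periodicity in the first (circle) variable. -/
def PerX {F : Type*} (f : ℝ × ℝ → F) : Prop := ∀ x y, f (x + 1, y) = f (x, y)

/-- 1-periodicity for functions on the boundary circle. -/
def Per {F : Type*} (f : ℝ → F) : Prop := ∀ x, f (x + 1) = f x

/-- Partial derivative in the first variable (within the strip). -/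
def pdx (L : ℝ) (f : ℝ × ℝ → ℝ) (z : ℝ × ℝ) : ℝ := fderivWithin ℝ f (strip L) z (1, 0)

/-- Partial derivative in the second variable (within the strip). -/
def pdy (L : ℝ) (f : ℝ × ℝ → ℝ) (z : ℝ × ℝ) : ℝ := fderivWithin ℝ f (strip L) z (0, 1)

/-- First component of a planar vector field. -/
def c1 (v : ℝ × ℝ → ℝ × ℝ) : ℝ × ℝ → ℝ := fun z => (v z).1

/-- Second component of a planar vector field. -/
def c2 (v : ℝ × ℝ → ℝ × ℝ) : ℝ × ℝ → ℝ := fun z => (v z).2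

/-- Divergence `∂ₓ v¹ + ∂_y v²`. -/
def divF (L : ℝ) (v : ℝ × ℝ → ℝ × ℝ) (z : ℝ × ℝ) : ℝ := pdx L (c1 v) z + pdy L (c2 v) z

/-- Scalar curl `∂ₓ v² − ∂_y v¹`. -/
def curlF (L : ℝ) (v : ℝ × ℝ → ℝ × ℝ) (z : ℝ × ℝ) : ℝ := pdx L (c2 v) z - pdy L (c1 v) z

/-- Squared Euclidean length `|v|²` of a planar vector field. -/
def sq (v : ℝ × ℝ → ℝ × ℝ) (z : ℝ × ℝ) : ℝ := (v z).1 ^ 2 + (v z).2 ^ 2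

/-- The steady incompressible Euler equations `v·∇v = −∇p`, `div v = 0` on the strip. -/
def Euler (L : ℝ) (v : ℝ × ℝ → ℝ × ℝ) (p : ℝ × ℝ → ℝ) : Prop :=
  ∀ z ∈ strip L,
    ((v z).1 * pdx L (c1 v) z + (v z).2 * pdy L (c1 v) z = - pdx L p z) ∧
    ((v z).1 * pdx L (c2 v) z + (v z).2 * pdy L (c2 v) z = - pdy L p z) ∧
    divF L v z = 0

/-- The magnetohydrostatic equations `B × j = −∇p`, `j = curl B`, `div B = 0` on the strip;
in 2D, `B × j = (−B² j, B¹ j)`. -/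
def MHS (L : ℝ) (B : ℝ × ℝ → ℝ × ℝ) (p : ℝ × ℝ → ℝ) : Prop :=
  ∀ z ∈ strip L,
    (-(B z).2 * curlF L B z = - pdx L p z) ∧
    ((B z).1 * curlF L B z = - pdy L p z) ∧
    divF L B z = 0

/-- Flux across the segment `𝒞 = {0} × [0,L]`:  `∫_𝒞 w·n dS = −∫₀^L w¹(0,y) dy`. -/
def fluxC (L : ℝ) (w : ℝ × ℝ → ℝ × ℝ) : ℝ := - ∫ y in (0:ℝ)..L, (w (0, y)).1

/-- A velocity/pressure pair of class `C^{k,α}` on the strip, periodic in `x`. -/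
def VP (L : ℝ) (k : ℕ) (a : ℝ) (v : ℝ × ℝ → ℝ × ℝ) (p : ℝ × ℝ → ℝ) : Prop :=
  PerX v ∧ PerX p ∧ MemC k a (strip L) v ∧ MemC k a (strip L) p

/-- Boundary data of class `C^{k,α}(𝕊¹)`: a 1-periodic function in `C^{k,α}(ℝ)`. -/
def BData (k : ℕ) (a : ℝ) (f : ℝ → ℝ) : Prop := Per f ∧ MemC k a (Set.univ : Set ℝ) f

/-- Solution of the steady Euler equations with the solvable-variant boundary conditions of
problem (C): `p = p₀ + h⁻` on `∂Ω₋`, `∂ₓp = ∂ₓp₀ + ∂ₓh⁺` on `∂Ω₊`,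
`v·n = v₀·n + f⁻` on `∂Ω₋`, flux `J`, within `C^{2,α}`-distance `M` of `v₀`. -/
def SolCmod (L a M : ℝ) (v₀ : ℝ × ℝ → ℝ × ℝ) (p₀ : ℝ × ℝ → ℝ) (hm hp fm : ℝ → ℝ) (J : ℝ)
    (v : ℝ × ℝ → ℝ × ℝ) (p : ℝ × ℝ → ℝ) : Prop :=
  VP L 2 a v p ∧ Euler L v p ∧
  hNorm 2 a (strip L) (fun z => v z - v₀ z) ≤ ENNReal.ofReal M ∧
  (∀ x, p (x, 0) = p₀ (x, 0) + hm x) ∧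
  (∀ x, deriv (fun t => p (t, L)) x = deriv (fun t => p₀ (t, L)) x + deriv hp x) ∧
  (∀ x, -(v (x, 0)).2 = -(v₀ (x, 0)).2 + fm x) ∧
  fluxC L v = J

/-- Solution of the steady Euler equations with the boundary conditions of problem (C):
`p = p₀ + h⁻` on `∂Ω₋`, `p = p₀ + h⁺` on `∂Ω₊`, `v·n = v₀·n + f⁻` on `∂Ω₋`,
flux `J`, within `C^{2,α}`-distance `M` of `v₀`. -/
def SolC (L a M : ℝ) (v₀ : ℝ × ℝ → ℝ × ℝ) (p₀ : ℝ × ℝ → ℝ) (hm hp fm : ℝ → ℝ) (J : ℝ)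
    (v : ℝ × ℝ → ℝ × ℝ) (p : ℝ × ℝ → ℝ) : Prop :=
  VP L 2 a v p ∧ Euler L v p ∧
  hNorm 2 a (strip L) (fun z => v z - v₀ z) ≤ ENNReal.ofReal M ∧
  (∀ x, p (x, 0) = p₀ (x, 0) + hm x) ∧
  (∀ x, p (x, L) = p₀ (x, L) + hp x) ∧
  (∀ x, -(v (x, 0)).2 = -(v₀ (x, 0)).2 + fm x) ∧
  fluxC L v = J

section G1

variable {E : Type*} [NormedAddCommGroup E] [NormedSpace ℝ E]

/-- The linear map `(s, t) ↦ s a + t b`. -/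
def lin (a b : E) : ℝ × ℝ →L[ℝ] E :=
  (ContinuousLinearMap.fst ℝ ℝ ℝ).smulRight a + (ContinuousLinearMap.snd ℝ ℝ ℝ).smulRight b

@[simp] lemma lin_apply (a b : E) (z : ℝ × ℝ) : lin a b z = z.1 • a + z.2 • b := rfl

lemma lin_add (a b a' b' : E) : lin (a + a') (b + b') = lin a b + lin a' b' := by
  ext <;> simp

lemma lin_sub (a b a' b' : E) : lin (a - a') (b - b') = lin a b - lin a' b' := by
  ext <;> simp

lemma norm_lin_le (a b : E) : ‖lin a b‖ ≤ ‖a‖ + ‖b‖ := by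
  refine ContinuousLinearMap.opNorm_le_bound _ (by positivity) fun z => ?_
  rw [lin_apply, add_mul]
  refine (norm_add_le _ _).trans (add_le_add ?_ ?_)
  · rw [norm_smul, mul_comm]; gcongr; exact norm_fst_le z
  · rw [norm_smul, mul_comm]; gcongr; exact norm_snd_le z

lemma mem_strip {L x y : ℝ} : (x, y) ∈ strip L ↔ y ∈ Icc 0 L := by simp [strip]

lemma convex_strip (L : ℝ) : Convex ℝ (strip L) := convex_univ.prod (convex_Icc 0 L)

lemma uniqueDiffOn_strip {L : ℝ} (hL : 0 < L) : UniqueDiffOn ℝ (strip L) :=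
  uniqueDiffOn_univ.prod (uniqueDiffOn_Icc hL)

/-- `f` is differentiable on the closed strip, with partial derivatives `fx`, `fy`. -/
def G1 (L : ℝ) (f fx fy : ℝ × ℝ → E) : Prop :=
  ∀ z ∈ strip L, HasFDerivWithinAt f (lin (fx z) (fy z)) (strip L) z

variable {L : ℝ} {f fx fy g gx gy : ℝ × ℝ → E}

lemma G1.continuousOn (h : G1 L f fx fy) : ContinuousOn f (strip L) :=
  fun z hz => (h z hz).continuousWithinAt

lemma G1.add (hf : G1 L f fx fy) (hg : G1 L g gx gy) :
    G1 L (fun z => f z + g z) (fun z => fx z + gx z) (fun z => fy z + gy z) := fun z hz => by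
  rw [lin_add]; exact (hf z hz).add (hg z hz)

lemma G1.sub (hf : G1 L f fx fy) (hg : G1 L g gx gy) :
    G1 L (fun z => f z - g z) (fun z => fx z - gx z) (fun z => fy z - gy z) := fun z hz => by
  rw [lin_sub]; exact (hf z hz).sub (hg z hz)

lemma G1.const (c : E) : G1 L (fun _ => c) (fun _ => 0) (fun _ => 0) := fun z _ => by
  have : lin (0 : E) 0 = 0 := by ext <;> simp
  rw [this]; exact hasFDerivWithinAt_const c z _

lemma G1.clm {F : Type*} [NormedAddCommGroup F] [NormedSpace ℝ F] (T : E →L[ℝ] F)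
    (hf : G1 L f fx fy) : G1 L (fun z => T (f z)) (fun z => T (fx z)) (fun z => T (fy z)) :=
  fun z hz => by
  have : lin (T (fx z)) (T (fy z)) = T.comp (lin (fx z) (fy z)) := by ext <;> simp
  rw [this]; exact T.hasFDerivAt.comp_hasFDerivWithinAt z (hf z hz)

lemma G1.const_smul (c : ℝ) (hf : G1 L f fx fy) :
    G1 L (fun z => c • f z) (fun z => c • fx z) (fun z => c • fy z) :=
  hf.clm (c • ContinuousLinearMap.id ℝ E)

lemma G1.neg (hf : G1 L f fx fy) :
    G1 L (fun z => - f z) (fun z => - fx z) (fun z => - fy z) :=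
  hf.clm (-ContinuousLinearMap.id ℝ E)

lemma G1.congr {f' fx' fy' : ℝ × ℝ → E} (h : G1 L f fx fy) (e : EqOn f' f (strip L))
    (ex : EqOn fx' fx (strip L)) (ey : EqOn fy' fy (strip L)) : G1 L f' fx' fy' := fun z hz => by
  rw [ex hz, ey hz]; exact (h z hz).congr e (e hz)

lemma G1.slice_x (h : G1 L f fx fy) {x y : ℝ} (hy : y ∈ Icc 0 L) :
    HasDerivAt (fun x => f (x, y)) (fx (x, y)) x := by
  have h1 : HasDerivAt (fun x : ℝ => (x, y)) ((1 : ℝ), (0 : ℝ)) x :=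
    (hasDerivAt_id x).prodMk (hasDerivAt_const x y)
  have h2 := (h (x, y) (mem_strip.2 hy)).comp_hasDerivWithinAt (s := univ) x
    h1.hasDerivWithinAt (fun t _ => mem_strip.2 hy)
  simpa [Function.comp_def] using h2

lemma G1.slice_y (h : G1 L f fx fy) {x y : ℝ} (hy : y ∈ Icc 0 L) :
    HasDerivWithinAt (fun y => f (x, y)) (fy (x, y)) (Icc 0 L) y := by
  have h1 : HasDerivAt (fun y : ℝ => (x, y)) ((0 : ℝ), (1 : ℝ)) y :=
    (hasDerivAt_const y x).prodMk (hasDerivAt_id y)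
  have h2 := (h (x, y) (mem_strip.2 hy)).comp_hasDerivWithinAt (s := Icc 0 L) y
    h1.hasDerivWithinAt (fun t ht => mem_strip.2 ht)
  simpa [Function.comp_def] using h2

lemma G1.unique (hL : 0 < L) (h : G1 L f fx fy) (h' : G1 L f gx gy) :
    EqOn fx gx (strip L) ∧ EqOn fy gy (strip L) := by
  have key : ∀ z ∈ strip L, lin (fx z) (fy z) = lin (gx z) (gy z) := fun z hz =>
    (uniqueDiffOn_strip hL).eq hz (h z hz) (h' z hz)
  constructor <;> intro z hz
  · simpa using congrArg (fun T => T (1, 0)) (key z hz)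
  · simpa using congrArg (fun T => T (0, 1)) (key z hz)

lemma G1.translate (h : G1 L f fx fy) (r : ℝ) :
    G1 L (fun z => f (z.1 + r, z.2)) (fun z => fx (z.1 + r, z.2)) (fun z => fy (z.1 + r, z.2)) := by
  intro z hz
  have h1 : HasFDerivWithinAt (fun z : ℝ × ℝ => (z.1 + r, z.2))
      (ContinuousLinearMap.id ℝ (ℝ × ℝ)) (strip L) z := by
    have : (fun z : ℝ × ℝ => (z.1 + r, z.2)) = fun z => z + (r, 0) := by ext z <;> simp
    rw [this]; exact (hasFDerivWithinAt_id z _).add_const _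
  have hm : MapsTo (fun z : ℝ × ℝ => (z.1 + r, z.2)) (strip L) (strip L) := fun w hw =>
    mem_strip.2 (mem_strip.1 (show (w.1, w.2) ∈ strip L from hw))
  simpa [Function.comp_def] using (h _ (hm hz)).comp z h1 hm

lemma G1.dist_le (h : G1 L f fx fy) {N : ℝ} (hx : ∀ z ∈ strip L, ‖fx z‖ ≤ N)
    (hy : ∀ z ∈ strip L, ‖fy z‖ ≤ N) {z w : ℝ × ℝ} (hz : z ∈ strip L) (hw : w ∈ strip L) :
    ‖f z - f w‖ ≤ 2 * N * ‖z - w‖ :=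
  (convex_strip L).norm_image_sub_le_of_norm_hasFDerivWithin_le h
    (fun z hz => (norm_lin_le _ _).trans (by linarith [hx z hz, hy z hz])) hw hz

lemma G1.eq_const (h : G1 L f (fun _ => 0) (fun _ => 0)) {z w : ℝ × ℝ} (hz : z ∈ strip L)
    (hw : w ∈ strip L) : f z = f w := by
  have := h.dist_le (N := 0) (by simp) (by simp) hz hw
  simpa [sub_eq_zero] using this

lemma G1.mul {f fx fy g gx gy : ℝ × ℝ → ℝ} (hf : G1 L f fx fy) (hg : G1 L g gx gy) :
    G1 L (fun z => f z * g z) (fun z => fx z * g z + f z * gx z)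
      (fun z => fy z * g z + f z * gy z) := fun z hz => by
  have : lin (fx z * g z + f z * gx z) (fy z * g z + f z * gy z)
      = f z • lin (gx z) (gy z) + g z • lin (fx z) (fy z) := by
    ext <;> simp <;> ring
  rw [this]; exact (hf z hz).mul (hg z hz)

lemma G1.comp {f fx fy : ℝ × ℝ → ℝ} (hf : G1 L f fx fy) {φ φ' : ℝ → ℝ}
    (hφ : ∀ t, HasDerivAt φ (φ' t) t) :
    G1 L (fun z => φ (f z)) (fun z => φ' (f z) * fx z) (fun z => φ' (f z) * fy z) := fun z hz => by
  have : lin (φ' (f z) * fx z) (φ' (f z) * fy z) = φ' (f z) • lin (fx z) (fy z) := by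
    ext <;> simp
  rw [this]; exact (hφ (f z)).comp_hasFDerivWithinAt z (hf z hz)

/-- A function of the first variable only. -/
lemma G1.of_fst {φ φ' : ℝ → E} (hφ : ∀ t, HasDerivAt φ (φ' t) t) :
    G1 L (fun z => φ z.1) (fun z => φ' z.1) (fun _ => 0) := fun z _ => by
  have h := (hφ z.1).hasFDerivAt.comp_hasFDerivWithinAt z
    ((ContinuousLinearMap.fst ℝ ℝ ℝ).hasFDerivWithinAt (s := strip L))
  have e : lin (φ' z.1) 0 = (ContinuousLinearMap.toSpanSingleton ℝ (φ' z.1)).comp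
      (ContinuousLinearMap.fst ℝ ℝ ℝ) := by ext <;> simp
  rw [e]; exact h

/-- A function of the second variable only. -/
lemma G1.of_snd {φ φ' : ℝ → E} (hφ : ∀ t ∈ Icc 0 L, HasDerivWithinAt φ (φ' t) (Icc 0 L) t) :
    G1 L (fun z => φ z.2) (fun _ => 0) (fun z => φ' z.2) := fun z hz => by
  have h := (hφ z.2 hz.2).hasFDerivWithinAt.comp z
    ((ContinuousLinearMap.snd ℝ ℝ ℝ).hasFDerivWithinAt (s := strip L)) (fun w hw => hw.2)
  have e : lin 0 (φ' z.2) = (ContinuousLinearMap.toSpanSingleton ℝ (φ' z.2)).comp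
      (ContinuousLinearMap.snd ℝ ℝ ℝ) := by ext <;> simp
  rw [e]; exact h

/-- Uniform limits of the partial derivatives pass to the limit. -/
lemma G1.lim [CompleteSpace E] {F Fx Fy : ℕ → ℝ × ℝ → E} (h : ∀ n, G1 L (F n) (Fx n) (Fy n))
    (hl : ∀ z ∈ strip L, Filter.Tendsto (fun n => F n z) Filter.atTop (nhds (f z)))
    (hx : TendstoUniformlyOn Fx fx Filter.atTop (strip L))
    (hy : TendstoUniformlyOn Fy fy Filter.atTop (strip L)) : G1 L f fx fy := by
  intro z hz
  rw [hasFDerivWithinAt_iff_isLittleO, Asymptotics.isLittleO_iff]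
  intro c hc
  rw [Metric.tendstoUniformlyOn_iff] at hx hy
  obtain ⟨n, hn⟩ := ((hx (c / 16) (by positivity)).and
    (hy (c / 16) (by positivity))).exists_forall_of_atTop
  have hn' := hn n le_rfl
  have hdiff : ∀ w ∈ strip L, ‖(f w - F n w) - (f z - F n z)‖ ≤ c / 2 * ‖w - z‖ := by
    intro w hw
    have t1 : Filter.Tendsto (fun m => ‖(F m w - F n w) - (F m z - F n z)‖) Filter.atTop
        (nhds ‖(f w - F n w) - (f z - F n z)‖) :=
      (((hl w hw).sub tendsto_const_nhds).sub ((hl z hz).sub tendsto_const_nhds)).norm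
    refine le_of_tendsto t1 (Filter.eventually_atTop.2 ⟨n, fun m hm => ?_⟩)
    have := ((h m).sub (h n)).dist_le (N := c / 4) (fun v hv => ?_) (fun v hv => ?_) hw hz
    · calc _ ≤ _ := this
        _ = _ := by ring
    · have a1 := (hn m hm).1 v hv
      have a2 := hn'.1 v hv
      rw [dist_eq_norm] at a1 a2
      have : Fx m v - Fx n v = (fx v - Fx n v) - (fx v - Fx m v) := by abel
      rw [this]; exact (norm_sub_le _ _).trans (by linarith)
    · have a1 := (hn m hm).2 v hv
      have a2 := hn'.2 v hv
      rw [dist_eq_norm] at a1 a2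
      have : Fy m v - Fy n v = (fy v - Fy n v) - (fy v - Fy m v) := by abel
      rw [this]; exact (norm_sub_le _ _).trans (by linarith)
  have hd := (h n z hz)
  rw [hasFDerivWithinAt_iff_isLittleO, Asymptotics.isLittleO_iff] at hd
  filter_upwards [hd (c := c / 4) (by positivity), self_mem_nhdsWithin] with w hw hws
  have e : f w - f z - (lin (fx z) (fy z)) (w - z) = ((f w - F n w) - (f z - F n z))
      + (F n w - F n z - lin (Fx n z) (Fy n z) (w - z))
      - (lin (fx z - Fx n z) (fy z - Fy n z)) (w - z) := by
    rw [lin_sub, sub_apply]; abel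
  have b3 : ‖(lin (fx z - Fx n z) (fy z - Fy n z)) (w - z)‖ ≤ c / 8 * ‖w - z‖ := by
    refine (ContinuousLinearMap.le_opNorm _ _).trans ?_
    gcongr
    have a1 := hn'.1 z hz
    have a2 := hn'.2 z hz
    rw [dist_eq_norm] at a1 a2
    exact (norm_lin_le _ _).trans (by linarith)
  rw [e]
  have := hdiff w hws
  calc _ ≤ _ := norm_sub_le _ _
    _ ≤ ‖(f w - F n w) - (f z - F n z)‖ + ‖F n w - F n z - lin (Fx n z) (Fy n z) (w - z)‖
        + c / 8 * ‖w - z‖ := add_le_add (norm_add_le _ _) b3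
    _ ≤ c / 2 * ‖w - z‖ + c / 4 * ‖w - z‖ + c / 8 * ‖w - z‖ := by gcongr
    _ ≤ c * ‖w - z‖ := by nlinarith [norm_nonneg (w - z)]

end G1

section Hoelder

variable {X E : Type*} [NormedAddCommGroup X] [NormedAddCommGroup E]

/-- `f` is bounded by `N` and `a`-Hölder with constant `N` on `S`. -/
def Ho (a N : ℝ) (S : Set X) (f : X → E) : Prop :=
  (∀ x ∈ S, ‖f x‖ ≤ N) ∧ ∀ x ∈ S, ∀ y ∈ S, ‖f x - f y‖ ≤ N * ‖x - y‖ ^ a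

variable {a N K : ℝ} {S : Set X} {f g : X → E}

lemma Ho.mono (h : Ho a N S f) (hK : N ≤ K) : Ho a K S f :=
  ⟨fun x hx => (h.1 x hx).trans hK, fun x hx y hy => (h.2 x hx y hy).trans (by gcongr)⟩

lemma Ho.congr (h : Ho a N S f) (e : EqOn g f S) : Ho a N S g :=
  ⟨fun x hx => by rw [e hx]; exact h.1 x hx, fun x hx y hy => by
    rw [e hx, e hy]; exact h.2 x hx y hy⟩

lemma Ho.nonneg (h : Ho a N S f) (hS : S.Nonempty) : 0 ≤ N := by
  obtain ⟨x, hx⟩ := hS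
  exact (norm_nonneg _).trans (h.1 x hx)

lemma Ho.add (h : Ho a N S f) (h' : Ho a K S g) : Ho a (N + K) S (fun x => f x + g x) := by
  refine ⟨fun x hx => (norm_add_le _ _).trans (add_le_add (h.1 x hx) (h'.1 x hx)),
    fun x hx y hy => ?_⟩
  rw [add_sub_add_comm, add_mul]
  exact (norm_add_le _ _).trans (add_le_add (h.2 x hx y hy) (h'.2 x hx y hy))

lemma Ho.neg (h : Ho a N S f) : Ho a N S (fun x => - f x) := by
  refine ⟨fun x hx => by simpa using h.1 x hx, fun x hx y hy => ?_⟩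
  rw [← neg_sub_neg, norm_sub_rev]
  simpa [norm_sub_rev] using h.2 x hx y hy

lemma Ho.sub (h : Ho a N S f) (h' : Ho a K S g) : Ho a (N + K) S (fun x => f x - g x) := by
  simpa [sub_eq_add_neg] using h.add h'.neg

lemma Ho.const (c : E) : Ho a ‖c‖ S (fun _ => c) :=
  ⟨fun _ _ => le_rfl, fun x _ y _ => by simp; positivity⟩

lemma Ho.const_smul [NormedSpace ℝ E] (c : ℝ) (h : Ho a N S f) :
    Ho a (|c| * N) S (fun x => c • f x) := by
  refine ⟨fun x hx => by rw [norm_smul, Real.norm_eq_abs]; gcongr; exact h.1 x hx,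
    fun x hx y hy => ?_⟩
  rw [← smul_sub, norm_smul, Real.norm_eq_abs, mul_assoc]
  gcongr
  exact h.2 x hx y hy

lemma Ho.mul {f g : X → ℝ} (h : Ho a N S f) (h' : Ho a K S g) :
    Ho a (2 * N * K) S (fun x => f x * g x) := by
  rcases S.eq_empty_or_nonempty with rfl | hS
  · exact ⟨fun x hx => hx.elim, fun x hx => hx.elim⟩
  have hN := h.nonneg hS
  have hK := h'.nonneg hS
  refine ⟨fun x hx => ?_, fun x hx y hy => ?_⟩
  · rw [norm_mul]
    have := mul_le_mul (h.1 x hx) (h'.1 x hx) (norm_nonneg _) hN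
    nlinarith [mul_nonneg hN hK]
  · have e : f x * g x - f y * g y = (f x - f y) * g x + f y * (g x - g y) := by ring
    rw [e]
    calc _ ≤ _ := norm_add_le _ _
      _ = ‖f x - f y‖ * ‖g x‖ + ‖f y‖ * ‖g x - g y‖ := by rw [norm_mul, norm_mul]
      _ ≤ (N * ‖x - y‖ ^ a) * K + N * (K * ‖x - y‖ ^ a) := by
          gcongr
          exacts [h.2 x hx y hy, h'.1 x hx, h.1 y hy, h'.2 x hx y hy]
      _ = _ := by ring

/-- A bounded function with small Lipschitz-type oscillation is Hölder. -/
lemma min_le_rpow {r a : ℝ} (hr : 0 ≤ r) (ha : a ∈ Ioo (0 : ℝ) 1) : min 1 r ≤ r ^ a := by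
  rcases le_total r 1 with h | h
  · rw [min_eq_right h]
    calc r = r ^ (1 : ℝ) := (Real.rpow_one r).symm
      _ ≤ r ^ a := Real.rpow_le_rpow_of_exponent_ge_of_imp hr h ha.2.le (by
          intro _ h'; linarith [ha.1])
  · rw [min_eq_left h]; exact Real.one_le_rpow h ha.1.le

lemma Ho.of_lip (ha : a ∈ Ioo (0 : ℝ) 1) (hb : ∀ x ∈ S, ‖f x‖ ≤ N)
    (hl : ∀ x ∈ S, ∀ y ∈ S, ‖f x - f y‖ ≤ 2 * N * ‖x - y‖) : Ho a (2 * N) S f := by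
  refine ⟨fun x hx => ?_, fun x hx y hy => ?_⟩
  · have := (norm_nonneg _).trans (hb x hx)
    linarith [hb x hx]
  · have hN := (norm_nonneg _).trans (hb x hx)
    have h1 : ‖f x - f y‖ ≤ 2 * N * 1 := (norm_sub_le _ _).trans (by linarith [hb x hx, hb y hy])
    calc _ ≤ 2 * N * min 1 ‖x - y‖ := by
          rw [mul_min_of_nonneg _ _ (by positivity)]; exact le_min h1 (hl x hx y hy)
      _ ≤ _ := by gcongr; exact min_le_rpow (norm_nonneg _) ha

lemma Ho.comp_lip {Y : Type*} [NormedAddCommGroup Y] {T : Set Y} {s : Y → X}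
    (ha : a ∈ Ioo (0 : ℝ) 1) (h : Ho a N S f)
    (hs : MapsTo s T S) (hK : 1 ≤ K) (hl : ∀ x ∈ T, ∀ y ∈ T, ‖s x - s y‖ ≤ K * ‖x - y‖) :
    Ho a (K * N) T (fun x => f (s x)) := by
  refine ⟨fun x hx => ?_, fun x hx y hy => ?_⟩
  · have := h.1 _ (hs hx)
    nlinarith [(norm_nonneg _).trans this]
  · have hN := (norm_nonneg _).trans (h.1 _ (hs hx))
    calc _ ≤ N * ‖s x - s y‖ ^ a := h.2 _ (hs hx) _ (hs hy)
      _ ≤ N * (K * ‖x - y‖) ^ a := by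
          have := ha.1.le
          gcongr; exact hl x hx y hy
      _ = N * (K ^ a * ‖x - y‖ ^ a) := by rw [Real.mul_rpow (by linarith) (norm_nonneg _)]
      _ ≤ N * (K * ‖x - y‖ ^ a) := by
          gcongr
          exact Real.rpow_le_self_of_one_le hK ha.2.le
      _ = _ := by ring

lemma Ho.inv {g : X → ℝ} (h : Ho a N S g) (hg : ∀ x ∈ S, 1 / 2 ≤ g x) :
    Ho a (2 + 4 * N) S (fun x => (g x)⁻¹) := by
  refine ⟨fun x hx => ?_, fun x hx y hy => ?_⟩
  · have hN := (norm_nonneg _).trans (h.1 x hx)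
    have h0 := hg x hx
    rw [norm_inv, Real.norm_of_nonneg (by linarith)]
    have : (g x)⁻¹ ≤ 2 := by rw [inv_le_comm₀ (by linarith) (by norm_num)]; linarith
    linarith
  · have hN := (norm_nonneg _).trans (h.1 x hx)
    have h0 := hg x hx
    have h1 := hg y hy
    have e : (g x)⁻¹ - (g y)⁻¹ = - ((g x)⁻¹ * (g y)⁻¹ * (g x - g y)) := by
      have : g x ≠ 0 := by linarith
      have : g y ≠ 0 := by linarith
      field_simp; ring
    have i0 : ‖(g x)⁻¹‖ ≤ 2 := by
      rw [norm_inv, Real.norm_of_nonneg (by linarith), inv_le_comm₀ (by linarith) (by norm_num)]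
      linarith
    have i1 : ‖(g y)⁻¹‖ ≤ 2 := by
      rw [norm_inv, Real.norm_of_nonneg (by linarith), inv_le_comm₀ (by linarith) (by norm_num)]
      linarith
    have hp : 0 ≤ ‖x - y‖ ^ a := by positivity
    rw [e, norm_neg, norm_mul, norm_mul]
    calc _ ≤ 2 * 2 * (N * ‖x - y‖ ^ a) := by gcongr; exact h.2 x hx y hy
      _ ≤ _ := by nlinarith

lemma Ho.lim {F : ℕ → X → E} (h : ∀ n, Ho a N S (F n))
    (hl : ∀ x ∈ S, Filter.Tendsto (fun n => F n x) Filter.atTop (nhds (f x))) : Ho a N S f :=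
  ⟨fun x hx => le_of_tendsto (hl x hx).norm (.of_forall fun n => (h n).1 x hx),
   fun x hx y hy => le_of_tendsto ((hl x hx).sub (hl y hy)).norm
    (.of_forall fun n => (h n).2 x hx y hy)⟩

lemma Ho.clm {F : Type*} [NormedAddCommGroup F] [NormedSpace ℝ E] [NormedSpace ℝ F]
    (T : E →L[ℝ] F) (hT : ‖T‖ ≤ 1) (h : Ho a N S f) : Ho a N S (fun x => T (f x)) := by
  refine ⟨fun x hx => (T.le_of_opNorm_le hT _).trans (by simpa using h.1 x hx),
    fun x hx y hy => ?_⟩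
  rw [← map_sub]
  exact (T.le_of_opNorm_le hT _).trans (by simpa using h.2 x hx y hy)

lemma Ho.continuousOn (ha : 0 < a) (h : Ho a N S f) : ContinuousOn f S := by
  intro x hx
  rw [ContinuousWithinAt, tendsto_iff_norm_sub_tendsto_zero]
  have t : Filter.Tendsto (fun y => N * ‖y - x‖ ^ a) (nhdsWithin x S) (nhds 0) := by
    have : ContinuousAt (fun y => N * ‖y - x‖ ^ a) x := by
      refine continuousAt_const.mul (ContinuousAt.rpow_const ?_ (Or.inr ha.le))
      exact (continuous_norm.comp (continuous_id.sub continuous_const)).continuousAt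
    have h2 := this.tendsto
    simp only [sub_self, norm_zero, Real.zero_rpow ha.ne', mul_zero] at h2
    exact h2.mono_left nhdsWithin_le_nhds
  exact squeeze_zero' (.of_forall fun _ => norm_nonneg _)
    (Filter.eventually_of_mem self_mem_nhdsWithin fun y hy => h.2 y hy x hx) t

/-- Interpolation: a small bounded function with an `a`-Hölder bound is small in a weaker
Hölder norm. -/
lemma Ho.interp {δ : ℝ} (h : Ho a N S f) (hb : ∀ x ∈ S, ‖f x‖ ≤ δ)
    (hδ : δ ≤ N) : Ho (a / 2) (2 * Real.sqrt (δ * N)) S f := by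
  refine ⟨fun x hx => ?_, fun x hx y hy => ?_⟩
  · have h0 := (norm_nonneg _).trans (hb x hx)
    have : δ ≤ Real.sqrt (δ * N) := Real.le_sqrt_of_sq_le (by nlinarith)
    linarith [hb x hx]
  · have h0 := (norm_nonneg _).trans (hb x hx)
    have hr : ‖x - y‖ ^ (a / 2) = Real.sqrt (‖x - y‖ ^ a) := by
      rw [Real.sqrt_eq_rpow, ← Real.rpow_mul (norm_nonneg _)]; congr 1; ring
    have h1 : ‖f x - f y‖ ≤ 2 * δ := (norm_sub_le _ _).trans (by linarith [hb x hx, hb y hy])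
    have h2 := h.2 x hx y hy
    have hp : 0 ≤ ‖x - y‖ ^ a := by positivity
    rw [hr, mul_assoc, ← Real.sqrt_mul (by nlinarith)]
    have : ‖f x - f y‖ ^ 2 ≤ 4 * (δ * N * ‖x - y‖ ^ a) := by
      have := mul_le_mul h1 h2 (norm_nonneg _) (by linarith)
      have hnn : 0 ≤ δ * (N * ‖x - y‖ ^ a) := by
        have : 0 ≤ N := by linarith
        positivity
      nlinarith
    calc ‖f x - f y‖ ≤ Real.sqrt (4 * (δ * N * ‖x - y‖ ^ a)) := Real.le_sqrt_of_sq_le this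
      _ = 2 * _ := by
        rw [Real.sqrt_mul (by norm_num), show (4 : ℝ) = 2 ^ 2 by norm_num,
          Real.sqrt_sq (by norm_num)]

end Hoelder

section OneD

variable {E : Type*} [NormedAddCommGroup E] [NormedSpace ℝ E] {a N K : ℝ}

/-- One-dimensional `C^{1,a}` bound, with explicit derivative. -/
def H1 (a N : ℝ) (f f' : ℝ → E) : Prop :=
  (∀ x, HasDerivAt f (f' x) x) ∧ (∀ x, ‖f x‖ ≤ N) ∧ Ho a N univ f'

/-- One-dimensional `C^{2,a}` bound, with explicit derivatives. -/
def H2 (a N : ℝ) (f f' f'' : ℝ → E) : Prop :=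
  (∀ x, HasDerivAt f (f' x) x) ∧ (∀ x, ‖f x‖ ≤ N) ∧ H1 a N f' f''

lemma lip_of_deriv {f f' : ℝ → E} (h : ∀ x, HasDerivAt f (f' x) x) (hb : ∀ x, ‖f' x‖ ≤ N)
    (x y : ℝ) : ‖f x - f y‖ ≤ N * |x - y| :=
  convex_univ.norm_image_sub_le_of_norm_hasDerivWithin_le
    (fun x _ => (h x).hasDerivWithinAt) (fun x _ => hb x) (mem_univ y) (mem_univ x)

lemma H1.nonneg {f f' : ℝ → E} (h : H1 a N f f') : 0 ≤ N := (norm_nonneg _).trans (h.2.1 0)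

lemma H1.lip {f f' : ℝ → E} (h : H1 a N f f') (x y : ℝ) : ‖f x - f y‖ ≤ N * |x - y| :=
  lip_of_deriv h.1 (fun x => h.2.2.1 x trivial) x y

lemma H1.mono {f f' : ℝ → E} (h : H1 a N f f') (hK : N ≤ K) : H1 a K f f' :=
  ⟨h.1, fun x => (h.2.1 x).trans hK, h.2.2.mono hK⟩

lemma H1.ho {f f' : ℝ → E} (ha : a ∈ Ioo (0 : ℝ) 1) (h : H1 a N f f') : Ho a (2 * N) univ f :=
  Ho.of_lip ha (fun x _ => h.2.1 x) fun x _ y _ => (h.lip x y).trans (by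
    have := h.nonneg
    rw [Real.norm_eq_abs]
    gcongr; linarith)

lemma H1.add {f f' g g' : ℝ → E} (h : H1 a N f f') (k : H1 a K g g') :
    H1 a (N + K) (fun x => f x + g x) (fun x => f' x + g' x) :=
  ⟨fun x => (h.1 x).add (k.1 x),
    fun x => (norm_add_le _ _).trans (add_le_add (h.2.1 x) (k.2.1 x)), h.2.2.add k.2.2⟩

lemma H1.sub {f f' g g' : ℝ → E} (h : H1 a N f f') (k : H1 a K g g') :
    H1 a (N + K) (fun x => f x - g x) (fun x => f' x - g' x) :=
  ⟨fun x => (h.1 x).sub (k.1 x),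
    fun x => (norm_sub_le _ _).trans (add_le_add (h.2.1 x) (k.2.1 x)), h.2.2.sub k.2.2⟩

lemma H1.const_smul {f f' : ℝ → E} (c : ℝ) (h : H1 a N f f') :
    H1 a (|c| * N) (fun x => c • f x) (fun x => c • f' x) :=
  ⟨fun x => (h.1 x).const_smul c, fun x => by
    rw [norm_smul, Real.norm_eq_abs]; gcongr; exact h.2.1 x, h.2.2.const_smul c⟩

lemma H1.mul {f f' g g' : ℝ → ℝ} (ha : a ∈ Ioo (0 : ℝ) 1) (h : H1 a N f f') (k : H1 a K g g') :
    H1 a (8 * N * K) (fun x => f x * g x) (fun x => f' x * g x + f x * g' x) := by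
  have hN := h.nonneg
  have hK := k.nonneg
  refine ⟨fun x => (h.1 x).mul (k.1 x), fun x => ?_, ?_⟩
  · rw [norm_mul]
    have := mul_le_mul (h.2.1 x) (k.2.1 x) (norm_nonneg _) hN
    nlinarith [mul_nonneg hN hK]
  · exact ((h.2.2.mul (k.ho ha)).add ((h.ho ha).mul k.2.2)).mono (by linarith)

lemma H1.comp {f f' s s' : ℝ → ℝ} (ha : a ∈ Ioo (0 : ℝ) 1) (h : H1 a N f f') (hK : 1 ≤ K)
    (hs : ∀ x, HasDerivAt s (s' x) x) (hs' : Ho a K univ s') :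
    H1 a (2 * K ^ 2 * N) (fun x => f (s x)) (fun x => f' (s x) * s' x) := by
  have hN := h.nonneg
  refine ⟨fun x => (h.1 (s x)).comp x (hs x), fun x => (h.2.1 _).trans ?_, ?_⟩
  · nlinarith [mul_nonneg (by nlinarith : 0 ≤ 2 * K ^ 2 - 1) hN]
  have h1 : Ho a (K * N) univ (fun x => f' (s x)) := h.2.2.comp_lip ha (fun _ _ => trivial) hK
    (fun x _ y _ => lip_of_deriv hs (fun x => hs'.1 x trivial) x y)
  exact (h1.mul hs').mono (by nlinarith)

lemma H1.inv {g g' : ℝ → ℝ} (ha : a ∈ Ioo (0 : ℝ) 1) (h : H1 a N g g') (hN : 1 ≤ N)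
    (hg : ∀ x, 1 / 2 ≤ g x) :
    H1 a (400 * N ^ 3) (fun x => (g x)⁻¹) (fun x => -g' x * ((g x)⁻¹ * (g x)⁻¹)) := by
  have i := (h.ho ha).inv (fun x _ => hg x)
  have i' : Ho a (10 * N) univ (fun x => (g x)⁻¹) := i.mono (by linarith)
  refine ⟨fun x => ?_, fun x => (i'.1 x trivial).trans ?_, ?_⟩
  · have h0 : g x ≠ 0 := by linarith [hg x]
    have := (h.1 x).inv h0
    rw [div_eq_mul_inv, pow_two, mul_inv] at this
    exact this
  · nlinarith [mul_nonneg (by linarith : 0 ≤ N - 1) (by linarith : 0 ≤ N),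
      pow_pos (by linarith : 0 < N) 3, mul_self_nonneg N,
      mul_nonneg (mul_nonneg (by linarith : 0 ≤ N - 1) (by linarith : 0 ≤ N)) (by linarith : 0 ≤ N)]
  · exact (h.2.2.neg.mul (i'.mul i')).mono (by nlinarith)

lemma H2.nonneg {f f' f'' : ℝ → E} (h : H2 a N f f' f'') : 0 ≤ N :=
  (norm_nonneg _).trans (h.2.1 0)

lemma H2.mono {f f' f'' : ℝ → E} (h : H2 a N f f' f'') (hK : N ≤ K) : H2 a K f f' f'' :=
  ⟨h.1, fun x => (h.2.1 x).trans hK, h.2.2.mono hK⟩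

lemma H2.h1 {f f' f'' : ℝ → E} (ha : a ∈ Ioo (0 : ℝ) 1) (h : H2 a N f f' f'') :
    H1 a (2 * N) f f' :=
  ⟨h.1, fun x => (h.2.1 x).trans (by linarith [h.nonneg]), h.2.2.ho ha⟩

lemma H2.add {f f' f'' g g' g'' : ℝ → E} (h : H2 a N f f' f'') (k : H2 a K g g' g'') :
    H2 a (N + K) (fun x => f x + g x) (fun x => f' x + g' x) (fun x => f'' x + g'' x) :=
  ⟨fun x => (h.1 x).add (k.1 x),
    fun x => (norm_add_le _ _).trans (add_le_add (h.2.1 x) (k.2.1 x)), h.2.2.add k.2.2⟩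

lemma H2.sub {f f' f'' g g' g'' : ℝ → E} (h : H2 a N f f' f'') (k : H2 a K g g' g'') :
    H2 a (N + K) (fun x => f x - g x) (fun x => f' x - g' x) (fun x => f'' x - g'' x) :=
  ⟨fun x => (h.1 x).sub (k.1 x),
    fun x => (norm_sub_le _ _).trans (add_le_add (h.2.1 x) (k.2.1 x)), h.2.2.sub k.2.2⟩

lemma H2.const_smul {f f' f'' : ℝ → E} (c : ℝ) (h : H2 a N f f' f'') :
    H2 a (|c| * N) (fun x => c • f x) (fun x => c • f' x) (fun x => c • f'' x) :=
  ⟨fun x => (h.1 x).const_smul c, fun x => by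
    rw [norm_smul, Real.norm_eq_abs]; gcongr; exact h.2.1 x, h.2.2.const_smul c⟩

lemma H2.mul {f f' f'' g g' g'' : ℝ → ℝ} (ha : a ∈ Ioo (0 : ℝ) 1) (h : H2 a N f f' f'')
    (k : H2 a K g g' g'') :
    H2 a (32 * N * K) (fun x => f x * g x) (fun x => f' x * g x + f x * g' x)
      (fun x => (f'' x * g x + f' x * g' x) + (f' x * g' x + f x * g'' x)) := by
  have hN := h.nonneg
  have hK := k.nonneg
  refine ⟨fun x => (h.1 x).mul (k.1 x), fun x => ?_, ?_⟩
  · rw [norm_mul]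
    have := mul_le_mul (h.2.1 x) (k.2.1 x) (norm_nonneg _) hN
    nlinarith [mul_nonneg hN hK]
  · exact ((h.2.2.mul ha (k.h1 ha)).add ((h.h1 ha).mul ha k.2.2)).mono (by linarith)

lemma Per.deriv_of {F : Type*} [NormedAddCommGroup F] [NormedSpace ℝ F] {f f' : ℝ → F}
    (hp : Per f) (h : ∀ x, HasDerivAt f (f' x) x) : Per f' := fun x => by
  have h1 : HasDerivAt (fun t => f (t + 1)) (f' (x + 1)) x := by
    simpa using (h (x + 1)).comp_add_const x 1
  have h2 : (fun t => f (t + 1)) = f := funext hp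
  rw [h2] at h1
  exact h1.unique (h x)

/-- A function with a uniformly small size and an `a`-Hölder derivative has small derivative. -/
lemma deriv_small {f f' : ℝ → E} {δ N : ℝ} (h : ∀ x, HasDerivAt f (f' x) x)
    (hH : ∀ x y, ‖f' x - f' y‖ ≤ N * |x - y| ^ a) (hN : 0 ≤ N) (ha : 0 < a)
    (hb : ∀ x, ‖f x‖ ≤ δ) (x : ℝ) {r : ℝ} (hr : 0 < r) : ‖f' x‖ ≤ 2 * δ / r + N * r ^ a := by
  have key : ‖(f (x + r) - (x + r) • f' x) - (f x - x • f' x)‖ ≤ N * r ^ a * |x + r - x| := by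
    have hd : ∀ t ∈ Icc x (x + r), HasDerivWithinAt (fun t => f t - t • f' x) (f' t - f' x)
        (Icc x (x + r)) t := fun t _ => by
      have := ((h t).sub ((hasDerivAt_id t).smul_const (f' x))).hasDerivWithinAt
        (s := Icc x (x + r))
      rw [one_smul] at this
      exact this
    refine (convex_Icc x (x + r)).norm_image_sub_le_of_norm_hasDerivWithin_le hd (fun t ht => ?_)
      ⟨le_rfl, by linarith⟩ ⟨by linarith, le_rfl⟩
    refine (hH t x).trans ?_
    gcongr
    rw [abs_of_nonneg (by linarith [ht.1])]; linarith [ht.2]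
  have e : (f (x + r) - (x + r) • f' x) - (f x - x • f' x) = (f (x + r) - f x) - r • f' x := by
    rw [add_smul]; abel
  rw [e, add_sub_cancel_left, abs_of_pos hr] at key
  have h1 : ‖r • f' x‖ ≤ 2 * δ + N * r ^ a * r := by
    have : r • f' x = (f (x + r) - f x) - ((f (x + r) - f x) - r • f' x) := by abel
    rw [this]
    refine (norm_sub_le _ _).trans (add_le_add ((norm_sub_le _ _).trans ?_) key)
    linarith [hb (x + r), hb x]
  rw [norm_smul, Real.norm_of_nonneg hr.le] at h1
  rw [div_add' _ _ _ hr.ne', le_div_iff₀ hr]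
  linarith

end OneD

section Exponentials

open Complex in
/-- The character `x ↦ exp (2πix)`. -/
def ee (x : ℝ) : ℂ := Complex.exp (2 * Real.pi * Complex.I * x)

lemma ee_add (x y : ℝ) : ee (x + y) = ee x * ee y := by
  rw [ee, ee, ee, ← Complex.exp_add]; push_cast; ring_nf

@[simp] lemma ee_zero : ee 0 = 1 := by simp [ee]

lemma ee_int (k : ℤ) : ee k = 1 := by
  rw [ee]
  have := Complex.exp_int_mul_two_pi_mul_I k
  rw [← this]; push_cast; ring_nf

lemma ee_neg (x : ℝ) : ee (-x) = (starRingEnd ℂ) (ee x) := by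
  rw [ee, ee, ← Complex.exp_conj]; simp [Complex.conj_ofNat]

@[simp] lemma norm_ee (x : ℝ) : ‖ee x‖ = 1 := by
  rw [ee]
  have : 2 * (Real.pi : ℂ) * Complex.I * x = ((2 * Real.pi * x : ℝ) : ℂ) * Complex.I := by
    push_cast; ring
  rw [this, Complex.norm_exp_ofReal_mul_I]

lemma hasDerivAt_ee (k x : ℝ) :
    HasDerivAt (fun x => ee (k * x)) (2 * Real.pi * Complex.I * k * ee (k * x)) x := by
  have h : HasDerivAt (fun x : ℝ => 2 * (Real.pi : ℂ) * Complex.I * ((k * x : ℝ) : ℂ))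
      (2 * Real.pi * Complex.I * ((k * 1 : ℝ) : ℂ)) x :=
    (((hasDerivAt_id x).const_mul k).ofReal_comp).const_mul _
  have := h.cexp
  unfold ee
  convert this using 1
  push_cast; ring

lemma continuous_ee : Continuous ee := by unfold ee; fun_prop

lemma integral_ee (k : ℤ) : ∫ s in (-1/2 : ℝ)..(1/2), ee (k * s) = if k = 0 then 1 else 0 := by
  split_ifs with h
  · subst h; simp; norm_num
  · have hc : 2 * (Real.pi : ℂ) * Complex.I * k ≠ 0 := by
      simp [Real.pi_ne_zero, h]
    have e : ∀ s : ℝ, ee (k * s) = Complex.exp (2 * (Real.pi : ℂ) * Complex.I * k * s) := by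
      intro s; rw [ee]; push_cast; ring_nf
    simp_rw [e]
    rw [integral_exp_mul_complex hc, ← e, ← e]
    have : ee (k * (1/2 : ℝ)) = ee (k * (-1/2 : ℝ)) := by
      have := ee_add (k * (-1/2 : ℝ)) k
      rw [ee_int, mul_one] at this
      rw [← this]; ring_nf
    rw [this, sub_self, zero_div]

end Exponentials

section Kernel

/-- `exp (2π(-t + is))`. -/
def zk (t s : ℝ) : ℂ := Real.exp (-(2 * Real.pi * t)) * ee s

/-- The kernel `∑ k z^k`. -/
def Nk (t s : ℝ) : ℂ := zk t s / (1 - zk t s) ^ 2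

lemma norm_zk (t s : ℝ) : ‖zk t s‖ = Real.exp (-(2 * Real.pi * t)) := by
  rw [zk, norm_mul, norm_ee, mul_one, Complex.norm_real, Real.norm_of_nonneg (Real.exp_nonneg _)]

lemma norm_zk_lt {t : ℝ} (ht : 0 < t) (s : ℝ) : ‖zk t s‖ < 1 := by
  rw [norm_zk, Real.exp_lt_one_iff]
  have := Real.pi_pos
  nlinarith [mul_pos this ht]

lemma one_sub_zk_ne {t : ℝ} (ht : 0 < t) (s : ℝ) : 1 - zk t s ≠ 0 := fun h => by
  have := norm_zk_lt ht s
  rw [← sub_eq_zero.1 h] at this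
  simp at this

lemma hasSum_Nk {t : ℝ} (ht : 0 < t) (s : ℝ) :
    HasSum (fun k : ℕ => (k : ℂ) * zk t s ^ k) (Nk t s) :=
  hasSum_coe_mul_geometric_of_norm_lt_one (norm_zk_lt ht s)

lemma continuous_zk (t : ℝ) : Continuous (zk t) := continuous_const.mul continuous_ee

lemma continuous_Nk {t : ℝ} (ht : 0 < t) : Continuous (Nk t) :=
  (continuous_zk t).div ((continuous_const.sub (continuous_zk t)).pow 2)
    fun s => pow_ne_zero 2 (one_sub_zk_ne ht s)

lemma norm_Nk_le {t s : ℝ} (ht : 0 < t) (hs : |s| ≤ 1 / 2) :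
    ‖Nk t s‖ ≤ (1 / 8) * (t + |s|) ^ (-2 : ℝ) := by
  set r := Real.exp (-(2 * Real.pi * t)) with hr
  have hr0 : 0 < r := Real.exp_pos _
  have hzre : (zk t s).re = r * Real.cos (2 * Real.pi * s) := by
    have : ee s = Complex.exp ((2 * Real.pi * s : ℝ) * Complex.I) := by
      rw [ee]; push_cast; ring_nf
    rw [zk, this, Complex.re_ofReal_mul, Complex.exp_ofReal_mul_I_re]
  have h1 : ‖1 - zk t s‖ ^ 2 = 1 - 2 * r * Real.cos (2 * Real.pi * s) + r ^ 2 := by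
    have := norm_zk t s
    have h2 : Complex.normSq (zk t s) = r ^ 2 := by rw [Complex.normSq_eq_norm_sq, this]
    rw [← Complex.normSq_eq_norm_sq, Complex.normSq_sub, h2]
    simp [hzre]; ring
  have hpi := Real.pi_gt_three
  have hcos : Real.cos (2 * Real.pi * s) ≤ 1 - 8 * s ^ 2 := by
    have hb : |2 * Real.pi * s| ≤ Real.pi := by
      rw [abs_mul, abs_of_pos (by positivity)]; nlinarith
    have := Real.cos_le_one_sub_mul_cos_sq hb
    refine this.trans (le_of_eq ?_)
    field_simp; ring
  have hcosh : 2 * r + 4 * Real.pi ^ 2 * t ^ 2 * r ≤ 1 + r ^ 2 := by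
    have h2 : Real.cosh (2 * (Real.pi * t)) = 1 + 2 * Real.sinh (Real.pi * t) ^ 2 := by
      rw [Real.cosh_two_mul, Real.cosh_sq]; ring
    have h3 : Real.pi * t ≤ Real.sinh (Real.pi * t) := Real.self_le_sinh_iff.2 (by positivity)
    have h4 : (Real.pi * t) ^ 2 ≤ Real.sinh (Real.pi * t) ^ 2 :=
      pow_le_pow_left₀ (by positivity) h3 2
    have h5 : 1 + r ^ 2 = 2 * r * Real.cosh (2 * (Real.pi * t)) := by
      rw [Real.cosh_eq, show 2 * (Real.pi * t) = 2 * Real.pi * t by ring, ← hr]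
      have : Real.exp (2 * Real.pi * t) * r = 1 := by rw [hr, ← Real.exp_add]; simp
      nlinarith
    rw [h5, h2]; nlinarith
  have h6 : 8 * (t + |s|) ^ 2 * r ≤ ‖1 - zk t s‖ ^ 2 := by
    rw [h1]
    have : (t + |s|) ^ 2 ≤ 2 * t ^ 2 + 2 * s ^ 2 := by
      rw [← sq_abs s]; nlinarith [sq_nonneg (t - |s|)]
    have h7 : 16 * t ^ 2 * r ≤ 4 * Real.pi ^ 2 * t ^ 2 * r := by
      gcongr; nlinarith
    nlinarith
  have hp : 0 < t + |s| := by positivity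
  rw [Nk, norm_div, norm_pow, norm_zk, ← hr, Real.rpow_neg hp.le, Real.rpow_two,
    div_le_iff₀ (by have := one_sub_zk_ne ht s; positivity)]
  calc r = (1 / 8) * ((t + |s|) ^ 2)⁻¹ * (8 * (t + |s|) ^ 2 * r) := by field_simp
    _ ≤ _ := by gcongr

lemma integral_abs_rpow_le {a t : ℝ} (ha : a < 1) (ht : 0 < t) :
    ∫ s in (-1/2 : ℝ)..(1/2), (t + |s|) ^ (a - 2) ≤ 2 / (1 - a) * t ^ (a - 1) := by
  have hc : Continuous fun s : ℝ => (t + |s|) ^ (a - 2) :=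
    (continuous_const.add continuous_abs).rpow_const fun s =>
      Or.inl (by positivity : 0 < t + |s|).ne'
  have e1 : ∫ s in (0 : ℝ)..(1/2), (t + |s|) ^ (a - 2) ≤ 1 / (1 - a) * t ^ (a - 1) := by
    have : ∫ s in (0 : ℝ)..(1/2), (t + |s|) ^ (a - 2)
        = ∫ s in (0 : ℝ)..(1/2), (t + s) ^ (a - 2) := by
      refine intervalIntegral.integral_congr fun s hs => ?_
      rw [uIcc_of_le (by norm_num)] at hs
      simp only [abs_of_nonneg hs.1]
    rw [this, intervalIntegral.integral_comp_add_left (fun s => s ^ (a - 2)), integral_rpow]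
    · rw [show a - 2 + 1 = -(1 - a) by ring, add_zero, div_neg, ← neg_div, neg_sub]
      have h2 : 0 ≤ (t + 1 / 2) ^ (-(1 - a)) := by positivity
      rw [show a - 1 = -(1 - a) by ring, one_div_mul_eq_div]
      have : 0 < 1 - a := by linarith
      gcongr; linarith
    · right
      refine ⟨by linarith, fun h => ?_⟩
      rw [uIcc_of_le (by linarith)] at h
      linarith [h.1]
  have e2 : ∫ s in (-1/2 : ℝ)..0, (t + |s|) ^ (a - 2)
      = ∫ s in (0 : ℝ)..(1/2), (t + |s|) ^ (a - 2) := by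
    have := intervalIntegral.integral_comp_neg (a := 0) (b := 1/2)
      (fun s : ℝ => (t + |s|) ^ (a - 2))
    simp only [abs_neg, neg_zero] at this
    rw [this]; norm_num
  rw [← intervalIntegral.integral_add_adjacent_intervals (b := 0)
    (hc.intervalIntegrable _ _) (hc.intervalIntegrable _ _), e2]
  calc _ ≤ _ := add_le_add e1 e1
    _ = _ := by ring

/-- The weighted `L¹` bound for the kernel. -/
lemma integral_Nk_le {a t : ℝ} (ha : a ∈ Ico (0 : ℝ) 1) (ht : 0 < t) :
    ∫ s in (-1/2 : ℝ)..(1/2), ‖Nk t s‖ * |s| ^ a ≤ 1 / (1 - a) * t ^ (a - 1) := by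
  have hc : Continuous fun s : ℝ => (1 / 8) * (t + |s|) ^ (a - 2) :=
    continuous_const.mul ((continuous_const.add continuous_abs).rpow_const
      fun s => Or.inl (by positivity : 0 < t + |s|).ne')
  have hc' : Continuous fun s : ℝ => ‖Nk t s‖ * |s| ^ a :=
    (continuous_Nk ht).norm.mul (continuous_abs.rpow_const fun _ => Or.inr ha.1)
  calc _ ≤ ∫ s in (-1/2 : ℝ)..(1/2), (1 / 8) * (t + |s|) ^ (a - 2) := by
        refine intervalIntegral.integral_mono_on (by norm_num) (hc'.intervalIntegrable _ _)
          (hc.intervalIntegrable _ _) fun s hs => ?_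
        have hs' : |s| ≤ 1 / 2 := abs_le.2 ⟨by linarith [hs.1], hs.2⟩
        have hp : 0 < t + |s| := by positivity
        calc _ ≤ (1 / 8) * (t + |s|) ^ (-2 : ℝ) * (t + |s|) ^ a := by
              have := ha.1
              gcongr
              · exact norm_Nk_le ht hs'
              · linarith
          _ = _ := by rw [mul_assoc, ← Real.rpow_add hp]; ring_nf
    _ ≤ (1 / 8) * (2 / (1 - a) * t ^ (a - 1)) := by
        rw [intervalIntegral.integral_const_mul]
        gcongr
        exact integral_abs_rpow_le ha.2 ht
    _ ≤ _ := by
        have : 0 ≤ 1 / (1 - a) * t ^ (a - 1) := by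
          have := ha.2
          have : 0 < 1 - a := by linarith
          positivity
        have e : (1 / 8) * (2 / (1 - a) * t ^ (a - 1))
            = 1/4 * (1 / (1 - a) * t ^ (a - 1)) := by ring
        rw [e]; linarith

end Kernel

section TrigPoly

/-- Trigonometric polynomial of degree `n` with coefficients `c`. -/
def TP (n : ℕ) (c : ℤ → ℂ) (x : ℝ) : ℂ := ∑ k ∈ Finset.Icc (-n : ℤ) n, c k * ee (k * x)

/-- Fourier multiplier `k exp (-2πkt)` on positive modes. -/
def wk (t : ℝ) (k : ℤ) : ℂ := if 0 < k then (k : ℂ) * Real.exp (-(2 * Real.pi * (k * t))) else 0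

lemma continuous_TP (n : ℕ) (c : ℤ → ℂ) : Continuous (TP n c) :=
  continuous_finsetSum _ fun _ _ => continuous_const.mul
    (continuous_ee.comp (continuous_const.mul continuous_id))

lemma integral_Nk_mul_ee {t : ℝ} (ht : 0 < t) (j : ℤ) :
    ∫ s in (-1/2 : ℝ)..(1/2), Nk t s * ee (-(j * s)) = wk t j := by
  have hs : HasSum (fun k : ℕ => ∫ s in (-1/2 : ℝ)..(1/2), ((k : ℂ) * zk t s ^ k) * ee (-(j * s)))
      (∫ s in (-1/2 : ℝ)..(1/2), Nk t s * ee (-(j * s))) := by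
    have hc : Continuous fun s : ℝ => ee (-(j * s)) := continuous_ee.comp (by fun_prop)
    refine intervalIntegral.hasSum_integral_of_dominated_convergence
      (fun k _ => (k : ℝ) * Real.exp (-(2 * Real.pi * t)) ^ k)
      (fun k => ((continuous_const.mul ((continuous_zk t).pow k)).mul hc).aestronglyMeasurable)
      (fun k => .of_forall fun s _ => ?_) (.of_forall fun s _ => ?_) intervalIntegrable_const
      (.of_forall fun s _ => (hasSum_Nk ht s).mul_right _)
    · simp [norm_zk]
    · have h1 : ‖Real.exp (-(2 * Real.pi * t))‖ < 1 := by
        rw [Real.norm_of_nonneg (Real.exp_nonneg _), ← norm_zk t 0]; exact norm_zk_lt ht 0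
      exact (hasSum_coe_mul_geometric_of_norm_lt_one h1).summable
  have he : ∀ k : ℕ, ∫ s in (-1/2 : ℝ)..(1/2), ((k : ℂ) * zk t s ^ k) * ee (-(j * s))
      = if (k : ℤ) = j then wk t j else 0 := by
    intro k
    have hz : ∀ s, ((k : ℂ) * zk t s ^ k) * ee (-(j * s))
        = ((k : ℂ) * Real.exp (-(2 * Real.pi * (k * t)))) * ee (((k : ℤ) - j : ℤ) * s) := by
      intro s
      have h1 : ee s ^ k * ee (-(j * s)) = ee (((k : ℤ) - j : ℤ) * s) := by
        have : ee s ^ k = ee (k * s) := by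
          rw [ee, ee, ← Complex.exp_nat_mul]; push_cast; ring_nf
        rw [this, ← ee_add]; push_cast; ring_nf
      have h2 : ((Real.exp (-(2 * Real.pi * t)) : ℝ) : ℂ) ^ k
          = Real.exp (-(2 * Real.pi * (k * t))) := by
        rw [← Complex.ofReal_pow, ← Real.exp_nat_mul]; ring_nf
      rw [zk, mul_pow, h2, ← h1]; ring
    simp_rw [hz]
    rw [intervalIntegral.integral_const_mul, integral_ee]
    by_cases h : (k : ℤ) = j
    · subst h
      rcases Nat.eq_zero_or_pos k with h0 | h0
      · subst h0; simp [wk]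
      · simp [wk, h0]
    · rw [if_neg (sub_ne_zero.2 h), if_neg h, mul_zero]
  simp_rw [he] at hs
  by_cases hj : 0 ≤ j
  · lift j to ℕ using hj
    have h2 : HasSum (fun k : ℕ => if (k : ℤ) = (j : ℤ) then wk t j else 0) (wk t j) := by
      have := hasSum_ite_eq j (wk t (j : ℤ))
      simpa using this
    exact hs.unique h2
  · have h2 : (fun k : ℕ => if (k : ℤ) = j then wk t j else 0) = fun _ => 0 := by
      funext k; rw [if_neg (by omega)]
    rw [h2] at hs
    rw [hs.unique hasSum_zero, wk, if_neg (by omega)]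

lemma integral_Nk_mul_TP {t : ℝ} (ht : 0 < t) (n : ℕ) (c : ℤ → ℂ) (x : ℝ) :
    ∫ s in (-1/2 : ℝ)..(1/2), Nk t s * TP n c (x - s) = TP n (fun k => wk t k * c k) x := by
  have hz : ∀ s, Nk t s * TP n c (x - s) = ∑ k ∈ Finset.Icc (-n : ℤ) n,
      (c k * ee (k * x)) * (Nk t s * ee (-(k * s))) := by
    intro s
    rw [TP, Finset.mul_sum]
    refine Finset.sum_congr rfl fun k _ => ?_
    have : ee (k * (x - s)) = ee (k * x) * ee (-(k * s)) := by rw [← ee_add]; ring_nf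
    rw [this]; ring
  simp_rw [hz]
  rw [intervalIntegral.integral_finsetSum]
  · refine Finset.sum_congr rfl fun k _ => ?_
    rw [intervalIntegral.integral_const_mul, integral_Nk_mul_ee ht]; ring
  · intro k _
    have hc : Continuous fun s : ℝ => ee (-(k * s)) := continuous_ee.comp (by fun_prop)
    exact (continuous_const.mul ((continuous_Nk ht).mul hc)).intervalIntegrable _ _

lemma integral_Nk {t : ℝ} (ht : 0 < t) : ∫ s in (-1/2 : ℝ)..(1/2), Nk t s = 0 := by
  simpa [wk] using integral_Nk_mul_ee ht 0

lemma norm_TP_wk_le {a t K : ℝ} (ha : a ∈ Ico (0 : ℝ) 1) (ht : 0 < t) (n : ℕ) (c : ℤ → ℂ)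
    (x : ℝ) (C : ℂ) (h : ∀ s, ‖TP n c (x - s) - C‖ ≤ K * |s| ^ a) :
    ‖TP n (fun k => wk t k * c k) x‖ ≤ K * (1 / (1 - a) * t ^ (a - 1)) := by
  have hK : 0 ≤ K := by
    have := h 1; simp at this; exact (norm_nonneg _).trans this
  have hcN := continuous_Nk ht
  have hcT : Continuous fun s => TP n c (x - s) := (continuous_TP n c).comp (by fun_prop)
  have e : TP n (fun k => wk t k * c k) x
      = ∫ s in (-1/2 : ℝ)..(1/2), Nk t s * (TP n c (x - s) - C) := by
    simp_rw [mul_sub]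
    have i1 : Continuous fun s => Nk t s * TP n c (x - s) := hcN.mul hcT
    have i2 : Continuous fun s => Nk t s * C := hcN.mul continuous_const
    rw [intervalIntegral.integral_sub (i1.intervalIntegrable _ _) (i2.intervalIntegrable _ _),
      intervalIntegral.integral_mul_const,
      integral_Nk ht, zero_mul, sub_zero, integral_Nk_mul_TP ht]
  have hc' : Continuous fun s : ℝ => K * (‖Nk t s‖ * |s| ^ a) :=
    continuous_const.mul (hcN.norm.mul (continuous_abs.rpow_const fun _ => Or.inr ha.1))
  rw [e]
  calc _ ≤ ∫ s in (-1/2 : ℝ)..(1/2), K * (‖Nk t s‖ * |s| ^ a) := by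
        refine intervalIntegral.norm_integral_le_of_norm_le (by norm_num)
          (.of_forall fun s _ => ?_) (hc'.intervalIntegrable _ _)
        rw [norm_mul]
        calc _ ≤ ‖Nk t s‖ * (K * |s| ^ a) := by gcongr; exact h s
          _ = _ := by ring
    _ ≤ _ := by
        rw [intervalIntegral.integral_const_mul]
        gcongr
        exact integral_Nk_le ha ht

lemma hasDerivAt_TP (n : ℕ) (c : ℤ → ℂ) (x : ℝ) :
    HasDerivAt (TP n c) (TP n (fun k => 2 * Real.pi * Complex.I * k * c k) x) x := by
  unfold TP
  refine HasDerivAt.fun_sum fun k _ => ?_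
  have := (hasDerivAt_ee k x).const_mul (c k)
  refine this.congr_deriv ?_
  push_cast; ring

lemma wk_half (t : ℝ) (k : ℤ) : wk (t / 2) k * wk (t / 2) k = k * wk t k := by
  unfold wk
  split_ifs
  · have : Real.exp (-(2 * Real.pi * (k * t)))
        = Real.exp (-(2 * Real.pi * (k * (t / 2))))  *
          Real.exp (-(2 * Real.pi * (k * (t / 2)))) := by
      rw [← Real.exp_add]; ring_nf
    rw [this]; push_cast; ring
  · simp

lemma TP_const_mul (n : ℕ) (c : ℤ → ℂ) (z : ℂ) (x : ℝ) :
    TP n (fun k => z * c k) x = z * TP n c x := by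
  unfold TP; rw [Finset.mul_sum]; exact Finset.sum_congr rfl fun k _ => by ring

lemma norm_TP_wk_sub_le {a t K : ℝ} (ha : a ∈ Ioo (0 : ℝ) 1) (ht : 0 < t) (n : ℕ) (c : ℤ → ℂ)
    (h : ∀ x x', ‖TP n c x - TP n c x'‖ ≤ K * |x - x'| ^ a) (x x' : ℝ) :
    ‖TP n (fun k => wk t k * c k) x - TP n (fun k => wk t k * c k) x'‖
      ≤ K * (8 * Real.pi / (1 - a)) * t ^ (a - 2) * |x - x'| := by
  have hpi := Real.pi_pos
  have h1a : 0 < 1 - a := by linarith [ha.2]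
  have hK : 0 ≤ K := by
    have := h 1 0; simp at this; exact (norm_nonneg _).trans this
  refine lip_of_deriv (fun x => hasDerivAt_TP n _ x) (fun y => ?_) x x'
  have e : (fun k : ℤ => 2 * (Real.pi : ℂ) * Complex.I * k * (wk t k * c k))
      = fun k => (2 * (Real.pi : ℂ) * Complex.I) * (wk (t / 2) k * (wk (t / 2) k * c k)) := by
    funext k
    rw [← mul_assoc (wk _ _), wk_half]; ring
  rw [e, TP_const_mul, norm_mul]
  have h0 : ‖2 * (Real.pi : ℂ) * Complex.I‖ = 2 * Real.pi := by simp [abs_of_pos hpi]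
  have h1 : ∀ y, ‖TP n (fun k => wk (t / 2) k * c k) y‖
      ≤ K * (1 / (1 - a) * (t / 2) ^ (a - 1)) := fun y =>
    norm_TP_wk_le ⟨ha.1.le, ha.2⟩ (by positivity) n c y (TP n c y) fun s => by
      have := h (y - s) y
      simpa using this
  have h2 := norm_TP_wk_le (a := 0) ⟨le_rfl, one_pos⟩ (half_pos ht) n
    (fun k => wk (t / 2) k * c k) y 0 (K := K * (1 / (1 - a) * (t / 2) ^ (a - 1))) (fun s => by
      simpa using h1 (y - s))
  have h3 : (t / 2) ^ (a - 1) ≤ 2 * t ^ (a - 1) := by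
    rw [Real.div_rpow ht.le (by norm_num), div_eq_mul_inv, mul_comm, ← Real.rpow_neg (by norm_num)]
    gcongr
    calc (2 : ℝ) ^ (-(a - 1)) ≤ 2 ^ (1 : ℝ) :=
          Real.rpow_le_rpow_of_exponent_le (by norm_num) (by linarith [ha.1])
      _ = 2 := Real.rpow_one 2
  have h4 : t ^ (a - 2) = t ^ (a - 1) / t := by
    rw [← Real.rpow_sub_one ht.ne']; ring_nf
  rw [h0, h4]
  calc _ ≤ 2 * Real.pi * (K * (1 / (1 - a) * (2 * t ^ (a - 1))) *
    (1 / (1 - 0) * (t / 2) ^ ((0 : ℝ) - 1))) := by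
        gcongr
        exact h2.trans (by gcongr)
    _ = _ := by
        rw [zero_sub, Real.rpow_neg_one]
        field_simp; ring

/-- The basic Hölder estimate for the positive-mode solution operator. -/
lemma positive_mode_estimate {a K B : ℝ} (ha : a ∈ Ioo (0 : ℝ) 1) (n : ℕ) (c : ℝ → ℤ → ℂ)
    (hm : ∀ k, Measurable fun t => c t k) (hB : ∀ t k, ‖c t k‖ ≤ B)
    (h : ∀ t x x', ‖TP n (c t) x - TP n (c t) x'‖ ≤ K * |x - x'| ^ a) (x x' : ℝ) :
    ‖TP n (fun k => ∫ t in Ioi (0 : ℝ), wk t k * c t k) x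
      - TP n (fun k => ∫ t in Ioi (0 : ℝ), wk t k * c t k) x'‖
      ≤ (2 / (a * (1 - a)) + 8 * Real.pi / (1 - a) ^ 2) * K * |x - x'| ^ a := by
  have h1a : 0 < 1 - a := by linarith [ha.2]
  have ha0 := ha.1
  have hK : 0 ≤ K := by
    have := h 0 1 0; simp at this; exact (norm_nonneg _).trans this
  have hint : ∀ k : ℤ, MeasureTheory.IntegrableOn (fun t => wk t k * c t k) (Ioi 0) := by
    intro k
    unfold wk
    split_ifs with hk
    · have hk' : (0 : ℝ) < 2 * Real.pi * k := by
        have : (0 : ℝ) < k := by exact_mod_cast hk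
        have := Real.pi_pos
        positivity
      have h1 := (exp_neg_integrableOn_Ioi 0 hk').ofReal (𝕜 := ℂ)
      have h2 := (h1.const_mul (k : ℂ)).mul_bdd (c := B) (hm k).aestronglyMeasurable
        (.of_forall fun t => hB t k)
      refine h2.congr (.of_forall fun t => ?_)
      simp only [RCLike.ofReal_eq_complex_ofReal]; ring_nf
    · simp
  have hTP : ∀ x, TP n (fun k => ∫ t in Ioi (0 : ℝ), wk t k * c t k) x
      = ∫ t in Ioi (0 : ℝ), TP n (fun k => wk t k * c t k) x := by
    intro x
    unfold TP
    rw [MeasureTheory.integral_finsetSum _ fun k _ => (hint k).mul_const _]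
    exact Finset.sum_congr rfl fun k _ => by rw [MeasureTheory.integral_mul_const]
  have hTPi : ∀ x, MeasureTheory.IntegrableOn (fun t => TP n (fun k => wk t k * c t k) x) (Ioi 0) :=
    fun x => MeasureTheory.integrable_finsetSum _ fun k _ => (hint k).mul_const _
  rcases eq_or_ne x x' with rfl | hne
  · simp [Real.zero_rpow ha0.ne']
  set r := |x - x'| with hr
  have hr0 : 0 < r := abs_pos.2 (sub_ne_zero.2 hne)
  rw [hTP, hTP, ← MeasureTheory.integral_sub (hTPi x) (hTPi x')]
  set D : ℝ → ℂ := fun t => TP n (fun k => wk t k * c t k) x - TP n (fun k => wk t k * c t k) x'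
    with hD
  have hDi : MeasureTheory.IntegrableOn D (Ioi 0) := (hTPi x).sub (hTPi x')
  have hsplit : Ioi (0 : ℝ) = Ioc 0 r ∪ Ioi r := (Ioc_union_Ioi_eq_Ioi hr0.le).symm
  have e1 : ∫ t in Ioi (0 : ℝ), D t = (∫ t in Ioc 0 r, D t) + ∫ t in Ioi r, D t := by
    rw [hsplit]
    refine MeasureTheory.setIntegral_union (Ioc_disjoint_Ioi le_rfl) measurableSet_Ioi
      (hDi.mono_set Ioc_subset_Ioi_self) (hDi.mono_set (Ioi_subset_Ioi hr0.le))
  have b1 : ‖∫ t in Ioc 0 r, D t‖ ≤ 2 / (a * (1 - a)) * K * r ^ a := by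
    have hint : IntervalIntegrable (fun t : ℝ => (2 * K / (1 - a)) * t ^ (a - 1))
        MeasureTheory.volume 0 r :=
      (intervalIntegral.intervalIntegrable_rpow' (by linarith)).const_mul _
    have hb := intervalIntegral.norm_integral_le_of_norm_le (f := D) hr0.le
      (.of_forall fun t ht => ?_) hint
    · rw [intervalIntegral.integral_of_le hr0.le, intervalIntegral.integral_const_mul,
        integral_rpow (Or.inl (by linarith))] at hb
      refine hb.trans (le_of_eq ?_)
      rw [sub_add_cancel, Real.zero_rpow ha0.ne']
      field_simp; ring
    · have hx : ∀ x, ‖TP n (fun k => wk t k * c t k) x‖ ≤ K * (1 / (1 - a) * t ^ (a - 1)) :=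
        fun x =>
        norm_TP_wk_le ⟨ha0.le, ha.2⟩ ht.1 n (c t) x (TP n (c t) x) fun s => by
          simpa using h t (x - s) x
      refine (norm_sub_le _ _).trans ((add_le_add (hx x) (hx x')).trans (le_of_eq ?_))
      ring
  have b2 : ‖∫ t in Ioi r, D t‖ ≤ 8 * Real.pi / (1 - a) ^ 2 * K * r ^ a := by
    have hint : MeasureTheory.IntegrableOn
        (fun t : ℝ => (K * (8 * Real.pi / (1 - a)) * r) * t ^ (a - 2)) (Ioi r) :=
      (integrableOn_Ioi_rpow_of_lt (by linarith) hr0).const_mul _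
    have hb := MeasureTheory.norm_integral_le_of_norm_le (f := D) hint
      ((MeasureTheory.ae_restrict_iff' measurableSet_Ioi).2 (.of_forall fun t ht => ?_))
    · rw [MeasureTheory.integral_const_mul, integral_Ioi_rpow_of_lt (by linarith) hr0] at hb
      refine hb.trans (le_of_eq ?_)
      have e : r ^ (a - 2 + 1) = r ^ a / r := by rw [← Real.rpow_sub_one hr0.ne']; ring_nf
      have : a - 2 + 1 ≠ 0 := by linarith
      rw [e, show a - 2 + 1 = -(1 - a) by ring]
      field_simp
    · have := norm_TP_wk_sub_le ha (hr0.trans ht) n (c t) (h t) x x'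
      refine this.trans (le_of_eq ?_)
      ring
  rw [e1]
  refine (norm_add_le _ _).trans ((add_le_add b1 b2).trans (le_of_eq ?_))
  ring

end TrigPoly

section ModeSolver

open MeasureTheory

/-- Bounded solution operator of `θ' = -lθ + f`. -/
def th (l : ℝ) (f : ℝ → ℂ) (y : ℝ) : ℂ := ∫ t in Ioi 0, (Real.exp (-(l * t)) : ℂ) * f (y - t)

lemma th_integrableOn {l B : ℝ} {f : ℝ → ℂ} (hl : 0 < l) (hf : Measurable f)
    (hB : ∀ y, ‖f y‖ ≤ B) (y r : ℝ) :
    IntegrableOn (fun t : ℝ => (Real.exp (-(l * t)) : ℂ) * f (y - t)) (Ioi r) := by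
  have h1 : IntegrableOn (fun t : ℝ => Real.exp (-(l * t)) * B) (Ioi r) := by
    refine ((exp_neg_integrableOn_Ioi r hl).mul_const B).congr (.of_forall fun t => ?_)
    simp only [neg_mul]
  refine Integrable.mono' h1 ?_ (.of_forall fun t => ?_)
  · have m1 : Measurable fun t : ℝ => (Real.exp (-(l * t)) : ℂ) := by fun_prop
    exact (m1.mul (hf.comp (measurable_const.sub measurable_id))).aestronglyMeasurable
  · rw [norm_mul, Complex.norm_real, Real.norm_of_nonneg (Real.exp_nonneg _)]
    gcongr; exact hB _

lemma th_split {l B : ℝ} {f : ℝ → ℂ} (hl : 0 < l) (hf : Measurable f)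
    (hB : ∀ y, ‖f y‖ ≤ B) (y0 y : ℝ) :
    th l f y = Real.exp (-(l * y)) * (Real.exp (l * y0) * th l f y0
      + ∫ s in y0..y, (Real.exp (l * s) : ℂ) * f s) := by
  have h1 := intervalIntegral.integral_interval_add_Ioi (th_integrableOn hl hf hB y 0)
    (th_integrableOn hl hf hB y (y - y0))
  rw [th, ← h1]
  have h2 : ∫ t in Ioi (y - y0), (Real.exp (-(l * t)) : ℂ) * f (y - t)
      = Real.exp (-(l * (y - y0))) * th l f y0 := by
    have e := (measurePreserving_add_right volume (y - y0)).setIntegral_preimage_emb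
      (MeasurableEquiv.addRight (y - y0)).measurableEmbedding
      (fun t => (Real.exp (-(l * t)) : ℂ) * f (y - t)) (Ioi (y - y0))
    rw [← e, th, ← integral_const_mul]
    have : (fun x => x + (y - y0)) ⁻¹' Ioi (y - y0) = Ioi 0 := by ext; simp
    rw [this]
    refine integral_congr_ae (.of_forall fun t => ?_)
    simp only
    rw [show y - (t + (y - y0)) = y0 - t by ring, ← mul_assoc, ← Complex.ofReal_mul,
      ← Real.exp_add]
    ring_nf
  have h3 : ∫ t in (0 : ℝ)..(y - y0), (Real.exp (-(l * t)) : ℂ) * f (y - t)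
      = Real.exp (-(l * y)) * ∫ s in y0..y, (Real.exp (l * s) : ℂ) * f s := by
    have e := intervalIntegral.integral_comp_sub_left (a := 0) (b := y - y0)
      (fun s => (Real.exp (-(l * (y - s))) : ℂ) * f s) y
    simp only [sub_sub_cancel, sub_zero] at e
    rw [e, ← intervalIntegral.integral_const_mul]
    refine intervalIntegral.integral_congr fun s _ => ?_
    rw [← mul_assoc, ← Complex.ofReal_mul, ← Real.exp_add]
    ring_nf
  rw [h2, h3, mul_add, ← mul_assoc, ← Complex.ofReal_mul, ← Real.exp_add]
  ring_nf

lemma th_hasDerivWithinAt {l B : ℝ} {f g : ℝ → ℂ} (hl : 0 < l) (hf : Measurable f)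
    (hB : ∀ y, ‖f y‖ ≤ B) {y0 y1 : ℝ} (hg : Continuous g) (he : EqOn f g (Ioo y0 y1)) {y : ℝ}
    (hy : y ∈ Icc y0 y1) :
    HasDerivWithinAt (th l f) (-(l * th l f y) + g y) (Icc y0 y1) y := by
  have hcE : Continuous fun s : ℝ => (Real.exp (l * s) : ℂ) * g s :=
    (Complex.continuous_ofReal.comp (by fun_prop)).mul hg
  have key : ∀ y ∈ Icc y0 y1, th l f y = Real.exp (-(l * y)) * (Real.exp (l * y0) * th l f y0
      + ∫ s in y0..y, (Real.exp (l * s) : ℂ) * g s) := by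
    intro y hy
    rw [th_split hl hf hB y0 y]
    congr 2
    refine intervalIntegral.integral_congr_ae ?_
    have : ∀ᵐ s : ℝ, s ≠ y := by simp [ae_iff]
    filter_upwards [this] with s hs1 hs
    rw [uIoc_of_le hy.1] at hs
    rw [he ⟨hs.1, (lt_of_le_of_ne hs.2 hs1).trans_le hy.2⟩]
  have d1 : HasDerivAt (fun y : ℝ => (Real.exp (-(l * y)) : ℂ))
      (((Real.exp (-(l * y)) * (-(l * 1)) : ℝ) : ℂ)) y :=
    (((hasDerivAt_id y).const_mul l).neg.exp).ofReal_comp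
  have d2 := (intervalIntegral.integral_hasDerivAt_right (hcE.intervalIntegrable y0 y)
    (hcE.stronglyMeasurableAtFilter _ _) hcE.continuousAt).const_add (Real.exp (l * y0) * th l f y0)
  have d := (d1.mul d2).hasDerivWithinAt (s := Icc y0 y1)
  refine (d.congr key (key y hy)).congr_deriv ?_
  rw [key y hy]
  have : (Real.exp (-(l * y)) : ℂ) * (Real.exp (l * y) * g y) = g y := by
    rw [← mul_assoc, ← Complex.ofReal_mul, ← Real.exp_add]; simp
  rw [this]; push_cast; ring

/-- Extension from `[0, L]` to a `2L`-periodic function, equal to `d (-y)` on `(-L, 0)`. -/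
def pext (L : ℝ) (c d : ℝ → ℂ) (y : ℝ) : ℂ :=
  if 2 * L * Int.fract (y / (2 * L)) ≤ L then c (2 * L * Int.fract (y / (2 * L)))
  else d (2 * L - 2 * L * Int.fract (y / (2 * L)))

variable {L : ℝ} {c d : ℝ → ℂ}

lemma pext_measurable (hc : Measurable c) (hd : Measurable d) : Measurable (pext L c d) := by
  have m : Measurable fun y : ℝ => 2 * L * Int.fract (y / (2 * L)) :=
    (measurable_fract.comp (measurable_id.div_const _)).const_mul _
  exact Measurable.ite (measurableSet_le m measurable_const) (hc.comp m)
    (hd.comp (measurable_const.sub m))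

lemma pext_norm_le {B : ℝ} (hc : ∀ y, ‖c y‖ ≤ B) (hd : ∀ y, ‖d y‖ ≤ B) (y : ℝ) :
    ‖pext L c d y‖ ≤ B := by
  unfold pext; split_ifs
  · exact hc _
  · exact hd _

lemma pext_per (hL : 0 < L) (y : ℝ) : pext L c d (y + 2 * L) = pext L c d y := by
  have : Int.fract ((y + 2 * L) / (2 * L)) = Int.fract (y / (2 * L)) := by
    rw [add_div, div_self (by positivity)]; exact Int.fract_add_one _
  unfold pext; rw [this]

lemma pext_pos (hL : 0 < L) : EqOn (pext L c d) c (Ioo 0 L) := by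
  intro y hy
  have h : Int.fract (y / (2 * L)) = y / (2 * L) := by
    refine Int.fract_eq_self.2 ⟨div_nonneg hy.1.le (by positivity), ?_⟩
    rw [div_lt_one (by positivity)]; linarith [hy.1, hy.2]
  have h2 : 2 * L * Int.fract (y / (2 * L)) = y := by rw [h]; field_simp
  unfold pext; rw [h2, if_pos hy.2.le]

lemma pext_neg (hL : 0 < L) : EqOn (pext L c d) (fun y => d (-y)) (Ioo (-L) 0) := by
  intro y hy
  rw [← pext_per hL]
  have h : Int.fract ((y + 2 * L) / (2 * L)) = (y + 2 * L) / (2 * L) := by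
    refine Int.fract_eq_self.2 ⟨div_nonneg (by linarith [hy.1]) (by positivity), ?_⟩
    rw [div_lt_one (by positivity)]; linarith [hy.2]
  have h2 : 2 * L * Int.fract ((y + 2 * L) / (2 * L)) = y + 2 * L := by rw [h]; field_simp
  unfold pext; rw [h2, if_neg (by linarith [hy.1])]
  ring_nf

lemma TP_conj (n : ℕ) (c : ℤ → ℂ) (x : ℝ) :
    TP n (fun k => (starRingEnd ℂ) (c (-k))) x = (starRingEnd ℂ) (TP n c x) := by
  unfold TP
  rw [map_sum]
  refine Finset.sum_nbij' (fun k => -k) (fun k => -k) ?_ ?_ ?_ ?_ ?_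
  · intro k hk; simp at hk ⊢; omega
  · intro k hk; simp at hk ⊢; omega
  · simp
  · simp
  · intro k _
    rw [map_mul, ← ee_neg]; push_cast; ring_nf

lemma TP_add (n : ℕ) (c d : ℤ → ℂ) (x : ℝ) : TP n (fun k => c k + d k) x = TP n c x + TP n d x := by
  unfold TP; rw [← Finset.sum_add_distrib]; exact Finset.sum_congr rfl fun k _ => by ring

lemma TP_sub (n : ℕ) (c d : ℤ → ℂ) (x : ℝ) : TP n (fun k => c k - d k) x = TP n c x - TP n d x := by
  unfold TP; rw [← Finset.sum_sub_distrib]; exact Finset.sum_congr rfl fun k _ => by ring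

lemma TP_per (n : ℕ) (c : ℤ → ℂ) (x : ℝ) : TP n c (x + 1) = TP n c x := by
  unfold TP
  refine Finset.sum_congr rfl fun k _ => ?_
  rw [mul_add, ee_add, mul_one, ee_int, mul_one]

lemma integral_TP (n : ℕ) (c : ℤ → ℂ) (x : ℝ) :
    ∫ s in (-1/2 : ℝ)..(1/2), TP n c (x - s) = c 0 := by
  unfold TP
  rw [intervalIntegral.integral_finsetSum]
  · have : ∀ k : ℤ, ∫ s in (-1/2 : ℝ)..(1/2), c k * ee (k * (x - s))
      = if k = 0 then c 0 else 0 := by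
      intro k
      have e : ∀ s : ℝ, c k * ee (k * (x - s)) = (c k * ee (k * x)) * ee ((-k : ℤ) * s) := by
        intro s; rw [mul_assoc, ← ee_add]; push_cast; ring_nf
      simp_rw [e]
      rw [intervalIntegral.integral_const_mul, integral_ee]
      split_ifs with h1 h2 h2
      · subst h2; simp
      · omega
      · omega
      · simp
    simp_rw [this]
    simp
  · intro k _
    exact (continuous_const.mul (continuous_ee.comp (by fun_prop))).intervalIntegrable _ _

/-- A trigonometric polynomial with zero mean is bounded by its oscillation. -/
lemma norm_TP_sub_le {D : ℝ} (n : ℕ) (c : ℤ → ℂ) (x : ℝ)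
    (h : ∀ s : ℝ, |s| ≤ 1 / 2 → ‖TP n c x - TP n c (x - s)‖ ≤ D) : ‖TP n c x - c 0‖ ≤ D := by
  have hc : Continuous fun s => TP n c (x - s) := (continuous_TP n c).comp (by fun_prop)
  have e : TP n c x - c 0 = ∫ s in (-1/2 : ℝ)..(1/2), (TP n c x - TP n c (x - s)) := by
    rw [intervalIntegral.integral_sub (by simp) (hc.intervalIntegrable _ _), integral_TP]
    simp; norm_num
  rw [e]
  have := intervalIntegral.norm_integral_le_of_norm_le_const (a := (-1/2 : ℝ)) (b := 1/2) (C := D)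
    (f := fun s => TP n c x - TP n c (x - s)) (fun s hs => h s ?_)
  · refine this.trans (le_of_eq ?_)
    norm_num
  · rw [uIoc_of_le (by norm_num)] at hs
    rw [abs_le]; constructor <;> linarith [hs.1, hs.2]

end ModeSolver

section FiniteModes

open MeasureTheory

lemma G1.sum {E ι : Type*} [NormedAddCommGroup E] [NormedSpace ℝ E] {L : ℝ} (s : Finset ι)
    {f fx fy : ι → ℝ × ℝ → E} (h : ∀ i ∈ s, G1 L (f i) (fx i) (fy i)) :
    G1 L (fun z => ∑ i ∈ s, f i z) (fun z => ∑ i ∈ s, fx i z) (fun z => ∑ i ∈ s, fy i z) := by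
  intro z hz
  have e : lin (∑ i ∈ s, fx i z) (∑ i ∈ s, fy i z) = ∑ i ∈ s, lin (fx i z) (fy i z) := by
    ext <;> simp
  rw [e]; exact HasFDerivWithinAt.fun_sum fun i hi => h i hi z hz

lemma G1.mode {L : ℝ} {w w' : ℝ → ℂ} (k : ℝ)
    (hw : ∀ y ∈ Icc 0 L, HasDerivWithinAt w (w' y) (Icc 0 L) y) :
    G1 L (fun z => w z.2 * ee (k * z.1))
      (fun z => 2 * Real.pi * Complex.I * k * w z.2 * ee (k * z.1))
      (fun z => w' z.2 * ee (k * z.1)) := by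
  intro z hz
  have h := (G1.of_snd hw z hz).mul (G1.of_fst (L := L) (fun t => hasDerivAt_ee k t) z hz)
  refine h.congr_fderiv ?_
  ext
  · simp; ring
  · simp; ring

/-- Fourier coefficients of the extended data. -/
def ce (L : ℝ) (c : ℤ → ℝ → ℂ) (k : ℤ) : ℝ → ℂ :=
  pext L (c k) fun s => (starRingEnd ℂ) (c (-k) s)

/-- `k` times the bounded solution of `θ' = -2πkθ + ce k`, on positive modes. -/
def ak (L : ℝ) (c : ℤ → ℝ → ℂ) (k : ℤ) (y : ℝ) : ℂ := ∫ t in Ioi 0, wk t k * ce L c k (y - t)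

/-- Fourier coefficients of the solution. -/
def wm (L : ℝ) (c : ℤ → ℝ → ℂ) (k : ℤ) (y : ℝ) : ℂ :=
  -Complex.I / k * (ak L c k y + (starRingEnd ℂ) (ak L c (-k) (-y)))

variable {L B : ℝ} {c : ℤ → ℝ → ℂ}

lemma ak_pos {k : ℤ} (hk : 0 < k) (y : ℝ) :
    ak L c k y = k * th (2 * Real.pi * k) (ce L c k) y := by
  rw [ak, th, ← integral_const_mul]
  refine integral_congr_ae (.of_forall fun t => ?_)
  simp only [wk, if_pos hk]
  ring_nf

lemma ak_nonpos {k : ℤ} (hk : k ≤ 0) (y : ℝ) : ak L c k y = 0 := by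
  rw [ak]; simp [wk, not_lt.2 hk]

lemma ce_measurable (hc : ∀ k, Continuous (c k)) (k : ℤ) : Measurable (ce L c k) :=
  pext_measurable (hc k).measurable (Complex.continuous_conj.comp (hc (-k))).measurable

lemma ce_norm_le (hB : ∀ k y, ‖c k y‖ ≤ B) (k : ℤ) (y : ℝ) : ‖ce L c k y‖ ≤ B :=
  pext_norm_le (hB k) (fun y => by simpa using hB (-k) y) y

lemma ak_deriv_pos (hL : 0 < L) (hc : ∀ k, Continuous (c k)) (hB : ∀ k y, ‖c k y‖ ≤ B) {k : ℤ}
    (hk : 0 < k) {y : ℝ} (hy : y ∈ Icc 0 L) :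
    HasDerivWithinAt (ak L c k) (-(2 * Real.pi * k * ak L c k y) + k * c k y) (Icc 0 L) y := by
  have hl : 0 < 2 * Real.pi * k := by have := Real.pi_pos; positivity
  have h := (th_hasDerivWithinAt hl (ce_measurable hc k) (ce_norm_le hB k) (hc k)
    (pext_pos hL) hy).const_mul (k : ℂ)
  rw [funext (ak_pos hk)]
  refine h.congr_deriv ?_
  push_cast; ring

lemma ak_deriv_neg (hL : 0 < L) (hc : ∀ k, Continuous (c k)) (hB : ∀ k y, ‖c k y‖ ≤ B) {k : ℤ}
    (hk : 0 < k) {y : ℝ} (hy : y ∈ Icc (-L) 0) :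
    HasDerivWithinAt (ak L c k)
      (-(2 * Real.pi * k * ak L c k y) + k * (starRingEnd ℂ) (c (-k) (-y))) (Icc (-L) 0) y := by
  have hl : 0 < 2 * Real.pi * k := by have := Real.pi_pos; positivity
  have h := (th_hasDerivWithinAt hl (ce_measurable hc k) (ce_norm_le hB k)
    (Complex.continuous_conj.comp ((hc (-k)).comp continuous_neg))
      (pext_neg hL) hy).const_mul (k : ℂ)
  rw [funext (ak_pos hk)]
  refine h.congr_deriv ?_
  simp only [Function.comp_apply]
  push_cast; ring

lemma ak_per (hL : 0 < L) (k : ℤ) (y : ℝ) : ak L c k (y + 2 * L) = ak L c k y := by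
  rw [ak, ak]
  refine integral_congr_ae (.of_forall fun t => ?_)
  simp only
  rw [show y + 2 * L - t = y - t + 2 * L by ring, ce, pext_per hL]

lemma wm_deriv (hL : 0 < L) (hc : ∀ k, Continuous (c k)) (hB : ∀ k y, ‖c k y‖ ≤ B) {k : ℤ}
    (hk : k ≠ 0) {y : ℝ} (hy : y ∈ Icc 0 L) :
    HasDerivWithinAt (wm L c k) (-(2 * Real.pi * k * wm L c k y) - Complex.I * c k y)
      (Icc 0 L) y := by
  have hk' : (k : ℂ) ≠ 0 := by exact_mod_cast hk
  rcases lt_or_gt_of_ne hk with h | h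
  · have e : wm L c k = fun y => -Complex.I / k * (starRingEnd ℂ) (ak L c (-k) (-y)) := by
      funext y; rw [wm, ak_nonpos h.le, zero_add]
    have hy' : -y ∈ Icc (-L) 0 := ⟨by linarith [hy.2], by linarith [hy.1]⟩
    have d1 := ak_deriv_neg hL hc hB (k := -k) (by omega) hy'
    have d2 := d1.scomp y ((hasDerivAt_neg y).hasDerivWithinAt (s := Icc 0 L))
      (fun t ht => ⟨by simpa using ht.2, by simpa using ht.1⟩)
    have d3 := (Complex.conjCLE.toContinuousLinearMap.hasFDerivAt.comp_hasDerivWithinAt y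
      d2).const_mul (-Complex.I / k)
    rw [e]
    refine d3.congr_deriv ?_
    simp [Complex.conj_ofNat]
    field_simp
    ring
  · have e : wm L c k = fun y => -Complex.I / k * ak L c k y := by
      funext y; rw [wm, ak_nonpos (k := -k) (by omega)]; simp
    rw [e]
    refine ((ak_deriv_pos hL hc hB h hy).const_mul (-Complex.I / k)).congr_deriv ?_
    field_simp
    ring

lemma wm_conj (k : ℤ) (y : ℝ) :
    (starRingEnd ℂ) (wm L c (-k) y) = wm L c k (-y) := by
  rcases eq_or_ne k 0 with rfl | hk
  · simp [wm]
  · have hk' : (k : ℂ) ≠ 0 := by exact_mod_cast hk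
    rw [wm, wm, map_mul, map_add, map_div₀, map_neg, Complex.conj_I, Complex.conj_conj, neg_neg,
      neg_neg, map_intCast]
    push_cast
    field_simp
    ring

lemma two_pi_mul_wm (n : ℕ) (x y : ℝ) :
    TP n (fun k => 2 * Real.pi * Complex.I * k * wm L c k y) x
      = 2 * Real.pi * (TP n (fun k => ak L c k y) x
        + (starRingEnd ℂ) (TP n (fun k => ak L c k (-y)) x)) := by
  rw [← TP_conj, ← TP_add, ← TP_const_mul]
  congr 1; funext k
  rcases eq_or_ne k 0 with rfl | hk
  · simp [ak_nonpos]
  · have hk' : (k : ℂ) ≠ 0 := by exact_mod_cast hk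
    rw [wm]; field_simp; rw [Complex.I_sq]; ring

lemma TP_ce_le {a K : ℝ} (hL : 0 < L) (n : ℕ)
    (hF : ∀ y ∈ Icc 0 L, Ho a K univ fun x => TP n (fun k => c k y) x) (y x x' : ℝ) :
    ‖TP n (fun k => ce L c k y) x - TP n (fun k => ce L c k y) x'‖ ≤ K * |x - x'| ^ a := by
  have h0 := Int.fract_nonneg (y / (2 * L))
  have h1 := Int.fract_lt_one (y / (2 * L))
  unfold ce pext
  split_ifs with h
  · have := (hF _ ⟨by positivity, h⟩).2 x trivial x' trivial
    simpa using this
  · have := (hF (2 * L - 2 * L * Int.fract (y / (2 * L))) ⟨by nlinarith, by linarith⟩).2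
      x trivial x' trivial
    have e := TP_conj n (fun k => c k (2 * L - 2 * L * Int.fract (y / (2 * L))))
    rw [e, e, ← map_sub, RCLike.norm_conj]
    simpa using this

end FiniteModes

section FiniteSolver

open MeasureTheory

/-- Hölder constant of the mode solver. -/
def CE (a : ℝ) : ℝ := 2 / (a * (1 - a)) + 8 * Real.pi / (1 - a) ^ 2

lemma CE_nonneg {a : ℝ} (ha : a ∈ Ioo (0 : ℝ) 1) : 0 ≤ CE a := by
  have := Real.pi_pos
  have h1 := ha.1
  have h2 : 0 < 1 - a := by linarith [ha.2]
  unfold CE; positivity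

variable {L B a K : ℝ} {c : ℤ → ℝ → ℂ} {n : ℕ}

lemma TP_ak_le (ha : a ∈ Ioo (0 : ℝ) 1) (hL : 0 < L) (hc : ∀ k, Continuous (c k))
    (hB : ∀ k y, ‖c k y‖ ≤ B)
    (hF : ∀ y ∈ Icc 0 L, Ho a K univ fun x => TP n (fun k => c k y) x) (y x x' : ℝ) :
    ‖TP n (fun k => ak L c k y) x - TP n (fun k => ak L c k y) x'‖ ≤ CE a * K * |x - x'| ^ a :=
  positive_mode_estimate ha n (fun t k => ce L c k (y - t))
    (fun k => (ce_measurable hc k).comp (measurable_const.sub measurable_id))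
    (fun _ k => ce_norm_le hB k _) (fun t x x' => TP_ce_le hL n hF (y - t) x x') x x'

lemma TP_wmx_le (ha : a ∈ Ioo (0 : ℝ) 1) (hL : 0 < L) (hc : ∀ k, Continuous (c k))
    (hB : ∀ k y, ‖c k y‖ ≤ B)
    (hF : ∀ y ∈ Icc 0 L, Ho a K univ fun x => TP n (fun k => c k y) x) (y : ℝ) :
    Ho a (4 * Real.pi * CE a * K) univ
      fun x => TP n (fun k => 2 * Real.pi * Complex.I * k * wm L c k y) x := by
  have hpi := Real.pi_pos
  have hK : 0 ≤ K := (hF 0 ⟨le_rfl, hL.le⟩).nonneg univ_nonempty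
  have hCE := CE_nonneg ha
  have key : ∀ x x', ‖TP n (fun k => 2 * Real.pi * Complex.I * k * wm L c k y) x
      - TP n (fun k => 2 * Real.pi * Complex.I * k * wm L c k y) x'‖
      ≤ 4 * Real.pi * CE a * K * |x - x'| ^ a := by
    intro x x'
    have e : ∀ z : ℂ, ‖2 * (Real.pi : ℂ) * z‖ = 2 * Real.pi * ‖z‖ := fun z => by
      simp [abs_of_pos hpi]
    rw [two_pi_mul_wm, two_pi_mul_wm, ← mul_sub, add_sub_add_comm, ← map_sub, e]
    have h1 := TP_ak_le ha hL hc hB hF y x x'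
    have h2 := TP_ak_le ha hL hc hB hF (-y) x x'
    have h3 := norm_add_le (TP n (fun k => ak L c k y) x - TP n (fun k => ak L c k y) x')
      ((starRingEnd ℂ) (TP n (fun k => ak L c k (-y)) x - TP n (fun k => ak L c k (-y)) x'))
    rw [RCLike.norm_conj] at h3
    nlinarith
  refine ⟨fun x _ => ?_, fun x _ x' _ => by simpa using key x x'⟩
  have := norm_TP_sub_le (D := 4 * Real.pi * CE a * K) n
    (fun k => 2 * Real.pi * Complex.I * k * wm L c k y) x fun s hs => by
      refine (key _ _).trans (mul_le_of_le_one_right (by positivity) ?_)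
      rw [sub_sub_cancel]
      exact Real.rpow_le_one (abs_nonneg _) (by linarith) ha.1.le
  simpa using this

lemma norm_TP_wm_le (ha : a ∈ Ioo (0 : ℝ) 1) (hL : 0 < L) (hc : ∀ k, Continuous (c k))
    (hB : ∀ k y, ‖c k y‖ ≤ B)
    (hF : ∀ y ∈ Icc 0 L, Ho a K univ fun x => TP n (fun k => c k y) x) (y x : ℝ) :
    ‖TP n (fun k => wm L c k y) x‖ ≤ 4 * Real.pi * CE a * K := by
  have hpi := Real.pi_pos
  have hK : 0 ≤ K := (hF 0 ⟨le_rfl, hL.le⟩).nonneg univ_nonempty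
  have hCE := CE_nonneg ha
  have := norm_TP_sub_le (D := 4 * Real.pi * CE a * K) n (fun k => wm L c k y) x fun s hs => by
    refine (lip_of_deriv (fun x => hasDerivAt_TP n (fun k => wm L c k y) x)
      (fun x => (TP_wmx_le ha hL hc hB hF y).1 x trivial) x (x - s)).trans
      (mul_le_of_le_one_right (by positivity) ?_)
    rw [sub_sub_cancel]; linarith
  simpa [wm] using this

/-- Solver for `(∂ₓ + i ∂_y) W = F`, `Im W = 0` on the boundary, for trigonometric polynomials. -/
theorem exists_solution_TP (ha : a ∈ Ioo (0 : ℝ) 1) (hL : 0 < L) (hc : ∀ k, Continuous (c k))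
    (hB : ∀ k y, ‖c k y‖ ≤ B) (h0 : ∀ y, (c 0 y).re = 0)
    (hF : ∀ y ∈ Icc 0 L, Ho a K univ fun x => TP n (fun k => c k y) x) :
    ∃ W Wx : ℝ × ℝ → ℂ,
      G1 L W Wx (fun z => -Complex.I * (TP n (fun k => c k z.2) z.1 - Wx z)) ∧ PerX W ∧ PerX Wx ∧
      (∀ x, (W (x, 0)).im = 0) ∧ (∀ x, (W (x, L)).im = 0) ∧
      ∫ y in (0 : ℝ)..L, (W (0, y)).re = 0 ∧
      (∀ y ∈ Icc 0 L, Ho a (4 * Real.pi * CE a * K) univ fun x => Wx (x, y)) ∧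
      ∀ z ∈ strip L, ‖W z‖ ≤ 2 * (4 * Real.pi * CE a + L) * K := by
  have hpi := Real.pi_pos
  have hK : 0 ≤ K := (hF 0 ⟨le_rfl, hL.le⟩).nonneg univ_nonempty
  have hCE := CE_nonneg ha
  have hci : Continuous fun y => (c 0 y).im := Complex.continuous_im.comp (hc 0)
  set P : ℝ → ℝ := fun y => ∫ s in (0 : ℝ)..y, (c 0 s).im with hP
  have hPd : ∀ y, HasDerivAt P (c 0 y).im y := fun y =>
    intervalIntegral.integral_hasDerivAt_right (hci.intervalIntegrable _ _)
      (hci.stronglyMeasurableAtFilter _ _) hci.continuousAt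
  have hc0 : ∀ y ∈ Icc 0 L, ‖c 0 y‖ ≤ K := by
    intro y hy
    rw [← integral_TP n (fun k => c k y) 0]
    refine (intervalIntegral.norm_integral_le_of_norm_le_const
      (fun s _ => (hF y hy).1 (0 - s) trivial)).trans (le_of_eq ?_)
    norm_num
  have hPb : ∀ y ∈ Icc 0 L, |P y| ≤ L * K := by
    intro y hy
    refine (intervalIntegral.norm_integral_le_of_norm_le_const (C := K)
      (f := fun s => (c 0 s).im) (fun s hs => ?_)).trans ?_
    · rw [uIoc_of_le hy.1] at hs
      exact (Complex.abs_im_le_norm _).trans (hc0 s ⟨hs.1.le, hs.2.trans hy.2⟩)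
    · rw [sub_zero, abs_of_nonneg hy.1, mul_comm]
      exact mul_le_mul_of_nonneg_right hy.2 hK
  have hG : G1 L (fun z => TP n (fun k => wm L c k z.2) z.1 + (P z.2 : ℂ))
      (fun z => TP n (fun k => 2 * Real.pi * Complex.I * k * wm L c k z.2) z.1)
      (fun z => -Complex.I * (TP n (fun k => c k z.2) z.1
        - TP n (fun k => 2 * Real.pi * Complex.I * k * wm L c k z.2) z.1)) := by
    have h1 := G1.sum (E := ℂ) (L := L) (Finset.Icc (-n : ℤ) n)
      (f := fun k z => wm L c k z.2 * ee (k * z.1))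
      (fx := fun k z => 2 * Real.pi * Complex.I * k * wm L c k z.2 * ee (k * z.1))
      (fy := fun k z => (-Complex.I * ((if k = 0 then 0 else c k z.2)
        - 2 * Real.pi * Complex.I * k * wm L c k z.2)) * ee (k * z.1)) (by
      intro k _
      have := G1.mode (L := L) (w := wm L c k)
        (w' := fun y => -Complex.I * ((if k = 0 then 0 else c k y)
          - 2 * Real.pi * Complex.I * k * wm L c k y)) k (by
        intro y hy
        rcases eq_or_ne k 0 with rfl | hk
        · have : wm L c 0 = fun _ => 0 := by funext y; simp [wm]
          rw [this]; simpa using hasDerivWithinAt_const y (Icc 0 L) (0 : ℂ)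
        · refine (wm_deriv hL hc hB hk hy).congr_deriv ?_
          rw [if_neg hk]; linear_combination (-2 * Real.pi * k * wm L c k y) * Complex.I_sq)
      simpa using this)
    have h2 : G1 L (fun z => (P z.2 : ℂ)) (fun _ => 0) (fun z => -Complex.I * c 0 z.2) := by
      refine (G1.of_snd (φ := fun y => (P y : ℂ)) (φ' := fun y => ((c 0 y).im : ℂ))
        fun y _ => (hPd y).ofReal_comp.hasDerivWithinAt).congr (fun _ _ => rfl) (fun _ _ => rfl) ?_
      intro z _
      apply Complex.ext <;> simp [h0]
    refine (h1.add h2).congr (fun _ _ => rfl) (fun z _ => by simp [TP]) fun z _ => ?_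
    have e : ∀ k : ℤ, (-Complex.I * ((if k = 0 then 0 else c k z.2)
          - 2 * Real.pi * Complex.I * k * wm L c k z.2)) * ee (k * z.1)
        = -Complex.I * (c k z.2 * ee (k * z.1)
          - 2 * Real.pi * Complex.I * k * wm L c k z.2 * ee (k * z.1))
          + if k = 0 then Complex.I * c 0 z.2 else 0 := by
      intro k; split_ifs with hk
      · subst hk; simp
      · ring
    simp only [e, TP]
    rw [Finset.sum_add_distrib, ← Finset.mul_sum, Finset.sum_sub_distrib]
    simp
  have hwc : ContinuousOn (fun y : ℝ => (TP n (fun k => wm L c k y) 0 + (P y : ℂ)).re)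
      (Icc 0 L) := by
    refine Complex.continuous_re.comp_continuousOn (hG.continuousOn.comp
      (f := fun y : ℝ => ((0 : ℝ), y)) (by fun_prop) fun y hy => mem_strip.2 hy)
  set J := ∫ y in (0 : ℝ)..L, (TP n (fun k => wm L c k y) 0 + (P y : ℂ)).re with hJ
  have hWb : ∀ z ∈ strip L, ‖TP n (fun k => wm L c k z.2) z.1 + (P z.2 : ℂ)‖
      ≤ (4 * Real.pi * CE a + L) * K := by
    intro z hz
    have h1 := norm_TP_wm_le ha hL hc hB hF z.2 z.1
    have h2 := hPb z.2 hz.2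
    have h3 : ‖(P z.2 : ℂ)‖ = |P z.2| := by simp
    refine (norm_add_le _ _).trans ?_
    rw [h3]; linarith
  have hJb : |J| ≤ (4 * Real.pi * CE a + L) * K * L := by
    refine (intervalIntegral.norm_integral_le_of_norm_le_const
      (f := fun y => (TP n (fun k => wm L c k y) 0 + (P y : ℂ)).re)
      (C := (4 * Real.pi * CE a + L) * K) fun y hy => ?_).trans (by rw [sub_zero, abs_of_pos hL])
    rw [uIoc_of_le hL.le] at hy
    exact (Complex.abs_re_le_norm _).trans (hWb (0, y) (mem_strip.2 ⟨hy.1.le, hy.2⟩))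
  have hreal : ∀ x y : ℝ, (∀ k, wm L c k (-y) = wm L c k y) →
      (TP n (fun k => wm L c k y) x).im = 0 := by
    intro x y h
    rw [← Complex.conj_eq_iff_im, ← TP_conj]
    congr 1; funext k
    rw [wm_conj, h]
  refine ⟨fun z => TP n (fun k => wm L c k z.2) z.1 + (P z.2 : ℂ) - ((J / L : ℝ) : ℂ),
    fun z => TP n (fun k => 2 * Real.pi * Complex.I * k * wm L c k z.2) z.1, ?_, ?_, ?_, ?_, ?_, ?_,
    fun y _ => TP_wmx_le ha hL hc hB hF y, ?_⟩
  · exact (hG.sub (G1.const _)).congr (fun _ _ => rfl) (fun _ _ => by simp) (fun _ _ => by simp)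
  · intro x y; simp only [TP_per]
  · intro x y; simp only [TP_per]
  · intro x; simp [hreal x 0 (by simp)]
  · intro x
    have : ∀ k, wm L c k (-L) = wm L c k L := by
      intro k
      have h1 := ak_per (c := c) hL k (-L)
      have h2 := ak_per (c := c) hL (-k) (-L)
      rw [show -L + 2 * L = L by ring] at h1 h2
      rw [wm, wm, neg_neg, h1, h2]
    simp [hreal x L this]
  · have : ∀ y : ℝ, (TP n (fun k => wm L c k y) 0 + (P y : ℂ) - ((J / L : ℝ) : ℂ)).re
        = (TP n (fun k => wm L c k y) 0 + (P y : ℂ)).re - J / L := fun y => by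
      rw [Complex.sub_re, Complex.ofReal_re]
    simp only [this]
    rw [intervalIntegral.integral_sub
      (hwc.intervalIntegrable_of_Icc hL.le) (by simp), ← hJ]
    simp; field_simp; simp
  · intro z hz
    refine (norm_sub_le _ _).trans ?_
    have h1 := hWb z hz
    have h2 : ‖((J / L : ℝ) : ℂ)‖ ≤ (4 * Real.pi * CE a + L) * K := by
      rw [Complex.norm_real, Real.norm_eq_abs, abs_div, abs_of_pos hL, div_le_iff₀ hL]
      exact hJb
    linarith

end FiniteSolver

section Divergence

open MeasureTheory

variable {L : ℝ}

lemma PerX.fract {F : Type*} {f : ℝ × ℝ → F} (h : PerX f) (x y : ℝ) :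
    f (x, y) = f (Int.fract x, y) := by
  have hp : Function.Periodic (fun x => f (x, y)) 1 := fun x => h x y
  have := hp.sub_int_mul_eq (x := x) ⌊x⌋
  simp only [mul_one] at this
  exact this.symm

lemma PerX.of_partials {f fx fy : ℝ × ℝ → ℝ} (hL : 0 ≤ L) (h : G1 L f fx fy) (hx : PerX fx)
    (hy : PerX fy) (h0 : f (1, 0) = f (0, 0)) (x : ℝ) {y : ℝ} (hy0 : y ∈ Icc 0 L) :
    f (x + 1, y) = f (x, y) := by
  have h1 : G1 L (fun z => f (z.1 + 1, z.2) - f z) (fun _ => 0) (fun _ => 0) :=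
    ((h.translate 1).sub h).congr (fun _ _ => rfl) (fun z _ => by simp [hx z.1 z.2])
      (fun z _ => by simp [hy z.1 z.2])
  have := h1.eq_const (z := (x, y)) (w := (0, 0)) (mem_strip.2 hy0)
    (mem_strip.2 ⟨le_rfl, hL⟩)
  simp [h0] at this
  linarith

lemma G1.poincare {α αx αy β βx βy : ℝ × ℝ → ℝ} (hα : G1 L α αx αy) (hβ : G1 L β βx βy)
    (he : EqOn αy βx (strip L)) : ∃ ψ, G1 L ψ α β := by
  have key := (convex_strip L).exists_forall_hasFDerivWithinAt_of_hasFDerivWithinAt_symmetric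
    (ω := fun z => lin (α z) (β z))
    (dω := fun z => (lin (αx z) (αy z)).smulRight (ContinuousLinearMap.fst ℝ ℝ ℝ)
      + (lin (βx z) (βy z)).smulRight (ContinuousLinearMap.snd ℝ ℝ ℝ)) (fun z hz => ?_) ?_
  · obtain ⟨ψ, hψ⟩ := key
    exact ⟨ψ, hψ⟩
  · have h1 := ((hα z hz).smul_const (ContinuousLinearMap.fst ℝ ℝ ℝ)).add
      ((hβ z hz).smul_const (ContinuousLinearMap.snd ℝ ℝ ℝ))
    refine h1.congr (fun w _ => ?_) ?_
    · ext <;> simp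
    · ext <;> simp
  · intro z hz x _ y _
    simp [he hz]; ring

lemma integral_div_eq {f fx fy g gx gy : ℝ × ℝ → ℝ} (hf : G1 L f fx fy) (hg : G1 L g gx gy)
    (hp : ∀ y ∈ Icc 0 L, f (1, y) = f (0, y))
    (hc : ContinuousOn (fun z => fx z + gy z) (strip L)) {y0 : ℝ}
    (hy0 : y0 ∈ Icc 0 L) :
    ∫ z in Icc (0 : ℝ × ℝ) (1, y0), (fx z + gy z)
      = (∫ x in (0 : ℝ)..1, g (x, y0)) - ∫ x in (0 : ℝ)..1, g (x, 0) := by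
  have hs : Icc (0 : ℝ × ℝ) (1, y0) ⊆ strip L := fun z hz =>
    ⟨trivial, hz.1.2, hz.2.2.trans hy0.2⟩
  have hd : ∀ {F Fx Fy : ℝ × ℝ → ℝ}, G1 L F Fx Fy → ∀ z ∈ Ioo (0 : ℝ) 1 ×ˢ Ioo (0 : ℝ) y0,
      HasFDerivAt F (lin (Fx z) (Fy z)) z := fun h z hz =>
    (h z ⟨trivial, hz.2.1.le, hz.2.2.le.trans hy0.2⟩).hasFDerivAt
      (prod_mem_nhds Filter.univ_mem (Icc_mem_nhds hz.2.1 (hz.2.2.trans_le hy0.2)))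
  have := integral_divergence_prod_Icc_of_hasFDerivAt_of_le f g
    (fun z => lin (fx z) (fy z)) (fun z => lin (gx z) (gy z)) (0 : ℝ × ℝ) (1, y0)
    ⟨zero_le_one, hy0.1⟩ (hf.continuousOn.mono hs) (hg.continuousOn.mono hs) (hd hf) (hd hg) ?_
  · simp only [lin_apply, one_smul, zero_smul, add_zero, zero_add] at this
    rw [this]
    have e : ∫ y in (0 : ℝ)..y0, f (1, y) = ∫ y in (0 : ℝ)..y0, f (0, y) := by
      refine intervalIntegral.integral_congr fun y hy => hp y ?_
      rw [uIcc_of_le hy0.1] at hy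
      exact ⟨hy.1, hy.2.trans hy0.2⟩
    simp [e]
  · simpa using (hc.mono hs).integrableOn_compact isCompact_Icc

lemma eq_zero_of_integral_eq_zero {h : ℝ × ℝ → ℝ} (hL : 0 < L) (hc : ContinuousOn h (strip L))
    (hp : PerX h) (h0 : ∀ z ∈ strip L, 0 ≤ h z)
    (hi : ∫ z in Icc (0 : ℝ × ℝ) (1, L), h z = 0) {z : ℝ × ℝ} (hz : z ∈ strip L) : h z = 0 := by
  have hs : Icc (0 : ℝ × ℝ) (1, L) ⊆ strip L := fun z hz => ⟨trivial, hz.1.2, hz.2.2⟩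
  have hcI := hc.mono hs
  have ae : h =ᵐ[volume.restrict (Icc (0 : ℝ × ℝ) (1, L))] 0 := by
    refine (setIntegral_eq_zero_iff_of_nonneg_ae ?_ (hcI.integrableOn_compact isCompact_Icc)).1 hi
    exact (ae_restrict_iff' measurableSet_Icc).2 (.of_forall fun z hz => h0 z (hs hz))
  have hcl : Icc (0 : ℝ × ℝ) (1, L) ⊆ closure (interior (Icc (0 : ℝ × ℝ) (1, L))) := by
    have e : Icc (0 : ℝ × ℝ) (1, L) = Icc (0 : ℝ) 1 ×ˢ Icc (0 : ℝ) L := by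
      exact Icc_prod_eq (0 : ℝ × ℝ) (1, L)
    rw [e, interior_prod_eq, closure_prod_eq, interior_Icc, interior_Icc,
      closure_Ioo zero_ne_one, closure_Ioo hL.ne]
  have key := Measure.eqOn_of_ae_eq ae hcI continuousOn_const hcl
  obtain ⟨x, y⟩ := z
  rw [hp.fract x y]
  exact key ⟨⟨Int.fract_nonneg x, hz.2.1⟩, ⟨(Int.fract_lt_one x).le, hz.2.2⟩⟩

/-- Uniqueness for the homogeneous div-curl problem. -/
theorem div_curl_unique (hL : 0 < L) {μ ν μx νx : ℝ × ℝ → ℝ} (hμ : G1 L μ μx νx)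
    (hν : G1 L ν νx (fun z => - μx z)) (pμ : PerX μ) (pν : PerX ν) (h0 : ∀ x, ν (x, 0) = 0)
    (h1 : ∀ x, ν (x, L) = 0) (hJ : ∫ y in (0 : ℝ)..L, μ (0, y) = 0) {z : ℝ × ℝ}
    (hz : z ∈ strip L) : μ z = 0 ∧ ν z = 0 := by
  obtain ⟨ψ', hψ'⟩ := G1.poincare hν hμ.neg (fun z _ => rfl)
  obtain ⟨ψ, hψ, hψ0⟩ : ∃ ψ, G1 L ψ ν (fun z => - μ z) ∧ ψ (0, 0) = 0 :=
    ⟨fun z => ψ' z - ψ' (0, 0), (hψ'.sub (G1.const _)).congr (fun _ _ => rfl)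
      (fun _ _ => by simp) (fun _ _ => by simp), by simp⟩
  have m0 : (0 : ℝ) ∈ Icc 0 L := ⟨le_rfl, hL.le⟩
  have mL : L ∈ Icc 0 L := ⟨hL.le, le_rfl⟩
  have cb : ∀ {y : ℝ}, y ∈ Icc 0 L → (∀ x, ν (x, y) = 0) → ∀ x, ψ (x, y) = ψ (0, y) := by
    intro y hy h x
    have hd : ∀ x, HasDerivAt (fun x => ψ (x, y)) 0 x := fun x => by
      simpa [h x] using hψ.slice_x (x := x) hy
    exact is_const_of_deriv_eq_zero (fun x => (hd x).differentiableAt) (fun x => (hd x).deriv) x 0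
  have b0 : ∀ x, ψ (x, 0) = 0 := fun x => (cb m0 h0 x).trans hψ0
  have bL : ∀ x, ψ (x, L) = 0 := fun x => by
    rw [cb mL h1 x]
    have hcm : ContinuousOn (fun y : ℝ => - μ (0, y)) (Icc 0 L) :=
      (hμ.continuousOn.comp (f := fun y : ℝ => ((0 : ℝ), y)) (by fun_prop)
        fun y hy => mem_strip.2 hy).neg
    have := intervalIntegral.integral_eq_sub_of_hasDerivAt_of_le hL.le
      (f := fun y => ψ (0, y)) (f' := fun y => - μ (0, y))
      (fun y hy => (hψ.slice_y hy).continuousWithinAt)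
      (fun y hy => (hψ.slice_y ⟨hy.1.le, hy.2.le⟩).hasDerivAt (Icc_mem_nhds hy.1 hy.2))
      (hcm.intervalIntegrable_of_Icc hL.le)
    rw [intervalIntegral.integral_neg, hJ, neg_zero, hψ0] at this
    linarith
  have hf := hψ.mul hν
  have hg := hψ.mul hμ.neg
  have hsq : ContinuousOn (fun z => ν z * ν z + μ z * μ z) (strip L) :=
    (hν.continuousOn.mul hν.continuousOn).add (hμ.continuousOn.mul hμ.continuousOn)
  have hp : ∀ x, ∀ y ∈ Icc 0 L, ψ (x + 1, y) = ψ (x, y) := fun x y hy =>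
    PerX.of_partials hL.le hψ pν (fun x y => by simp only [pμ x y]) (by rw [b0, b0]) x hy
  have hdiv : ∀ z, (ν z * ν z + ψ z * νx z) + (-μ z * -μ z + ψ z * -νx z)
      = ν z * ν z + μ z * μ z := fun z => by ring
  have key := integral_div_eq hf hg (fun y hy => by
    simpa using congrArg₂ (· * ·) (hp 0 y hy) (pν 0 y)) (by simpa only [hdiv] using hsq) mL
  simp only [hdiv, b0, bL, zero_mul, intervalIntegral.integral_zero, sub_zero] at key
  have := eq_zero_of_integral_eq_zero hL hsq (fun x y => by simp only [pμ x y, pν x y])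

    (fun z _ => add_nonneg (mul_self_nonneg _) (mul_self_nonneg _)) key hz
  constructor <;> nlinarith [mul_self_nonneg (μ z), mul_self_nonneg (ν z)]

end Divergence

section Kernel

open MeasureTheory

lemma TP_of_support {n m : ℕ} (hnm : n ≤ m) {c : ℤ → ℂ}
    (hc : ∀ k, k ∉ Finset.Icc (-n : ℤ) n → c k = 0) (x : ℝ) : TP m c x = TP n c x := by
  unfold TP
  refine (Finset.sum_subset (fun k hk => ?_) fun k _ hk => by rw [hc k hk, zero_mul]).symm
  simp only [Finset.mem_Icc] at hk ⊢
  omega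

/-- Unnormalised approximate identity. -/
def cosk (s : ℝ) : ℝ := Real.cos (Real.pi * s) ^ 2

lemma continuous_cosk : Continuous cosk := by unfold cosk; fun_prop

lemma cosk_pow (n : ℕ) (s : ℝ) : ((cosk s ^ n : ℝ) : ℂ) = TP n (fun k =>
    if k ∈ Finset.Icc (-n : ℤ) n then (((4 : ℝ) ^ n)⁻¹ * ((2 * n).choose (k + n).toNat : ℝ) : ℝ)
    else 0) s := by
  have h1 : ((Real.cos (Real.pi * s) : ℝ) : ℂ) = (ee (s / 2) + ee (-(s / 2))) / 2 := by
    rw [Complex.ofReal_cos, Complex.cos, ee, ee]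
    push_cast
    ring_nf
  have h2 : ((cosk s ^ n : ℝ) : ℂ) = ((4 : ℂ) ^ n)⁻¹ * (ee (s / 2) + ee (-(s / 2))) ^ (2 * n) := by
    rw [cosk]; push_cast [h1]
    rw [← pow_mul, div_pow, pow_mul 2 2 n]; norm_num; ring
  rw [h2, add_pow, TP, Finset.mul_sum]
  have hp : ∀ (x : ℝ) (j : ℕ), ee x ^ j = ee (j * x) := fun x j => by
    rw [ee, ee, ← Complex.exp_nat_mul]; push_cast; ring_nf
  refine Finset.sum_nbij' (fun j : ℕ => (j : ℤ) - n) (fun k : ℤ => (k + n).toNat) ?_ ?_ ?_ ?_ ?_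
  · intro j hj; simp at hj ⊢; omega
  · intro k hk; simp at hk ⊢; omega
  · intro j hj; simp
  · intro k hk; simp at hk ⊢; omega
  · intro j hj
    have hj' : j ≤ 2 * n := by simp at hj; omega
    rw [if_pos (by simp; omega), hp, hp, mul_comm (ee _ * ee _), ← ee_add]
    have : (j : ℝ) * (s / 2) + ((2 * n - j : ℕ) : ℝ) * -(s / 2) = (((j : ℤ) - n : ℤ) : ℝ) * s := by
      push_cast [Nat.cast_sub hj']; ring
    rw [this]
    simp
    ring

/-- Trigonometric approximate identities. -/
lemma exists_kernel {a : ℝ} (ha : 0 < a) : ∃ (κ : ℕ → ℝ → ℝ) (b : ℕ → ℤ → ℝ) (ε : ℕ → ℝ),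
    (∀ n, Continuous (κ n)) ∧ (∀ n s, 0 ≤ κ n s) ∧ (∀ n, ∫ s in (-1/2 : ℝ)..(1/2), κ n s = 1) ∧
    (∀ n s, (κ n s : ℂ) = TP n (fun k => (b n k : ℂ)) s) ∧ (∀ n, ∃ B, ∀ k, |b n k| ≤ B) ∧
    (∀ (n : ℕ) (k : ℤ), k ∉ Finset.Icc (-n : ℤ) n → b n k = 0) ∧
    (∀ n, ∫ s in (-1/2 : ℝ)..(1/2), κ n s * |s| ^ a = ε n) ∧
    Filter.Tendsto ε Filter.atTop (nhds 0) := by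
  have hpi := Real.pi_pos
  set Z : ℕ → ℝ := fun n => ∫ s in (-1/2 : ℝ)..(1/2), cosk s ^ n with hZ
  have hcos : ∀ s ∈ Ioo (-1/2 : ℝ) (1/2), 0 < cosk s := fun s hs => by
    have := Real.cos_pos_of_mem_Ioo (x := Real.pi * s)
      ⟨by nlinarith [hs.1], by nlinarith [hs.2]⟩
    unfold cosk; positivity
  have hZpos : ∀ n, 0 < Z n := fun n =>
    intervalIntegral.intervalIntegral_pos_of_pos_on
      ((continuous_cosk.pow n).intervalIntegrable _ _)
      (fun s hs => pow_pos (hcos s hs) n) (by norm_num)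
  refine ⟨fun n s => (Z n)⁻¹ * cosk s ^ n, fun n k => (Z n)⁻¹ *
    if k ∈ Finset.Icc (-n : ℤ) n then ((4 : ℝ) ^ n)⁻¹ * ((2 * n).choose (k + n).toNat : ℝ) else 0,
    fun n => ∫ s in (-1/2 : ℝ)..(1/2), ((Z n)⁻¹ * cosk s ^ n) * |s| ^ a, fun n =>
    continuous_const.mul (continuous_cosk.pow n), fun n s => ?_, fun n => ?_, fun n s => ?_,
    fun n => ⟨(Z n)⁻¹, fun k => ?_⟩, fun n k hk => ?_, fun n => rfl, ?_⟩
  · have := (hZpos n).le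
    have h2 : 0 ≤ cosk s := by unfold cosk; positivity
    positivity
  · rw [intervalIntegral.integral_const_mul]; exact inv_mul_cancel₀ (hZpos n).ne'
  · rw [Complex.ofReal_mul, cosk_pow, ← TP_const_mul]
    congr 1; funext k
    by_cases hk : k ∈ Finset.Icc (-n : ℤ) n
    · simp only [if_pos hk]; push_cast; rfl
    · simp only [if_neg hk]; push_cast; rfl
  · have := hZpos n
    rw [abs_mul, abs_of_pos (inv_pos.2 this)]
    refine mul_le_of_le_one_right (by positivity) ?_
    split_ifs
    · rw [abs_of_nonneg (by positivity), inv_mul_le_iff₀ (by positivity), mul_one]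
      have := Nat.choose_le_two_pow (2 * n) (k + n).toNat
      calc ((2 * n).choose (k + n).toNat : ℝ) ≤ ((2 ^ (2 * n) : ℕ) : ℝ) := by exact_mod_cast this
        _ = 4 ^ n := by push_cast; rw [pow_mul]; norm_num
    · simp
  · simp only; rw [if_neg hk, mul_zero]
  · have hmem : (0 : ℝ) ∈ Ioo (-1/2 : ℝ) (1/2) := by constructor <;> norm_num
    have key := tendsto_setIntegral_pow_smul_of_unique_maximum_of_isCompact_of_continuousOn
      (μ := (volume : Measure ℝ)) (s := Icc (-1/2 : ℝ) (1/2)) (x₀ := 0) isCompact_Icc (c := cosk)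
      (g := fun s : ℝ => |s| ^ a)
      continuous_cosk.continuousOn (fun y hy h0 => ?_) (fun y _ => by unfold cosk; positivity)
      (hcos 0 hmem)
      (by rw [interior_Icc, closure_Ioo (by norm_num)]; exact Ioo_subset_Icc_self hmem)
      (continuous_abs.rpow_const fun _ => Or.inr ha.le).continuousOn
    · simp only [abs_zero, Real.zero_rpow ha.ne'] at key
      refine key.congr fun n => ?_
      rw [integral_Icc_eq_integral_Ioc, integral_Icc_eq_integral_Ioc,
        ← intervalIntegral.integral_of_le (by norm_num),
        ← intervalIntegral.integral_of_le (by norm_num), smul_eq_mul,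
        ← intervalIntegral.integral_const_mul]
      refine intervalIntegral.integral_congr fun s _ => ?_
      simp only [smul_eq_mul, hZ]; ring
    · have h1 : cosk 0 = 1 := by simp [cosk]
      rw [h1, cosk, Real.cos_sq']
      have : Real.sin (Real.pi * y) ≠ 0 := by
        rcases lt_or_gt_of_ne h0 with h | h
        · exact (Real.sin_neg_of_neg_of_neg_pi_lt (by nlinarith) (by nlinarith [hy.1])).ne
        · exact (Real.sin_pos_of_pos_of_lt_pi (by positivity) (by nlinarith [hy.2])).ne'
      have : 0 < Real.sin (Real.pi * y) ^ 2 := by positivity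
      linarith

end Kernel

section Limits

variable {X E : Type*} [NormedAddCommGroup E]

lemma exists_tendstoUniformlyOn [CompleteSpace E] {f : ℕ → X → E} {S : Set X} {δ : ℕ → ℝ}
    (h : ∀ n m, n ≤ m → ∀ z ∈ S, ‖f n z - f m z‖ ≤ δ n + δ m)
    (hδ : Filter.Tendsto δ Filter.atTop (nhds 0)) :
    ∃ g : X → E, TendstoUniformlyOn f g Filter.atTop S ∧ ∀ z, z ∉ S → g z = 0 := by
  classical
  have hu : UniformCauchySeqOn f Filter.atTop S := by
    rw [Metric.uniformCauchySeqOn_iff]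
    intro ε hε
    obtain ⟨N, hN⟩ := Filter.eventually_atTop.1 (hδ.eventually (gt_mem_nhds (half_pos hε)))
    refine ⟨N, fun m hm n hn z hz => ?_⟩
    have h1 := hN m hm
    have h2 := hN n hn
    rcases le_total m n with hmn | hmn
    · rw [dist_eq_norm]; linarith [h m n hmn z hz]
    · rw [dist_comm, dist_eq_norm]; linarith [h n m hmn z hz]
  have hl : ∀ z ∈ S, ∃ l, Filter.Tendsto (fun n => f n z) Filter.atTop (nhds l) := fun z hz =>
    cauchySeq_tendsto_of_complete (hu.cauchy_map hz)
  refine ⟨fun z => if hz : z ∈ S then (hl z hz).choose else 0,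
    hu.tendstoUniformlyOn_of_tendsto fun z hz => ?_, fun z hz => by simp [hz]⟩
  simp only [hz, dif_pos]
  exact (hl z hz).choose_spec

lemma PerX.lim {L : ℝ} {f : ℕ → ℝ × ℝ → E} {g : ℝ × ℝ → E} (h : ∀ n, PerX (f n))
    (hl : ∀ z ∈ strip L, Filter.Tendsto (fun n => f n z) Filter.atTop (nhds (g z)))
    (h0 : ∀ z, z ∉ strip L → g z = 0) : PerX g := by
  intro x y
  by_cases hy : y ∈ Icc 0 L
  · refine tendsto_nhds_unique (hl (x + 1, y) (mem_strip.2 hy)) ?_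
    simp only [h _ x y]
    exact hl (x, y) (mem_strip.2 hy)
  · rw [h0 _ (fun h => hy (mem_strip.1 h)), h0 _ (fun h => hy (mem_strip.1 h))]

end Limits

section ComplexSystem

open MeasureTheory

variable {L a N : ℝ}

lemma complex_unique (hL : 0 < L) {V Vx : ℝ × ℝ → ℂ} (h : G1 L V Vx (fun z => Complex.I * Vx z))
    (hp : PerX V) (h0 : ∀ x, (V (x, 0)).im = 0) (h1 : ∀ x, (V (x, L)).im = 0)
    (hJ : ∫ y in (0 : ℝ)..L, (V (0, y)).re = 0) {z : ℝ × ℝ} (hz : z ∈ strip L) : V z = 0 := by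
  have hr := h.clm Complex.reCLM
  have hi := (h.clm Complex.imCLM).neg
  have := div_curl_unique hL (μ := fun z => (V z).re) (ν := fun z => -(V z).im)
    (μx := fun z => (Vx z).re) (νx := fun z => -(Vx z).im)
    (hr.congr (fun _ _ => rfl) (fun _ _ => rfl) (fun z _ => by simp))
    (hi.congr (fun _ _ => rfl) (fun _ _ => rfl) (fun z _ => by simp))
    (fun x y => by simp only [hp x y]) (fun x y => by simp only [hp x y])
    (fun x => by simp [h0 x]) (fun x => by simp [h1 x]) hJ hz
  exact Complex.ext this.1 (by simpa using this.2)

lemma norm_integral_kernel_le {κ D : ℝ → ℝ} {g : ℝ → ℂ} (hκ : Continuous κ) (h0 : ∀ s, 0 ≤ κ s)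
    (hD : Continuous D) (h : ∀ s, ‖g s‖ ≤ D s) :
    ‖∫ s in (-1/2 : ℝ)..(1/2), κ s * g s‖ ≤ ∫ s in (-1/2 : ℝ)..(1/2), κ s * D s := by
  refine intervalIntegral.norm_integral_le_of_norm_le (by norm_num) (.of_forall fun s _ => ?_)
    ((hκ.mul hD).intervalIntegrable _ _)
  rw [norm_mul, Complex.norm_real, Real.norm_of_nonneg (h0 s)]
  exact mul_le_mul_of_nonneg_left (h s) (h0 s)

/-- Convolution with a trigonometric kernel. -/
lemma integral_kernel_eq_TP {n : ℕ} {κ : ℝ → ℝ} {b : ℤ → ℝ}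
    (hκ : ∀ s, (κ s : ℂ) = TP n (fun k => (b k : ℂ)) s) {f : ℝ → ℂ} (hf : Continuous f)
    (hp : Per f) (x : ℝ) :
    ∫ s in (-1/2 : ℝ)..(1/2), κ s * f (x - s)
      = TP n (fun k => b k * ∫ s in (-1/2 : ℝ)..(1/2), ee (-(k * s)) * f s) x := by
  have hper : ∀ s, (κ (s + 1) : ℂ) = κ s := fun s => by rw [hκ, hκ, TP_per]
  have e1 : ∫ s in (-1/2 : ℝ)..(1/2), (κ s : ℂ) * f (x - s)
      = ∫ s in (x - 1/2)..(x - 1/2 + 1), (κ (x - s) : ℂ) * f s := by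
    have := intervalIntegral.integral_comp_sub_left (a := (-1/2 : ℝ)) (b := 1/2)
      (fun s => (κ (x - s) : ℂ) * f s) x
    simp only [sub_sub_cancel] at this
    rw [this]; congr 1; ring
  have hP : Function.Periodic (fun s => (κ (x - s) : ℂ) * f s) 1 := fun s => by
    have : (κ (x - (s + 1)) : ℂ) = κ (x - s) := by rw [← hper (x - (s + 1))]; congr 2; ring
    simp only [this, hp s]
  rw [e1, hP.intervalIntegral_add_eq (x - 1/2) (-1/2), show (-1/2 : ℝ) + 1 = 1/2 by norm_num]
  unfold TP
  have e2 : ∀ s, (κ (x - s) : ℂ) * f s = ∑ k ∈ Finset.Icc (-n : ℤ) n,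
      (b k * ee (k * x)) * (ee (-(k * s)) * f s) := fun s => by
    rw [hκ, TP, Finset.sum_mul]
    refine Finset.sum_congr rfl fun k _ => ?_
    rw [show (k : ℝ) * (x - s) = k * x + -(k * s) by ring, ee_add]; ring
  simp only [e2]
  rw [intervalIntegral.integral_finsetSum]
  · refine Finset.sum_congr rfl fun k _ => ?_
    rw [intervalIntegral.integral_const_mul]; ring
  · intro k _
    exact (continuous_const.mul ((continuous_ee.comp (by fun_prop)).mul hf)).intervalIntegrable _ _

lemma tendsto_integral_of_uniform {f : ℕ → ℝ → ℝ} {g : ℝ → ℝ} (hL : 0 ≤ L)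
    (h : TendstoUniformlyOn f g Filter.atTop (Icc 0 L)) (hc : ∀ n, ContinuousOn (f n) (Icc 0 L))
    {c : ℝ} (hi : ∀ n, ∫ y in (0 : ℝ)..L, f n y = c) : ∫ y in (0 : ℝ)..L, g y = c := by
  have hg : ContinuousOn g (Icc 0 L) := h.continuousOn (.of_forall hc)
  have key : ∀ e > 0, |(∫ y in (0 : ℝ)..L, g y) - c| ≤ e * L := fun e he => by
    rw [Metric.tendstoUniformlyOn_iff] at h
    obtain ⟨n, hn⟩ := (h e he).exists
    rw [← hi n, ← intervalIntegral.integral_sub (hg.intervalIntegrable_of_Icc hL)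
      ((hc n).intervalIntegrable_of_Icc hL)]
    have := intervalIntegral.norm_integral_le_of_norm_le_const (a := (0 : ℝ)) (b := L) (C := e)
      (f := fun y => g y - f n y) fun y hy => ?_
    · simpa [abs_of_nonneg hL] using this
    · rw [uIoc_of_le hL] at hy
      have := hn y ⟨hy.1.le, hy.2⟩
      rw [dist_eq_norm] at this; exact this.le
  have h0 : |(∫ y in (0 : ℝ)..L, g y) - c| ≤ 0 := by
    refine le_of_forall_pos_le_add fun e he => ?_
    have := key (e / (L + 1)) (by positivity)
    refine this.trans ?_
    rw [zero_add, div_mul_eq_mul_div, div_le_iff₀ (by linarith)]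
    nlinarith
  have := abs_eq_zero.1 (le_antisymm h0 (abs_nonneg _))
  linarith

/-- The conjugate Cauchy–Riemann system `W_y = -i (F - W_x)`. -/
def CSol (L : ℝ) (F W Wx : ℝ × ℝ → ℂ) : Prop :=
  G1 L W Wx (fun z => -Complex.I * (F z - Wx z)) ∧ PerX W ∧ PerX Wx ∧
    (∀ x, (W (x, 0)).im = 0) ∧ (∀ x, (W (x, L)).im = 0) ∧
    ∫ y in (0 : ℝ)..L, (W (0, y)).re = 0

lemma CSol.continuousOn_re {F W Wx : ℝ × ℝ → ℂ} (h : CSol L F W Wx) :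
    ContinuousOn (fun y => (W (0, y)).re) (Icc 0 L) :=
  Complex.continuous_re.comp_continuousOn
    (h.1.continuousOn.comp (by fun_prop) fun y hy => mem_strip.2 hy)

lemma CSol.sub {F W Wx F' W' Wx' : ℝ × ℝ → ℂ} (hL : 0 ≤ L) (h : CSol L F W Wx)
    (h' : CSol L F' W' Wx') : CSol L (fun z => F z - F' z) (fun z => W z - W' z)
      (fun z => Wx z - Wx' z) := by
  refine ⟨(h.1.sub h'.1).congr (fun _ _ => rfl) (fun _ _ => rfl) (fun z _ => by ring),
    fun x y => by simp only [h.2.1 x y, h'.2.1 x y],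
    fun x y => by simp only [h.2.2.1 x y, h'.2.2.1 x y],
    fun x => by simp [h.2.2.2.1 x, h'.2.2.2.1 x],
    fun x => by simp [h.2.2.2.2.1 x, h'.2.2.2.2.1 x], ?_⟩
  simp only [Complex.sub_re]
  rw [intervalIntegral.integral_sub ((h.continuousOn_re).intervalIntegrable_of_Icc hL)
    ((h'.continuousOn_re).intervalIntegrable_of_Icc hL), h.2.2.2.2.2, h'.2.2.2.2.2, sub_zero]

lemma CSol.unique {F W Wx W' Wx' : ℝ × ℝ → ℂ} (hL : 0 < L) (h : CSol L F W Wx)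
    (h' : CSol L F W' Wx') : EqOn W W' (strip L) ∧ EqOn Wx Wx' (strip L) := by
  have d := h.sub hL.le h'
  have hz : ∀ z ∈ strip L, W z = W' z := fun z hz => by
    have := complex_unique hL (d.1.congr (fun _ _ => rfl) (fun _ _ => rfl)
      (fun z _ => by ring)) d.2.1 d.2.2.2.1 d.2.2.2.2.1 d.2.2.2.2.2 hz
    exact sub_eq_zero.1 this
  exact ⟨hz, (h.1.unique hL (h'.1.congr hz (fun _ _ => rfl) (fun _ _ => rfl))).1⟩

end ComplexSystem

section ComplexExistence

open MeasureTheory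

variable {L a N : ℝ}

lemma tendstoUniformlyOn_of_norm_le {X E : Type*} [NormedAddCommGroup E] {f : ℕ → X → E}
    {g : X → E} {S : Set X} {δ : ℕ → ℝ} (h : ∀ n, ∀ z ∈ S, ‖f n z - g z‖ ≤ δ n)
    (hδ : Filter.Tendsto δ Filter.atTop (nhds 0)) :
    TendstoUniformlyOn f g Filter.atTop S := by
  rw [Metric.tendstoUniformlyOn_iff]
  intro e he
  filter_upwards [hδ.eventually (gt_mem_nhds he)] with n hn z hz
  rw [dist_comm, dist_eq_norm]; exact (h n z hz).trans_lt hn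

/-- Existence for the conjugate Cauchy–Riemann system with Hölder slices. -/
lemma exists_CSol_of_continuous (ha : a ∈ Ioo (0 : ℝ) 1) (hL : 0 < L) {F : ℝ × ℝ → ℂ}
    (hF : Continuous F) (hp : PerX F) (hH : ∀ y, Ho a N univ fun x => F (x, y))
    (h0 : ∀ y, ∫ s in (-1/2 : ℝ)..(1/2), (F (s, y)).re = 0) :
    ∃ W Wx, CSol L F W Wx ∧ (∀ y ∈ Icc 0 L, Ho a (4 * Real.pi * CE a * N) univ fun x => Wx (x, y)) ∧
      ∀ z ∈ strip L, ‖W z‖ ≤ 2 * (4 * Real.pi * CE a + L) * N := by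
  have hpi := Real.pi_pos
  have hN : 0 ≤ N := (hH 0).nonneg univ_nonempty
  obtain ⟨κ, b, ε, hκ, hκ0, hκ1, hκT, hb, hbs, hε, hεt⟩ := exists_kernel ha.1
  have hε0 : ∀ n, 0 ≤ ε n := fun n => by
    rw [← hε n]
    exact intervalIntegral.integral_nonneg (by norm_num) fun s _ => by
      have := hκ0 n s; positivity
  have hFx : ∀ y, Continuous fun x => F (x, y) := fun y => hF.comp (by fun_prop)
  set I : ℤ → ℝ → ℂ := fun k y => ∫ s in (-1/2 : ℝ)..(1/2), ee (-(k * s)) * F (s, y) with hI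
  have hIc : ∀ k, Continuous (I k) := fun k => by
    refine intervalIntegral.continuous_parametric_intervalIntegral_of_continuous' ?_ _ _
    exact (continuous_ee.comp (by fun_prop)).mul (hF.comp (by fun_prop))
  have hIN : ∀ k y, ‖I k y‖ ≤ N := fun k y => by
    have := intervalIntegral.norm_integral_le_of_norm_le_const (a := (-1/2 : ℝ)) (b := 1/2) (C := N)
      (f := fun s => ee (-(k * s)) * F (s, y)) fun s _ => by
        rw [norm_mul, norm_ee, one_mul]; exact (hH y).1 s trivial
    refine this.trans_eq ?_
    norm_num
  have hI0 : ∀ y, (I 0 y).re = 0 := fun y => by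
    simp only [hI, Int.cast_zero, zero_mul, neg_zero, ee_zero, one_mul]
    rw [← h0 y]
    exact (Complex.reCLM.intervalIntegral_comp_comm ((hFx y).intervalIntegrable _ _)).symm
  set c : ℕ → ℤ → ℝ → ℂ := fun n k y => b n k * I k y with hc
  have hcc : ∀ n k, Continuous (c n k) := fun n k => continuous_const.mul (hIc k)
  have hc0 : ∀ n y, (c n 0 y).re = 0 := fun n y => by simp [hc, hI0]
  have hcB : ∀ n, ∃ B, ∀ k y, ‖c n k y‖ ≤ B := fun n => by
    obtain ⟨B, hB⟩ := hb n
    refine ⟨B * N, fun k y => ?_⟩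
    rw [hc, norm_mul, Complex.norm_real]
    exact mul_le_mul (hB k) (hIN k y) (norm_nonneg _) ((abs_nonneg _).trans (hB k))
  set Fn : ℕ → ℝ × ℝ → ℂ := fun n z => TP n (fun k => c n k z.2) z.1 with hFn
  have hconv : ∀ n x y, ∫ s in (-1/2 : ℝ)..(1/2), κ n s * F (x - s, y) = Fn n (x, y) := fun n x y =>
    integral_kernel_eq_TP (hκT n) (hFx y) (fun x => hp x y) x
  have hii : ∀ n x y,
      IntervalIntegrable (fun s => (κ n s : ℂ) * F (x - s, y)) volume (-1/2) (1/2) :=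
    fun n x y => ((Complex.continuous_ofReal.comp (hκ n)).mul
      ((hFx y).comp (by fun_prop))).intervalIntegrable _ _
  have hFnH : ∀ n y, Ho a N univ fun x => Fn n (x, y) := fun n y => by
    refine ⟨fun x _ => ?_, fun x _ x' _ => ?_⟩
    · simp only []
      rw [← hconv]
      refine (norm_integral_kernel_le (hκ n) (hκ0 n) (continuous_const (y := N))
        fun s => (hH y).1 _ trivial).trans_eq ?_
      rw [intervalIntegral.integral_mul_const, hκ1, one_mul]
    · simp only []
      rw [← hconv, ← hconv, ← intervalIntegral.integral_sub (hii n x y) (hii n x' y)]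
      simp only [← mul_sub]
      refine (norm_integral_kernel_le (hκ n) (hκ0 n) (continuous_const (y := N * ‖x - x'‖ ^ a))
        fun s => ?_).trans_eq ?_
      · have := (hH y).2 (x - s) trivial (x' - s) trivial
        rwa [sub_sub_sub_cancel_right] at this
      · rw [intervalIntegral.integral_mul_const, hκ1, one_mul]
  have hFnF : ∀ n x y, ‖Fn n (x, y) - F (x, y)‖ ≤ N * ε n := fun n x y => by
    have e : F (x, y) = ∫ s in (-1/2 : ℝ)..(1/2), (κ n s : ℂ) * F (x, y) := by
      rw [intervalIntegral.integral_mul_const, intervalIntegral.integral_ofReal, hκ1]; simp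
    have hi' : IntervalIntegrable (fun s => (κ n s : ℂ) * F (x, y)) volume (-1 / 2) (1 / 2) :=
      ((Complex.continuous_ofReal.comp (hκ n)).mul continuous_const).intervalIntegrable _ _
    rw [e, ← hconv, ← intervalIntegral.integral_sub (hii n x y) hi']
    simp only [← mul_sub]
    refine (norm_integral_kernel_le (hκ n) (hκ0 n) (D := fun s => |s| ^ a * N)
      ((continuous_abs.rpow_const fun _ => Or.inr ha.1.le).mul continuous_const)
      fun s => ?_).trans_eq ?_
    · have := (hH y).2 (x - s) trivial x trivial
      rwa [show x - s - x = -s by ring, norm_neg, Real.norm_eq_abs, mul_comm] at this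
    · simp only [← mul_assoc]
      rw [intervalIntegral.integral_mul_const, hε, mul_comm]
  have hsol : ∀ n, ∃ W Wx, CSol L (Fn n) W Wx ∧
      (∀ y ∈ Icc 0 L, Ho a (4 * Real.pi * CE a * N) univ fun x => Wx (x, y)) ∧
      ∀ z ∈ strip L, ‖W z‖ ≤ 2 * (4 * Real.pi * CE a + L) * N := fun n => by
    obtain ⟨B, hB⟩ := hcB n
    obtain ⟨W, Wx, h1, h2, h3, h4, h5, h6, h7, h8⟩ :=
      exists_solution_TP ha hL (hcc n) hB (hc0 n) (fun y _ => hFnH n y)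
    exact ⟨W, Wx, ⟨h1, h2, h3, h4, h5, h6⟩, h7, h8⟩
  choose W Wx hW hWx hWb using hsol
  have ha2 : a / 2 ∈ Ioo (0 : ℝ) 1 := ⟨by linarith [ha.1], by linarith [ha.1, ha.2]⟩
  have hCE := CE_nonneg ha2
  set C := 2 * (4 * Real.pi * CE (a / 2) + L) with hC
  have hdiff : ∀ n m, n ≤ m → ∀ z ∈ strip L,
      ‖W n z - W m z‖ ≤ C * (4 * N * √(ε n)) + C * (4 * N * √(ε m))
      ∧ ‖Wx n z - Wx m z‖ ≤ C * (4 * N * √(ε n)) + C * (4 * N * √(ε m)) := by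
    intro n m hnm z hz
    obtain ⟨B, hB⟩ := hcB n
    obtain ⟨B', hB'⟩ := hcB m
    have eTP : ∀ z : ℝ × ℝ, TP m (fun k => c n k z.2 - c m k z.2) z.1 = Fn n z - Fn m z :=
        fun z => by
      rw [TP_sub, TP_of_support hnm]
      intro k hk
      simp [hc, hbs n k hk]
    have hHd : ∀ y, Ho (a / 2) (4 * N * (√(ε n) + √(ε m))) univ
        fun x => TP m (fun k => c n k y - c m k y) x := fun y => by
      have e : (fun x => TP m (fun k => c n k y - c m k y) x)
          = fun x => Fn n (x, y) - Fn m (x, y) :=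
        funext fun x => eTP (x, y)
      rw [e]
      have i := ((hFnH n y).sub (hFnH m y)).interp
        (δ := min (N * (ε n + ε m)) (N + N)) (fun x _ => le_min ?_ ?_) (min_le_right _ _)
      · refine i.mono ?_
        have : √(min (N * (ε n + ε m)) (N + N) * (N + N)) ≤ 2 * N * (√(ε n) + √(ε m)) := by
          have hh : min (N * (ε n + ε m)) (N + N) * (N + N) ≤ (2 * N) ^ 2 * (ε n + ε m) := by
            have := mul_le_mul_of_nonneg_right (min_le_left (N * (ε n + ε m)) (N + N))
              (by linarith : 0 ≤ N + N)
            nlinarith [mul_nonneg (mul_nonneg hN hN) (add_nonneg (hε0 n) (hε0 m))]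
          refine (Real.sqrt_le_sqrt hh).trans ?_
          rw [Real.sqrt_mul (by positivity), Real.sqrt_sq (by positivity)]
          gcongr
          rw [Real.sqrt_le_left (by positivity)]
          nlinarith [Real.sq_sqrt (hε0 n), Real.sq_sqrt (hε0 m),
            mul_nonneg (Real.sqrt_nonneg (ε n)) (Real.sqrt_nonneg (ε m))]
        linarith
      · have h1 := hFnF n x y
        have h2 := hFnF m x y
        rw [← sub_sub_sub_cancel_right _ _ (F (x, y))]
        exact (norm_sub_le _ _).trans (by linarith)
      · exact (norm_sub_le _ _).trans (add_le_add ((hFnH n y).1 x trivial) ((hFnH m y).1 x trivial))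
    obtain ⟨V, Vx, h1, h2, h3, h4, h5, h6, h7, h8⟩ :=
      exists_solution_TP (n := m) (c := fun k y => c n k y - c m k y) (B := B + B') ha2 hL
        (fun k => (hcc n k).sub (hcc m k))
        (fun k y => (norm_sub_le _ _).trans (add_le_add (hB k y) (hB' k y)))
        (fun y => by simp [hc0]) (fun y _ => hHd y)
    have hV : CSol L (fun z => Fn n z - Fn m z) V Vx :=
      ⟨h1.congr (fun _ _ => rfl) (fun _ _ => rfl) (fun z _ => by simp only [← eTP z]),
        h2, h3, h4, h5, h6⟩
    obtain ⟨e1, e2⟩ := ((hW n).sub hL.le (hW m)).unique hL hV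
    have hs := Real.sqrt_nonneg (ε n)
    have hs' := Real.sqrt_nonneg (ε m)
    have e1' : W n z - W m z = V z := e1 hz
    have e2' : Wx n z - Wx m z = Vx z := e2 hz
    rw [e1', e2']
    constructor
    · exact (h8 z hz).trans_eq (by ring)
    · refine ((h7 z.2 (mem_strip.1 hz)).1 z.1 trivial).trans ?_
      rw [← mul_add, ← mul_add]
      gcongr
      rw [hC]; nlinarith [mul_nonneg hpi.le hCE]
  have hδ : Filter.Tendsto (fun n => C * (4 * N * √(ε n))) Filter.atTop (nhds 0) := by
    have := ((Real.continuous_sqrt.tendsto 0).comp hεt).const_mul (C * (4 * N))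
    simp only [Real.sqrt_zero, mul_zero] at this
    refine this.congr fun n => ?_
    simp only [Function.comp]; ring
  obtain ⟨U, hU, hU0⟩ := exists_tendstoUniformlyOn (fun n m h z hz => (hdiff n m h z hz).1) hδ
  obtain ⟨Ux, hUx, hUx0⟩ := exists_tendstoUniformlyOn (fun n m h z hz => (hdiff n m h z hz).2) hδ
  have hFt : TendstoUniformlyOn Fn F Filter.atTop (strip L) :=
    tendstoUniformlyOn_of_norm_le (fun n z _ => hFnF n z.1 z.2) (by simpa using hεt.const_mul N)
  have hUl : ∀ z ∈ strip L, Filter.Tendsto (fun n => W n z) Filter.atTop (nhds (U z)) := fun z hz =>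
    hU.tendsto_at hz
  have hUxl : ∀ z ∈ strip L, Filter.Tendsto (fun n => Wx n z) Filter.atTop (nhds (Ux z)) :=
    fun z hz => hUx.tendsto_at hz
  have him : ∀ z ∈ strip L, (∀ n, (W n z).im = 0) → (U z).im = 0 := fun z hz h =>
    tendsto_nhds_unique ((Complex.continuous_im.tendsto _).comp (hUl z hz))
      (by simp [Function.comp_def, h])
  refine ⟨U, Ux, ⟨G1.lim (fun n => (hW n).1) hUl hUx ?_, PerX.lim (fun n => (hW n).2.1) hUl hU0,
    PerX.lim (fun n => (hW n).2.2.1) hUxl hUx0,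
    fun x => him _ (mem_strip.2 ⟨le_rfl, hL.le⟩) fun n => (hW n).2.2.2.1 x,
    fun x => him _ (mem_strip.2 ⟨hL.le, le_rfl⟩) fun n => (hW n).2.2.2.2.1 x, ?_⟩,
    fun y hy => Ho.lim (fun n => hWx n y hy) fun x _ => hUxl (x, y) (mem_strip.2 hy),
    fun z hz => le_of_tendsto (hUl z hz).norm (.of_forall fun n => hWb n z hz)⟩
  · exact (uniformContinuous_const_smul (-Complex.I)).comp_tendstoUniformlyOn (hFt.sub hUx)
  · refine tendsto_integral_of_uniform hL.le ?_ (fun n => (hW n).continuousOn_re)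
      fun n => (hW n).2.2.2.2.2
    have h1 : TendstoUniformlyOn (fun n y => W n (0, y)) (fun y => U (0, y))
        Filter.atTop (Icc 0 L) := by
      have := hU.comp (fun y : ℝ => ((0 : ℝ), y))
      exact this.mono fun y hy => mem_strip.2 hy
    exact Complex.reCLM.uniformContinuous.comp_tendstoUniformlyOn h1

/-- Existence for the conjugate Cauchy–Riemann system with Hölder slices. -/
theorem exists_CSol (ha : a ∈ Ioo (0 : ℝ) 1) (hL : 0 < L) {F : ℝ × ℝ → ℂ}
    (hF : ContinuousOn F (strip L)) (hp : PerX F)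
    (hH : ∀ y ∈ Icc 0 L, Ho a N univ fun x => F (x, y))
    (h0 : ∀ y ∈ Icc 0 L, ∫ s in (-1/2 : ℝ)..(1/2), (F (s, y)).re = 0) :
    ∃ W Wx, CSol L F W Wx ∧ (∀ y ∈ Icc 0 L, Ho a (4 * Real.pi * CE a * N) univ fun x => Wx (x, y)) ∧
      ∀ z ∈ strip L, ‖W z‖ ≤ 2 * (4 * Real.pi * CE a + L) * N := by
  set t : ℝ → ℝ := fun y => (projIcc 0 L hL.le y : ℝ) with ht
  have htc : Continuous t := continuous_subtype_val.comp continuous_projIcc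
  have htm : ∀ y, t y ∈ Icc 0 L := fun y => (projIcc 0 L hL.le y).2
  have hte : ∀ y ∈ Icc 0 L, t y = y := fun y hy => by rw [ht]; simp only [projIcc_of_mem hL.le hy]
  obtain ⟨W, Wx, h1, h2, h3⟩ := exists_CSol_of_continuous (N := N) ha hL
    (F := fun z => F (z.1, t z.2))
    (hF.comp_continuous (by fun_prop) fun z => mem_strip.2 (htm _))
    (fun x y => hp x (t y)) (fun y => hH _ (htm y)) (fun y => h0 _ (htm y))
  refine ⟨W, Wx, ⟨h1.1.congr (fun _ _ => rfl) (fun _ _ => rfl) fun z hz => ?_, h1.2⟩, h2, h3⟩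
  simp only [hte z.2 (mem_strip.1 hz)]

end ComplexExistence

section RealSystem

open MeasureTheory

variable {L a N : ℝ}

/-- A slicewise Hölder bound for both partial derivatives is a joint Hölder bound. -/
lemma G1.joint_ho {E : Type*} [NormedAddCommGroup E] [NormedSpace ℝ E] {W Wx Wy : ℝ × ℝ → E}
    (ha : a ∈ Ioo (0 : ℝ) 1) (h : G1 L W Wx Wy)
    (hx : ∀ y ∈ Icc 0 L, Ho a N univ fun x => Wx (x, y))
    (hy : ∀ y ∈ Icc 0 L, Ho a N univ fun x => Wy (x, y)) : Ho a (4 * N) (strip L) Wx := by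
  have key : ∀ x, ∀ y ∈ Icc 0 L, ∀ y' ∈ Icc 0 L,
      ‖Wx (x, y) - Wx (x, y')‖ ≤ 3 * N * |y - y'| ^ a := by
    intro x y hY y' hY'
    rcases eq_or_ne y y' with rfl | hne
    · simp [Real.zero_rpow ha.1.ne']
    have hN : 0 ≤ N := (hx y hY).nonneg univ_nonempty
    set r := |y - y'| with hr
    have hr0 : 0 < r := abs_pos.2 (sub_ne_zero.2 hne)
    have quot : ∀ y ∈ Icc 0 L, ‖W (x + r, y) - W (x, y) - r • Wx (x, y)‖ ≤ N * r ^ a * r := by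
      intro y hY
      have hd : ∀ t ∈ Icc x (x + r), HasDerivWithinAt (fun t => W (t, y) - t • Wx (x, y))
          (Wx (t, y) - Wx (x, y)) (Icc x (x + r)) t := fun t _ => by
        have h1 := ((hasDerivAt_id t).smul_const (Wx (x, y)))
        rw [one_smul] at h1
        exact ((h.slice_x hY).sub h1).hasDerivWithinAt
      have := (convex_Icc x (x + r)).norm_image_sub_le_of_norm_hasDerivWithin_le hd
        (C := N * r ^ a) (fun t ht => ?_) (left_mem_Icc.2 (by linarith))
        (right_mem_Icc.2 (by linarith))
      · rw [add_sub_cancel_left, Real.norm_of_nonneg hr0.le] at this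
        convert this using 2
        rw [add_smul]; abel
      · refine ((hx y hY).2 t trivial x trivial).trans ?_
        gcongr
        · exact ha.1.le
        · rw [Real.norm_of_nonneg (by linarith [ht.1])]; linarith [ht.2]
    have dif : ‖(W (x + r, y) - W (x, y)) - (W (x + r, y') - W (x, y'))‖ ≤ N * r ^ a * r := by
      have hd : ∀ t ∈ Icc 0 L, HasDerivWithinAt (fun t => W (x + r, t) - W (x, t))
          (Wy (x + r, t) - Wy (x, t)) (Icc 0 L) t := fun t ht => (h.slice_y ht).sub (h.slice_y ht)
      refine (convex_Icc 0 L).norm_image_sub_le_of_norm_hasDerivWithin_le hd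
        (C := N * r ^ a) (fun t ht => ?_) hY' hY
      have := (hy t ht).2 (x + r) trivial x trivial
      rwa [add_sub_cancel_left, Real.norm_of_nonneg hr0.le] at this
    have e : r • (Wx (x, y) - Wx (x, y'))
        = ((W (x + r, y) - W (x, y)) - (W (x + r, y') - W (x, y')))
        - (W (x + r, y) - W (x, y) - r • Wx (x, y))
        + (W (x + r, y') - W (x, y') - r • Wx (x, y')) := by rw [smul_sub]; abel
    have h3 : r * ‖Wx (x, y) - Wx (x, y')‖ ≤ r * (3 * N * r ^ a) := by
      rw [← Real.norm_of_nonneg hr0.le, ← norm_smul, Real.norm_of_nonneg hr0.le, e]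
      refine (norm_add_le _ _).trans ((add_le_add_left (norm_sub_le _ _) _).trans ?_)
      linarith [quot y hY, quot y' hY', dif]
    exact le_of_mul_le_mul_left h3 hr0
  refine ⟨fun z hz => ?_, fun z hz w hw => ?_⟩
  · have := (hx z.2 (mem_strip.1 hz)).1 z.1 trivial
    have hN := (norm_nonneg _).trans this
    exact this.trans (by linarith)
  · have hz' := mem_strip.1 (show (z.1, z.2) ∈ strip L from hz)
    have hw' := mem_strip.1 (show (w.1, w.2) ∈ strip L from hw)
    have hN : 0 ≤ N := (hx z.2 hz').nonneg univ_nonempty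
    have h1 := (hx z.2 hz').2 z.1 trivial w.1 trivial
    have h2 := key w.1 z.2 hz' w.2 hw'
    have b1 : ‖z.1 - w.1‖ ^ a ≤ ‖z - w‖ ^ a :=
      Real.rpow_le_rpow (norm_nonneg _) (norm_fst_le (z - w)) ha.1.le
    have b2 : |z.2 - w.2| ^ a ≤ ‖z - w‖ ^ a :=
      Real.rpow_le_rpow (abs_nonneg _) (norm_snd_le (z - w)) ha.1.le
    calc ‖Wx z - Wx w‖ ≤ ‖Wx z - Wx (w.1, z.2)‖ + ‖Wx (w.1, z.2) - Wx w‖ :=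
          norm_sub_le_norm_sub_add_norm_sub _ _ _
      _ ≤ N * ‖z - w‖ ^ a + 3 * N * ‖z - w‖ ^ a := by
          refine add_le_add (h1.trans ?_) (h2.trans ?_) <;> gcongr
      _ = _ := by ring

/-- `(μ, ν)` is a periodic divergence free field with vorticity `ω`, normal component `b₀`, `b₁`
on the two boundary components, and flux `j`. -/
structure RSol (L : ℝ) (ω : ℝ × ℝ → ℝ) (b0 b1 : ℝ → ℝ) (j : ℝ) (μ ν μx νx : ℝ × ℝ → ℝ) : Prop where
  hμ : G1 L μ μx (fun z => νx z - ω z)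
  hν : G1 L ν νx (fun z => - μx z)
  pμ : PerX μ
  pν : PerX ν
  pμx : PerX μx
  pνx : PerX νx
  h0 : ∀ x, ν (x, 0) = b0 x
  h1 : ∀ x, ν (x, L) = b1 x
  hj : ∫ y in (0 : ℝ)..L, μ (0, y) = j

lemma G1.continuousOn_slice {E : Type*} [NormedAddCommGroup E] [NormedSpace ℝ E]
    {f fx fy : ℝ × ℝ → E} (h : G1 L f fx fy) (x : ℝ) : ContinuousOn (fun y => f (x, y)) (Icc 0 L) :=
  fun _ hy => (h.slice_y hy).continuousWithinAt

lemma RSol.sub (hL : 0 < L) {ω ω' : ℝ × ℝ → ℝ} {b0 b1 b0' b1' : ℝ → ℝ} {j j' : ℝ}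
    {μ ν μx νx μ' ν' μx' νx' : ℝ × ℝ → ℝ} (h : RSol L ω b0 b1 j μ ν μx νx)
    (h' : RSol L ω' b0' b1' j' μ' ν' μx' νx') :
    RSol L (fun z => ω z - ω' z) (fun x => b0 x - b0' x) (fun x => b1 x - b1' x) (j - j')
      (fun z => μ z - μ' z) (fun z => ν z - ν' z) (fun z => μx z - μx' z)
      (fun z => νx z - νx' z) where
  hμ := (h.hμ.sub h'.hμ).congr (fun _ _ => rfl) (fun _ _ => rfl) (fun z _ => by ring)
  hν := (h.hν.sub h'.hν).congr (fun _ _ => rfl) (fun _ _ => rfl) (fun z _ => by ring)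
  pμ x y := by simp only [h.pμ x y, h'.pμ x y]
  pν x y := by simp only [h.pν x y, h'.pν x y]
  pμx x y := by simp only [h.pμx x y, h'.pμx x y]
  pνx x y := by simp only [h.pνx x y, h'.pνx x y]
  h0 x := by rw [h.h0, h'.h0]
  h1 x := by rw [h.h1, h'.h1]
  hj := by
    rw [intervalIntegral.integral_sub
      ((h.hμ.continuousOn_slice 0).intervalIntegrable_of_Icc hL.le)
      ((h'.hμ.continuousOn_slice 0).intervalIntegrable_of_Icc hL.le), h.hj, h'.hj]

lemma RSol.unique (hL : 0 < L) {ω : ℝ × ℝ → ℝ} {b0 b1 : ℝ → ℝ} {j : ℝ}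
    {μ ν μx νx μ' ν' μx' νx' : ℝ × ℝ → ℝ} (h : RSol L ω b0 b1 j μ ν μx νx)
    (h' : RSol L ω b0 b1 j μ' ν' μx' νx') :
    EqOn μ μ' (strip L) ∧ EqOn ν ν' (strip L) ∧ EqOn μx μx' (strip L) ∧ EqOn νx νx' (strip L) := by
  have d := h.sub hL h'
  have u := fun z hz => div_curl_unique hL (z := z) (d.hμ.congr (fun _ _ => rfl) (fun _ _ => rfl)
    (fun z _ => by simp)) d.hν d.pμ d.pν (fun x => by rw [d.h0]; simp)
    (fun x => by rw [d.h1]; simp) (by rw [d.hj]; simp) hz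
  have e1 : EqOn μ μ' (strip L) := fun z hz => sub_eq_zero.1 (u z hz).1
  have e2 : EqOn ν ν' (strip L) := fun z hz => sub_eq_zero.1 (u z hz).2
  exact ⟨e1, e2, (h.hμ.unique hL (h'.hμ.congr e1 (fun _ _ => rfl) (fun _ _ => rfl))).1,
    (h.hν.unique hL (h'.hν.congr e2 (fun _ _ => rfl) (fun _ _ => rfl))).1⟩

lemma Ho.ofReal {X : Type*} [NormedAddCommGroup X] {S : Set X} {f : X → ℝ} (h : Ho a N S f) :
    Ho a N S fun x => (f x : ℂ) :=
  ⟨fun x hx => by simpa using h.1 x hx, fun x hx y hy => by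
    rw [← Complex.ofReal_sub, Complex.norm_real]; exact h.2 x hx y hy⟩

lemma Ho.I_mul {X : Type*} [NormedAddCommGroup X] {S : Set X} {f : X → ℂ} (h : Ho a N S f) :
    Ho a N S fun x => Complex.I * f x :=
  ⟨fun x hx => by simpa using h.1 x hx, fun x hx y hy => by
    rw [← mul_sub, norm_mul, Complex.norm_I, one_mul]; exact h.2 x hx y hy⟩

/-- Schauder estimate at first order. -/
theorem exists_RSol (ha : a ∈ Ioo (0 : ℝ) 1) (hL : 0 < L) : ∃ C ≥ 0, ∀ (N : ℝ) (ω : ℝ × ℝ → ℝ)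
    (b0 b1 b0' b1' : ℝ → ℝ) (j : ℝ), ContinuousOn ω (strip L) → PerX ω →
    (∀ y ∈ Icc 0 L, Ho a N univ fun x => ω (x, y)) → Per b0 → Per b1 → H1 a N b0 b0' →
    H1 a N b1 b1' → ∫ x in (-1/2 : ℝ)..(1/2), b0 x = ∫ x in (-1/2 : ℝ)..(1/2), b1 x → |j| ≤ N →
    ∃ μ ν μx νx, RSol L ω b0 b1 j μ ν μx νx ∧ Ho a (C * N) (strip L) μx ∧
      Ho a (C * N) (strip L) νx ∧ (∀ z ∈ strip L, |μ z| ≤ C * N) ∧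
        ∀ z ∈ strip L, |ν z| ≤ C * N := by
  have hpi := Real.pi_pos
  have hCE := CE_nonneg ha
  set C1 : ℝ := 4 / L + 6 with hC1
  have hC1p : 0 ≤ C1 := by positivity
  set C2 := 4 * Real.pi * CE a * C1 with hC2
  have hC2p : 0 ≤ C2 := by positivity
  set C3 := 2 * (4 * Real.pi * CE a + L) * C1 with hC3
  have hC3p : 0 ≤ C3 := by positivity
  refine ⟨4 * (C2 + 10) + C3 + 1 / L, by positivity,
    fun N ω b0 b1 b0' b1' j hω pω hωH p0 p1 H0 H1' hm hj => ?_⟩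
  have hN : 0 ≤ N := H0.nonneg
  have p0' := p0.deriv_of H0.1
  have p1' := p1.deriv_of H1'.1
  have hc0 : Continuous b0 := continuous_iff_continuousAt.2 fun x => (H0.1 x).continuousAt
  have hc1 : Continuous b1 := continuous_iff_continuousAt.2 fun x => (H1'.1 x).continuousAt
  have hc0' : Continuous b0' := continuousOn_univ.1 (H0.2.2.continuousOn ha.1)
  have hc1' : Continuous b1' := continuousOn_univ.1 (H1'.2.2.continuousOn ha.1)
  set B : ℝ × ℝ → ℝ := fun z => b0 z.1 + z.2 * (L⁻¹ * (b1 z.1 - b0 z.1)) with hB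
  set Bx : ℝ × ℝ → ℝ := fun z => b0' z.1 + z.2 * (L⁻¹ * (b1' z.1 - b0' z.1)) with hBx
  have gB : G1 L B Bx (fun z => L⁻¹ * (b1 z.1 - b0 z.1)) := by
    have g0 := G1.of_fst (L := L) H0.1
    have g1 := (G1.of_fst (L := L) fun t => (H1'.1 t).sub (H0.1 t)).const_smul L⁻¹
    have g2 := G1.of_snd (L := L) (φ := fun t : ℝ => t) (φ' := fun _ => 1)
      fun t _ => hasDerivWithinAt_id t _
    exact (g0.add (g2.mul g1)).congr (fun _ _ => rfl) (fun z _ => by simp [hBx])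
      (fun z _ => by simp)
  have ylem : ∀ y ∈ Icc 0 L, |y * L⁻¹| ≤ 1 := fun y hy => by
    rw [abs_of_nonneg (mul_nonneg hy.1 (by positivity)), ← div_eq_mul_inv, div_le_one hL]
    exact hy.2
  have hBxH : ∀ y ∈ Icc 0 L, Ho a (3 * N) univ fun x => Bx (x, y) := fun y hy => by
    have := H0.2.2.add ((H1'.2.2.sub H0.2.2).const_smul (y * L⁻¹))
    refine (this.mono ?_).congr fun x _ => by simp [hBx, mul_assoc]
    nlinarith [ylem y hy]
  set F : ℝ × ℝ → ℂ := fun z => ((L⁻¹ * (b0 z.1 - b1 z.1) : ℝ) : ℂ)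
    - Complex.I * ((ω z - Bx z : ℝ) : ℂ) with hF
  have hFre : ∀ z, (F z).re = L⁻¹ * (b0 z.1 - b1 z.1) := fun z => by simp [hF]
  have hFim : ∀ z, (F z).im = -(ω z - Bx z) := fun z => by simp [hF]
  have hFc : ContinuousOn F (strip L) := by
    have : Continuous Bx := by rw [hBx]; fun_prop
    refine ContinuousOn.sub (Continuous.continuousOn (by fun_prop)) (continuousOn_const.mul ?_)
    exact Complex.continuous_ofReal.comp_continuousOn (hω.sub this.continuousOn)
  have hFH : ∀ y ∈ Icc 0 L, Ho a (C1 * N) univ fun x => F (x, y) := fun y hy => by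
    have h1 := (((H0.ho ha).sub (H1'.ho ha)).const_smul L⁻¹).ofReal
    have h2 := ((hωH y hy).sub (hBxH y hy)).ofReal.I_mul
    refine ((h1.sub h2).mono ?_).congr fun x _ => by simp [hF]
    rw [abs_of_pos (by positivity), hC1, div_eq_mul_inv]
    nlinarith
  obtain ⟨W, Wx, hW, hWx, hWb⟩ := exists_CSol ha hL hFc (fun x y => by
    simp only [hF, hBx, p0 x, p1 x, pω x y, p0' x, p1' x]) hFH (fun y _ => by
      simp only [hFre]
      rw [intervalIntegral.integral_const_mul, intervalIntegral.integral_sub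
        (hc0.intervalIntegrable _ _) (hc1.intervalIntegrable _ _), hm]; simp)
  have gr := hW.1.clm Complex.reCLM
  have gi := hW.1.clm Complex.imCLM
  have sol : RSol L ω b0 b1 j (fun z => (W z).re + j / L) (fun z => B z - (W z).im)
      (fun z => (Wx z).re) (fun z => Bx z - (Wx z).im) := by
    refine ⟨(gr.add (G1.const (j / L))).congr (fun _ _ => rfl) (fun _ _ => by simp)
      (fun z _ => by simp [hFim]; ring), (gB.sub gi).congr (fun _ _ => rfl) (fun _ _ => rfl)
      (fun z _ => by simp [hFre]; ring), fun x y => ?_, fun x y => ?_, fun x y => ?_, fun x y => ?_,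
      fun x => ?_, fun x => ?_, ?_⟩
    · simp only [hW.2.1 x y]
    · simp only [hW.2.1 x y, hB, p0 x, p1 x]
    · simp only [hW.2.2.1 x y]
    · simp only [hW.2.2.1 x y, hBx, p0' x, p1' x]
    · simp [hB, hW.2.2.2.1 x]
    · simp only [hB, hW.2.2.2.2.1 x]; field_simp; ring
    · rw [intervalIntegral.integral_add (hW.continuousOn_re.intervalIntegrable_of_Icc hL.le)
        (by simp), hW.2.2.2.2.2]
      simp; field_simp
  have hre : ∀ y ∈ Icc 0 L, Ho a ((C2 + 10) * N) univ fun x => (Wx (x, y)).re := fun y hy => by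
    refine ((hWx y hy).clm Complex.reCLM Complex.reCLM_norm.le).mono ?_
    rw [← mul_assoc, ← hC2]; linarith
  have him : ∀ y ∈ Icc 0 L, Ho a ((C2 + 3) * N) univ fun x => Bx (x, y) - (Wx (x, y)).im :=
    fun y hy => by
    refine ((hBxH y hy).sub ((hWx y hy).clm Complex.imCLM Complex.imCLM_norm.le)).mono ?_
    rw [← mul_assoc, ← hC2]; linarith
  have him' : ∀ y ∈ Icc 0 L, Ho a ((C2 + 10) * N) univ fun x => Bx (x, y) - (Wx (x, y)).im :=
    fun y hy => (him y hy).mono (by linarith)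
  have hr1 : 0 ≤ 1 / L * N := by positivity
  have hr2 : 0 ≤ C2 * N := by positivity
  have hr3 : 0 ≤ C3 * N := by positivity
  have hWb' : ∀ z ∈ strip L, ‖W z‖ ≤ C3 * N := fun z hz => by
    rw [hC3, mul_assoc]; exact hWb z hz
  refine ⟨_, _, _, _, sol, (sol.hμ.joint_ho ha hre fun y hy => ?_).mono ?_,
    (sol.hν.joint_ho ha him' fun y hy => (hre y hy).neg).mono ?_, fun z hz => ?_, fun z hz => ?_⟩
  · exact ((him y hy).sub (hωH y hy)).mono (by linarith)
  · linarith
  · linarith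
  · refine (abs_add_le _ _).trans ?_
    have h1 : |(W z).re| ≤ C3 * N := (Complex.abs_re_le_norm _).trans (hWb' z hz)
    have h2 : |j / L| ≤ 1 / L * N := by
      rw [abs_div, abs_of_pos hL, div_mul_eq_mul_div, one_mul]; gcongr
    linarith
  · have h1 : |(W z).im| ≤ C3 * N := (Complex.abs_im_le_norm _).trans (hWb' z hz)
    have h2 : |B z| ≤ 3 * N := by
      have a0 := H0.2.1 z.1
      have a1 := H1'.2.1 z.1
      rw [Real.norm_eq_abs] at a0 a1
      have e : B z = b0 z.1 + (z.2 * L⁻¹) * (b1 z.1 - b0 z.1) := by rw [hB]; ring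
      rw [e]
      refine (abs_add_le _ _).trans ?_
      rw [abs_mul]
      have := mul_le_mul (ylem z.2 (mem_strip.1 hz)) ((abs_sub _ _).trans (add_le_add a1 a0))
        (abs_nonneg _) zero_le_one
      linarith
    refine (abs_sub _ _).trans ?_
    linarith

end RealSystem

section SecondOrder

open MeasureTheory

variable {L a N : ℝ}

/-- Extension of a function on the strip to the plane, constant in the second variable. -/
def clampY {E : Type*} (L : ℝ) (f : ℝ × ℝ → E) (z : ℝ × ℝ) : E := f (z.1, max 0 (min z.2 L))

lemma clampY_eqOn {E : Type*} (f : ℝ × ℝ → E) : EqOn (clampY L f) f (strip L) := fun z hz => by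
  have h : z.2 ∈ Icc 0 L := hz.2
  simp [clampY, h.1, h.2]

lemma PerX.clampY {E : Type*} {f : ℝ × ℝ → E} (hL : 0 ≤ L)
    (h : ∀ x, ∀ y ∈ Icc 0 L, f (x + 1, y) = f (x, y)) : PerX (EulerBVP.clampY L f) := fun x _ =>
  h x _ ⟨le_max_left _ _, max_le hL (min_le_right _ _)⟩

lemma G1.sub_base {f fx fy : ℝ × ℝ → ℝ} (h : G1 L f fx fy) (z0 : ℝ × ℝ) :
    G1 L (fun z => f z - f z0) fx fy :=
  (h.sub (G1.const _)).congr (fun _ _ => rfl) (fun _ _ => by simp) (fun _ _ => by simp)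

/-- A first-order perturbation of a parallel flow: the velocity components `m`, `n`, the vorticity
`w`, and the derivatives of these along the strip. -/
structure Flow where
  (m n mx nx mxx nxx w wx : ℝ × ℝ → ℝ)

/-- `q` is a periodic divergence free `C^{2,a}` field with curl `w`, of size `N`. -/
structure Good (L a N : ℝ) (q : Flow) : Prop where
  hm : G1 L q.m q.mx (fun z => q.nx z - q.w z)
  hn : G1 L q.n q.nx (fun z => - q.mx z)
  hmx : G1 L q.mx q.mxx (fun z => q.nxx z - q.wx z)
  hnx : G1 L q.nx q.nxx (fun z => - q.mxx z)
  pm : PerX q.m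
  pn : PerX q.n
  pw : PerX q.w
  pmx : PerX q.mx
  pnx : PerX q.nx
  pwx : PerX q.wx
  sm : ∀ y ∈ Icc 0 L, H2 a N (fun x => q.m (x, y)) (fun x => q.mx (x, y)) fun x => q.mxx (x, y)
  sn : ∀ y ∈ Icc 0 L, H2 a N (fun x => q.n (x, y)) (fun x => q.nx (x, y)) fun x => q.nxx (x, y)
  sw : ∀ y ∈ Icc 0 L, H1 a N (fun x => q.w (x, y)) fun x => q.wx (x, y)
  jm : Ho a N (strip L) q.mxx
  jn : Ho a N (strip L) q.nxx

lemma Ho.slice {f : ℝ × ℝ → ℝ} (h : Ho a N (strip L) f) {y : ℝ} (hy : y ∈ Icc 0 L) :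
    Ho a N univ fun x => f (x, y) :=
  ⟨fun x _ => h.1 _ (mem_strip.2 hy), fun x _ x' _ => by
    simpa using h.2 (x, y) (mem_strip.2 hy) (x', y) (mem_strip.2 hy)⟩

lemma continuous_of_deriv {E : Type*} [NormedAddCommGroup E] [NormedSpace ℝ E] {f f' : ℝ → E}
    (h : ∀ x, HasDerivAt f (f' x) x) : Continuous f :=
  continuous_iff_continuousAt.2 fun x => (h x).continuousAt

lemma H1.continuous_deriv (ha : a ∈ Ioo (0 : ℝ) 1) {f f' : ℝ → ℝ} (h : H1 a N f f') :
    Continuous f' := continuousOn_univ.1 (h.2.2.continuousOn ha.1)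

lemma G1.integral_x {f fx fy : ℝ × ℝ → ℝ} (h : G1 L f fx fy) {y : ℝ} (hy : y ∈ Icc 0 L)
    (hc : Continuous fun x => fx (x, y)) (x0 x1 : ℝ) :
    ∫ x in x0..x1, fx (x, y) = f (x1, y) - f (x0, y) :=
  intervalIntegral.integral_eq_sub_of_hasDerivAt (fun _ _ => h.slice_x hy)
    (hc.intervalIntegrable _ _)

lemma G1.integral_y (hL : 0 ≤ L) {f fx fy : ℝ × ℝ → ℝ} (h : G1 L f fx fy) (x : ℝ)
    (hc : ContinuousOn (fun y => fy (x, y)) (Icc 0 L)) :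
    ∫ y in (0 : ℝ)..L, fy (x, y) = f (x, L) - f (x, 0) :=
  intervalIntegral.integral_eq_sub_of_hasDerivAt_of_le hL
    (fun _ hy => (h.slice_y hy).continuousWithinAt)
    (fun _ hy => (h.slice_y (Ioo_subset_Icc_self hy)).hasDerivAt (Icc_mem_nhds hy.1 hy.2))
    (hc.intervalIntegrable_of_Icc hL)

lemma Per.integral_deriv_eq_zero (ha : a ∈ Ioo (0 : ℝ) 1) {b b' : ℝ → ℝ} (p : Per b)
    (h : H1 a N b b') (c : ℝ) : ∫ x in c..(c + 1), b' x = 0 := by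
  rw [intervalIntegral.integral_eq_sub_of_hasDerivAt (fun x _ => h.1 x)
    ((h.continuous_deriv ha).intervalIntegrable _ _), p, sub_self]

lemma Per.integral_half {b : ℝ → ℝ} (p : Per b) :
    ∫ x in (-1 / 2 : ℝ)..(1 / 2), b x = ∫ x in (0 : ℝ)..1, b x := by
  have := Function.Periodic.intervalIntegral_add_eq (f := b) (T := 1) p (-1 / 2) 0
  norm_num at this ⊢
  exact this

/-- A solution of the linear problem with one more derivative. -/
lemma RSol.of_deriv (hL : 0 < L) {w wx wy mh nh mhx nhx : ℝ × ℝ → ℝ}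
    {b0 b1 b0' b1' : ℝ → ℝ} (j : ℝ) (gw : G1 L w wx wy) (pw : PerX w)
    (h : RSol L wx b0' b1' (b0 0 - b1 0) mh nh mhx nhx) (p0 : Per b0)
    (h0 : H1 a N b0 b0') (h1 : H1 a N b1 b1')
    (hm : ∫ x in (0 : ℝ)..1, b0 x = ∫ x in (0 : ℝ)..1, b1 x) :
    ∃ μ ν, RSol L w b0 b1 j μ ν mh nh := by
  have m0 : (0 : ℝ) ∈ Icc 0 L := ⟨le_rfl, hL.le⟩
  have mL : L ∈ Icc 0 L := ⟨hL.le, le_rfl⟩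
  obtain ⟨ν', hν'⟩ := G1.poincare h.hν h.hμ.neg (fun z _ => rfl)
  have hν := (hν'.sub_base (0, 0)).add (G1.const (b0 0))
  replace hν : G1 L (fun z => ν' z - ν' (0, 0) + b0 0) nh (fun z => - mh z) :=
    hν.congr (fun _ _ => rfl) (fun _ _ => by simp) (fun _ _ => by simp)
  set ν := fun z => ν' z - ν' (0, 0) + b0 0 with hνd
  obtain ⟨μ', hμ'⟩ := G1.poincare h.hμ (h.hν.sub gw) (fun z _ => rfl)
  have ν0 : ∀ x, ν (x, 0) = b0 x := fun x => by
    have e := is_const_of_deriv_eq_zero (f := fun x => ν (x, 0) - b0 x)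
      (fun x => ((hν.slice_x m0).sub (h0.1 x)).differentiableAt)
      (fun x => ((hν.slice_x m0).sub (h0.1 x)).deriv.trans (by rw [h.h0]; simp)) x 0
    have : ν (0, 0) = b0 0 := by simp [hνd]
    linarith
  have ν1 : ∀ x, ν (x, L) = b1 x := fun x => by
    have e := is_const_of_deriv_eq_zero (f := fun x => ν (x, L) - b1 x)
      (fun x => ((hν.slice_x mL).sub (h1.1 x)).differentiableAt)
      (fun x => ((hν.slice_x mL).sub (h1.1 x)).deriv.trans (by rw [h.h1]; simp)) x 0
    have e2 := hν.integral_y hL.le 0 (h.hμ.neg.continuousOn_slice 0)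
    rw [intervalIntegral.integral_neg, h.hj, ν0 0] at e2
    linarith
  have pν : ∀ x, ∀ y ∈ Icc 0 L, ν (x + 1, y) = ν (x, y) := fun x y hy =>
    PerX.of_partials hL.le hν h.pν (fun x y => by simp only [h.pμ x y]) (by
      have := p0 0
      rw [zero_add] at this
      rw [ν0, ν0, this]) x hy
  obtain ⟨ψ, hψ⟩ := G1.poincare hν hμ'.neg (fun z _ => rfl)
  have hP : ∀ z ∈ strip L, μ' (z.1 + 1, z.2) - μ' z = μ' (1, 0) - μ' (0, 0) := fun z hz => by
    have := (((hμ'.translate 1).sub hμ').congr (fun _ _ => rfl)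
      (fun z _ => (sub_eq_zero.2 (h.pμ z.1 z.2)).symm)
      (fun z _ => by
        simp only [pw z.1 z.2, h.pν z.1 z.2]
        exact (sub_self _).symm)).eq_const hz (mem_strip.2 m0 : ((0 : ℝ), (0 : ℝ)) ∈ strip L)
    simpa using this
  have cb : ∀ {b b' : ℝ → ℝ}, H1 a N b b' → Continuous b := fun h => continuous_of_deriv h.1
  have P0 : μ' (1, 0) - μ' (0, 0) = 0 := by
    have x0 := hψ.integral_x m0 (by simpa only [ν0] using cb h0) 0 1
    have x1 := hψ.integral_x mL (by simpa only [ν1] using cb h1) 0 1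
    have y0 := hψ.integral_y hL.le 0 (hμ'.neg.continuousOn_slice 0)
    have y1 := hψ.integral_y hL.le 1 (hμ'.neg.continuousOn_slice 1)
    simp only [ν0, ν1] at x0 x1
    rw [intervalIntegral.integral_neg] at y0 y1
    have e : ∫ y in (0 : ℝ)..L, (μ' (1, y) - μ' (0, y))
        = ∫ y in (0 : ℝ)..L, (μ' (1, 0) - μ' (0, 0)) :=
      intervalIntegral.integral_congr fun y hy => by
        rw [uIcc_of_le hL.le] at hy
        simpa using hP (0, y) (mem_strip.2 hy)
    rw [intervalIntegral.integral_sub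
      ((hμ'.continuousOn_slice 1).intervalIntegrable_of_Icc hL.le)
      ((hμ'.continuousOn_slice 0).intervalIntegrable_of_Icc hL.le),
      intervalIntegral.integral_const, sub_zero, smul_eq_mul] at e
    have : L * (μ' (1, 0) - μ' (0, 0)) = 0 := by linarith
    exact (mul_eq_zero.1 this).resolve_left hL.ne'
  set c := (j - ∫ y in (0 : ℝ)..L, μ' (0, y)) / L with hc
  have hμ : G1 L (fun z => μ' z + c) mh (fun z => nh z - w z) :=
    (hμ'.add (G1.const c)).congr (fun _ _ => rfl) (fun _ _ => by simp) (fun _ _ => by simp)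
  have eμ := clampY_eqOn (L := L) fun z => μ' z + c
  have eν := clampY_eqOn (L := L) ν
  refine ⟨clampY L fun z => μ' z + c, clampY L ν,
    hμ.congr eμ (fun _ _ => rfl) (fun _ _ => rfl), hν.congr eν (fun _ _ => rfl) (fun _ _ => rfl),
    PerX.clampY hL.le fun x y hy => ?_, PerX.clampY hL.le pν, h.pμ, h.pν, fun x => ?_,
    fun x => ?_, ?_⟩
  · have := hP (x, y) (mem_strip.2 hy)
    simp only at this ⊢
    linarith
  · rw [eν (mem_strip.2 m0), ν0]
  · rw [eν (mem_strip.2 mL), ν1]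
  · rw [intervalIntegral.integral_congr (g := fun y => μ' (0, y) + c) fun y hy => by
        rw [uIcc_of_le hL.le] at hy
        exact eμ (mem_strip.2 hy),
      intervalIntegral.integral_add ((hμ'.continuousOn_slice 0).intervalIntegrable_of_Icc hL.le)
        (by simp), intervalIntegral.integral_const, sub_zero, smul_eq_mul, hc]
    field_simp
    ring

/-- Schauder estimate at second order. -/
theorem exists_Good (ha : a ∈ Ioo (0 : ℝ) 1) (hL : 0 < L) : ∃ C ≥ 0, ∀ (N : ℝ)
    (w wx wy : ℝ × ℝ → ℝ) (b0 b1 b0' b1' b0'' b1'' : ℝ → ℝ) (j : ℝ), G1 L w wx wy → PerX w →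
    ContinuousOn wx (strip L) → PerX wx →
    (∀ y ∈ Icc 0 L, H1 a N (fun x => w (x, y)) fun x => wx (x, y)) → Per b0 → Per b1 →
    H2 a N b0 b0' b0'' → H2 a N b1 b1' b1'' →
    ∫ x in (0 : ℝ)..1, b0 x = ∫ x in (0 : ℝ)..1, b1 x → |j| ≤ N →
    ∃ q : Flow, q.w = w ∧ q.wx = wx ∧ Good L a (C * N) q ∧ RSol L w b0 b1 j q.m q.n q.mx q.nx := by
  obtain ⟨C, hC, H⟩ := exists_RSol ha hL
  refine ⟨4 * C + 1, by positivity,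
    fun N w wx wy b0 b1 b0' b1' b0'' b1'' j gw pw cw pwx sw p0 p1 h0 h1
    hm hj => ?_⟩
  have hN : 0 ≤ N := h0.nonneg
  have p0' := p0.deriv_of h0.1
  have p1' := p1.deriv_of h1.1
  have i0 := Per.integral_deriv_eq_zero ha p0 (h0.h1 ha) (-1 / 2)
  have i1 := Per.integral_deriv_eq_zero ha p1 (h1.h1 ha) (-1 / 2)
  norm_num at i0 i1
  have b0N := h0.2.1 0
  have b1N := h1.2.1 0
  rw [Real.norm_eq_abs] at b0N b1N
  obtain ⟨mh, nh, mhx, nhx, hr, j1, j2, s1, s2⟩ := H (2 * N) wx b0' b1' b0'' b1''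
    (b0 0 - b1 0) cw pwx (fun y hy => ((sw y hy).2.2).mono (by linarith)) p0' p1'
    (h0.2.2.mono (by linarith)) (h1.2.2.mono (by linarith)) (by norm_num [i0, i1])
    ((abs_sub _ _).trans (by linarith))
  obtain ⟨μ, ν, μx, νx, hr', -, -, s3, s4⟩ := H (2 * N) w b0 b1 b0' b1' j gw.continuousOn pw
    (fun y hy => (sw y hy).ho ha) p0 p1 (h0.h1 ha) (h1.h1 ha)
      (by rw [p0.integral_half, p1.integral_half, hm])
    (by linarith)
  obtain ⟨μ', ν', hr''⟩ := hr.of_deriv hL j gw pw p0 (h0.h1 ha) (h1.h1 ha) hm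
  obtain ⟨-, -, e1, e2⟩ := hr'.unique hL hr''
  have hCN : C * (2 * N) ≤ (4 * C + 1) * N := by nlinarith [mul_nonneg hC hN]
  have gm : G1 L μx mhx (fun z => nhx z - wx z) := hr.hμ.congr e1 (fun _ _ => rfl) fun _ _ => rfl
  have gn : G1 L νx nhx (fun z => - mhx z) := hr.hν.congr e2 (fun _ _ => rfl) fun _ _ => rfl
  refine ⟨⟨μ, ν, μx, νx, mhx, nhx, w, wx⟩, rfl, rfl, ⟨hr'.hμ, hr'.hν, gm, gn, hr'.pμ, hr'.pν, pw,
    hr'.pμx, hr'.pνx, pwx, fun y hy => ⟨fun x => hr'.hμ.slice_x hy, fun x => ?_,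
      fun x => gm.slice_x hy, fun x => ?_, (j1.mono hCN).slice hy⟩,
    fun y hy => ⟨fun x => hr'.hν.slice_x hy, fun x => ?_,
      fun x => gn.slice_x hy, fun x => ?_, (j2.mono hCN).slice hy⟩,
    fun y hy => (sw y hy).mono (by nlinarith [mul_nonneg hC hN]), j1.mono hCN, j2.mono hCN⟩, hr'⟩
  · exact (s3 _ (mem_strip.2 hy)).trans hCN
  · dsimp only
    rw [e1 (mem_strip.2 hy)]
    exact (s1 _ (mem_strip.2 hy)).trans hCN
  · exact (s4 _ (mem_strip.2 hy)).trans hCN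
  · dsimp only
    rw [e2 (mem_strip.2 hy)]
    exact (s2 _ (mem_strip.2 hy)).trans hCN

end SecondOrder

section Lagrangian

variable {L a N D : ℝ}

lemma monotone_sub_of_deriv {Ψ g : ℝ → ℝ} (h : ∀ x, HasDerivAt Ψ (g x) x)
    (hg : ∀ x, 1 / 2 ≤ g x) : Monotone fun x => Ψ x - x * (1 / 2) := by
  have hd : ∀ x, HasDerivAt (fun x => Ψ x - x * (1 / 2)) (g x - 1 / 2) x := fun x => by
    have h1 := (hasDerivAt_id x).mul_const (1 / 2 : ℝ)
    rw [one_mul] at h1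
    exact (h x).sub h1
  exact monotone_of_deriv_nonneg (fun x => (hd x).differentiableAt) fun x => by
    rw [(hd x).deriv]; linarith [hg x]

lemma abs_sub_le_of_deriv {Ψ g : ℝ → ℝ} (h : ∀ x, HasDerivAt Ψ (g x) x)
    (hg : ∀ x, 1 / 2 ≤ g x) (x y : ℝ) : |x - y| ≤ 2 * |Ψ x - Ψ y| := by
  have m := monotone_sub_of_deriv h hg
  rcases le_total x y with hxy | hxy
  · have := m hxy
    simp only at this
    rw [abs_of_nonpos (by linarith), abs_of_nonpos (by linarith)]; linarith
  · have := m hxy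
    simp only at this
    rw [abs_of_nonneg (by linarith), abs_of_nonneg (by linarith)]; linarith

lemma exists_inverse {Ψ g : ℝ → ℝ} (h : ∀ x, HasDerivAt Ψ (g x) x) (hg : ∀ x, 1 / 2 ≤ g x) :
    ∃ S : ℝ → ℝ, (∀ x, S (Ψ x) = x) ∧ (∀ t, Ψ (S t) = t) ∧
      ∀ t, HasDerivAt S (g (S t))⁻¹ t := by
  have m := monotone_sub_of_deriv h hg
  have hinj : Function.Injective Ψ := fun x y e => by
    have := abs_sub_le_of_deriv h hg x y
    rw [e, sub_self, abs_zero, mul_zero] at this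
    exact sub_eq_zero.1 (abs_nonpos_iff.1 this)
  have hc : Continuous Ψ := continuous_of_deriv h
  have hsurj : Function.Surjective Ψ := hc.surjective
    (Filter.tendsto_atTop_mono' _ ((Filter.eventually_ge_atTop 0).mono fun x hx => by
      have := m hx; simp only at this; (show Ψ 0 + x * (1 / 2) ≤ Ψ x); linarith)
      (Filter.tendsto_atTop_add_const_left _ _
        (Filter.tendsto_id.atTop_mul_const (by norm_num : (0 : ℝ) < 1 / 2))))
    (Filter.tendsto_atBot_mono' _ ((Filter.eventually_le_atBot 0).mono fun x hx => by
      have := m hx; simp only at this; (show Ψ x ≤ Ψ 0 + x * (1 / 2)); linarith)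
      (Filter.tendsto_atBot_add_const_left _ _
        (Filter.tendsto_id.atBot_mul_const (by norm_num : (0 : ℝ) < 1 / 2))))
  obtain ⟨S, hS⟩ := hsurj.hasRightInverse
  have hl : ∀ x, S (Ψ x) = x := fun x => hinj (hS _)
  have hlip : LipschitzWith 2 S := LipschitzWith.of_dist_le_mul fun s t => by
    have := abs_sub_le_of_deriv h hg (S s) (S t)
    rwa [hS, hS] at this
  exact ⟨S, hl, hS, fun t => HasDerivAt.of_local_left_inverse hlip.continuous.continuousAt
    (h _) (by linarith [hg (S t)]) (.of_forall hS)⟩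

/-- `s z` is the foot on the bottom boundary of the streamline of `(m, 1 + n)` through `z`. -/
structure Lag (L : ℝ) (m n : ℝ × ℝ → ℝ) (β : ℝ → ℝ) (s : ℝ × ℝ → ℝ) : Prop where
  hs : G1 L s (fun z => (1 + β (s z))⁻¹ * (1 + n z)) (fun z => (1 + β (s z))⁻¹ * -m z)
  s0 : ∀ x, s (x, 0) = x
  sp : ∀ x y, s (x + 1, y) = s (x, y) + 1

lemma exists_Lag (hL : 0 < L) {m n mx my nx : ℝ × ℝ → ℝ} {β : ℝ → ℝ} (hm : G1 L m mx my)
    (hn : G1 L n nx (fun z => - mx z)) (pm : PerX m) (pn : PerX n) (h0 : ∀ x, n (x, 0) = β x)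
    (hβ : ∀ x, |β x| ≤ 1 / 2) : ∃ s, Lag L m n β s := by
  have m0 : (0 : ℝ) ∈ Icc 0 L := ⟨le_rfl, hL.le⟩
  have gα : G1 L (fun z => 1 + n z) nx (fun z => - mx z) :=
    ((G1.const 1).add hn).congr (fun _ _ => rfl) (fun _ _ => by simp) (fun _ _ => by simp)
  obtain ⟨ψ, hψ⟩ := G1.poincare gα hm.neg (fun z _ => rfl)
  have hΨ : ∀ x, HasDerivAt (fun x => ψ (x, 0)) (1 + β x) x := fun x => by
    rw [← h0]; exact hψ.slice_x m0
  have hg : ∀ x, 1 / 2 ≤ 1 + β x := fun x => by linarith [(abs_le.1 (hβ x)).1]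
  obtain ⟨S, hl, hr, hS⟩ := exists_inverse hΨ hg
  have hs := hψ.comp hS
  have hP : ∀ z ∈ strip L, ψ (z.1 + 1, z.2) - ψ z = ψ (1, 0) - ψ (0, 0) := fun z hz => by
    have := (((hψ.translate 1).sub hψ).congr (fun _ _ => rfl)
      (fun z _ => by simp only [pn z.1 z.2]; exact (sub_self _).symm)
      (fun z _ => by simp only [pm z.1 z.2]; exact (sub_self _).symm)).eq_const hz
        (mem_strip.2 m0 : ((0 : ℝ), (0 : ℝ)) ∈ strip L)
    simpa using this
  have e := clampY_eqOn (L := L) fun z => S (ψ z)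
  refine ⟨clampY L fun z => S (ψ z),
    hs.congr e (fun z hz => by rw [e hz]) (fun z hz => by rw [e hz]),
    fun x => (e (mem_strip.2 m0)).trans (hl x), fun x y => ?_⟩
  set y' := max 0 (min y L)
  have hy' : y' ∈ Icc 0 L := ⟨le_max_left _ _, max_le hL.le (min_le_right _ _)⟩
  show S (ψ (x + 1, y')) = S (ψ (x, y')) + 1
  rw [← hl (S (ψ (x, y')) + 1)]
  congr 1
  have h1 := hP (x, y') (mem_strip.2 hy')
  have h2 := hP (S (ψ (x, y')), 0) (mem_strip.2 m0)
  have h3 := hr (ψ (x, y'))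
  simp only at h1 h2 h3
  linarith

section Estimates

variable {m n m' n' : ℝ × ℝ → ℝ} {β β' : ℝ → ℝ} {s s' : ℝ × ℝ → ℝ}

lemma abs_inv_mul_le {b c : ℝ} (hb : |b| ≤ 1 / 2) (hc : |c| ≤ 1) :
    |(1 + b)⁻¹ * (1 + c)| ≤ 4 := by
  have hg : 1 / 2 ≤ 1 + b := by linarith [(abs_le.1 hb).1]
  rw [abs_mul, abs_of_nonneg (by positivity)]
  have h1 : (1 + b)⁻¹ ≤ 2 := by
    rw [inv_le_comm₀ (by linarith) (by norm_num)]; linarith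
  have h2 : |1 + c| ≤ 2 := (abs_add_le _ _).trans (by rw [abs_one]; linarith)
  nlinarith [abs_nonneg (1 + c), inv_nonneg.2 (by linarith : 0 ≤ 1 + b)]

lemma Lag.lip (h : Lag L m n β s) (hβ : ∀ x, |β x| ≤ 1 / 2) (hn : ∀ z ∈ strip L, |n z| ≤ 1)
    {y : ℝ} (hy : y ∈ Icc 0 L) (x x' : ℝ) : |s (x, y) - s (x', y)| ≤ 4 * |x - x'| :=
  lip_of_deriv (fun _ => h.hs.slice_x hy) (fun _ => abs_inv_mul_le (hβ _) (hn _ (mem_strip.2 hy)))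
    x x'

lemma Lag.abs_sub_le (hL : 0 < L) (h : Lag L m n β s) (h' : Lag L m' n' β s')
    (hβc : Continuous β) (hβ : ∀ x, |β x| ≤ 1 / 2) (hD : ∀ z ∈ strip L, |m z - m' z| ≤ D)
    {z : ℝ × ℝ} (hz : z ∈ strip L) : |s z - s' z| ≤ 2 * L * D := by
  have hg : ∀ x, 1 / 2 ≤ 1 + β x := fun x => by linarith [(abs_le.1 (hβ x)).1]
  have hΨ : ∀ x, HasDerivAt (fun x => ∫ t in (0 : ℝ)..x, (1 + β t)) (1 + β x) x := fun x =>
    ((continuous_const.add hβc).integral_hasStrictDerivAt 0 x).hasDerivAt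
  set Ψ : ℝ → ℝ := fun x => ∫ t in (0 : ℝ)..x, (1 + β t)
  refine (abs_sub_le_of_deriv hΨ hg _ _).trans ?_
  have gE := ((h.hs.comp hΨ).sub (h'.hs.comp hΨ))
  have hz2 := mem_strip.1 (show (z.1, z.2) ∈ strip L from hz)
  have m0 : (0 : ℝ) ∈ Icc 0 L := ⟨le_rfl, hL.le⟩
  have key := (convex_Icc 0 L).norm_image_sub_le_of_norm_hasDerivWithin_le (C := D)
    (fun y hy => gE.slice_y (x := z.1) hy) (fun y hy => ?_) m0 hz2
  · simp only [h.s0, h'.s0, sub_self, sub_zero, Real.norm_eq_abs] at key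
    have hD0 := (abs_nonneg _).trans (hD z hz)
    rw [abs_of_nonneg hz2.1] at key
    nlinarith [hz2.2]
  · have g1 := hg (s (z.1, y))
    have g2 := hg (s' (z.1, y))
    have := hD (z.1, y) (mem_strip.2 hy)
    rw [Real.norm_eq_abs, ← mul_assoc, ← mul_assoc, mul_inv_cancel₀ (by linarith),
      mul_inv_cancel₀ (by linarith), one_mul, one_mul, neg_sub_neg, abs_sub_comm]
    exact this

lemma abs_inv_sub_inv_le {x y : ℝ} (hx : 1 / 2 ≤ x) (hy : 1 / 2 ≤ y) :
    |x⁻¹ - y⁻¹| ≤ 4 * |x - y| := by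
  have hx0 : 0 < x := by linarith
  have hy0 : 0 < y := by linarith
  have hxy : 0 < x * y := by positivity
  rw [inv_sub_inv hx0.ne' hy0.ne', abs_div, abs_sub_comm, abs_of_pos hxy, div_le_iff₀ hxy]
  have : 1 ≤ 4 * (x * y) := by nlinarith
  nlinarith [abs_nonneg (x - y)]

lemma Lag.abs_deriv_sub_le (hL : 0 < L) (h : Lag L m n β s) (h' : Lag L m' n' β s')
    (hβd : ∀ x, HasDerivAt β (β' x) x) (hβ' : ∀ x, |β' x| ≤ 1)
    (hβ : ∀ x, |β x| ≤ 1 / 2) (hD : ∀ z ∈ strip L, |m z - m' z| ≤ D)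
    (hDn : ∀ z ∈ strip L, |n z - n' z| ≤ D) (hn' : ∀ z ∈ strip L, |n' z| ≤ 1)
    {z : ℝ × ℝ} (hz : z ∈ strip L) :
    |(1 + β (s z))⁻¹ * (1 + n z) - (1 + β (s' z))⁻¹ * (1 + n' z)| ≤ (2 + 16 * L) * D := by
  have hθ := h.abs_sub_le hL h' (continuous_of_deriv hβd) hβ hD hz
  have hg : ∀ x, 1 / 2 ≤ 1 + β x := fun x => by linarith [(abs_le.1 (hβ x)).1]
  have i1 : |(1 + β (s z))⁻¹| ≤ 2 := by
    rw [abs_of_nonneg (by linarith [inv_nonneg.2 (by linarith [hg (s z)] : 0 ≤ 1 + β (s z))]),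
      inv_le_comm₀ (by linarith [hg (s z)]) (by norm_num)]
    linarith [hg (s z)]
  have i2 : |(1 + β (s z))⁻¹ - (1 + β (s' z))⁻¹| ≤ 4 * (2 * L * D) := by
    refine (abs_inv_sub_inv_le (hg _) (hg _)).trans ?_
    have := lip_of_deriv hβd hβ' (s z) (s' z)
    rw [add_sub_add_left_eq_sub]
    rw [Real.norm_eq_abs] at this
    linarith
  have i3 : |1 + n' z| ≤ 2 := (abs_add_le _ _).trans (by rw [abs_one]; linarith [hn' z hz])
  have e : (1 + β (s z))⁻¹ * (1 + n z) - (1 + β (s' z))⁻¹ * (1 + n' z)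
      = (1 + β (s z))⁻¹ * (n z - n' z) + ((1 + β (s z))⁻¹ - (1 + β (s' z))⁻¹) * (1 + n' z) := by
    ring
  rw [e]
  refine (abs_add_le _ _).trans ?_
  rw [abs_mul, abs_mul]
  have := mul_le_mul i1 (hDn z hz) (abs_nonneg _) (by norm_num)
  have := mul_le_mul i2 i3 (abs_nonneg _) ((abs_nonneg _).trans i2)
  linarith

end Estimates

lemma Ho.comp_sub_comp (ha : a ∈ Ioo (0 : ℝ) 1) {f f' s s' : ℝ → ℝ} {K : ℝ} (h : H1 a N f f')
    (hK : 1 ≤ K) (hs : ∀ x y, |s x - s y| ≤ K * |x - y|) (hs' : ∀ x y, |s' x - s' y| ≤ K * |x - y|)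
    (hθ : Ho a D univ fun x => s x - s' x) :
    Ho a (2 * K * N * D) univ fun x => f (s x) - f (s' x) := by
  have hN := h.nonneg
  have hD := hθ.nonneg univ_nonempty
  have hND := mul_nonneg hN hD
  refine ⟨fun x _ => (h.lip _ _).trans ?_, fun x _ y _ => ?_⟩
  · have := hθ.1 x trivial
    rw [Real.norm_eq_abs] at this
    nlinarith [mul_le_mul_of_nonneg_left this hN]
  set p := fun x τ => s' x + τ * (s x - s' x) with hp
  have hd : ∀ x τ, HasDerivAt (fun τ => f (p x τ)) (f' (p x τ) * (s x - s' x)) τ := fun x τ => by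
    have : HasDerivAt (fun τ => p x τ) (s x - s' x) τ := by
      simpa [hp] using ((hasDerivAt_id τ).mul_const (s x - s' x)).const_add (s' x)
    exact (h.1 _).comp τ this
  have key := (convex_Icc (0 : ℝ) 1).norm_image_sub_le_of_norm_hasDerivWithin_le
    (C := 2 * K * N * D * ‖x - y‖ ^ a)
    (fun τ _ => ((hd x τ).sub (hd y τ)).hasDerivWithinAt) (fun τ hτ => ?_)
    (left_mem_Icc.2 zero_le_one) (right_mem_Icc.2 zero_le_one)
  · simp only [Pi.sub_apply, hp, one_mul, zero_mul, add_zero, add_sub_cancel, sub_zero, norm_one,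
      mul_one] at key
    convert key using 2
    ring
  · have hr : 0 ≤ ‖x - y‖ ^ a := by positivity
    have e1 : |p x τ - p y τ| ≤ K * ‖x - y‖ := by
      have : p x τ - p y τ = (1 - τ) * (s' x - s' y) + τ * (s x - s y) := by simp only [hp]; ring
      rw [this]
      refine (abs_add_le _ _).trans ?_
      rw [abs_mul, abs_mul, abs_of_nonneg hτ.1, abs_of_nonneg (by linarith [hτ.2] : 0 ≤ 1 - τ),
        Real.norm_eq_abs]
      nlinarith [hs x y, hs' x y, hτ.1, hτ.2]
    have e2 : ‖f' (p x τ) - f' (p y τ)‖ ≤ N * (K * ‖x - y‖ ^ a) := by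
      refine (h.2.2.2 _ trivial _ trivial).trans ?_
      gcongr
      refine (Real.rpow_le_rpow (norm_nonneg _) e1 ha.1.le).trans ?_
      rw [Real.mul_rpow (by linarith) (norm_nonneg _)]
      gcongr
      exact (Real.rpow_le_rpow_of_exponent_le hK ha.2.le).trans_eq (Real.rpow_one K)
    have e3 := hθ.1 x trivial
    have e4 := hθ.2 x trivial y trivial
    have e5 := h.2.2.1 (p y τ) trivial
    have e : f' (p x τ) * (s x - s' x) - f' (p y τ) * (s y - s' y)
        = (f' (p x τ) - f' (p y τ)) * (s x - s' x)
          + f' (p y τ) * ((s x - s' x) - (s y - s' y)) := by ring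
    rw [e]
    refine (norm_add_le _ _).trans ?_
    rw [norm_mul, norm_mul]
    have g1 := mul_le_mul e2 e3 (norm_nonneg _) (by positivity)
    have g2 := mul_le_mul e5 e4 (norm_nonneg _) hN
    have : N * D * ‖x - y‖ ^ a ≤ K * (N * D * ‖x - y‖ ^ a) :=
      le_mul_of_one_le_left (by positivity) hK
    nlinarith

lemma Per.abs_le_of_integral_eq_zero {f f' : ℝ → ℝ} {B : ℝ} (hp : Per f)
    (hd : ∀ x, HasDerivAt f (f' x) x) (hB : ∀ x, |f' x| ≤ B) (hi : ∫ x in (0 : ℝ)..1, f x = 0)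
    (x : ℝ) : |f x| ≤ B := by
  have hc : Continuous f := continuous_of_deriv hd
  have h1 : ∫ t in x..(x + 1), f t = 0 := by
    have := Function.Periodic.intervalIntegral_add_eq (f := f) (T := 1) hp x 0
    rw [this, zero_add, hi]
  have h2 : ∫ t in x..(x + 1), (f x - f t) = f x := by
    rw [intervalIntegral.integral_sub (by simp) (hc.intervalIntegrable _ _), h1]
    simp
  rw [← h2, ← Real.norm_eq_abs]
  refine (intervalIntegral.norm_integral_le_of_norm_le_const (C := B) fun t ht => ?_).trans ?_
  · rw [uIoc_of_le (by linarith)] at ht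
    refine (lip_of_deriv hd hB x t).trans ?_
    have hB0 := (abs_nonneg _).trans (hB 0)
    rw [abs_sub_comm, abs_of_nonneg (by linarith [ht.1])]
    nlinarith [ht.2]
  · simp

end Lagrangian

section Iteration

variable {L a N δ D : ℝ}

/-- Reduced boundary data, with two derivatives: the normal velocity on the bottom, and the
inhomogeneous parts of the Bernoulli function on the bottom and of the normal velocity on the
top; and the flux. -/
structure BD where
  (β β' β'' A A' A'' T T' T'' : ℝ → ℝ)
  j : ℝ

structure BD.Good (a δ : ℝ) (d : BD) : Prop where
  pβ : Per d.β
  pA : Per d.A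
  pT : Per d.T
  hβ : H2 a δ d.β d.β' d.β''
  hA : H2 a δ d.A d.A' d.A''
  hT : H2 a δ d.T d.T' d.T''
  hj : |d.j| ≤ δ

/-- The vorticity as a function of the foot of the streamline. -/
def kap (d : BD) (q : Flow) (t : ℝ) : ℝ :=
  (1 + d.β t)⁻¹ * (d.A' t + (q.m (t, 0) * q.mx (t, 0) + d.β t * d.β' t))

/-- The Bernoulli function, up to a constant, as a function of the foot of the streamline. -/
def bern (d : BD) (q : Flow) (t : ℝ) : ℝ :=
  d.A t + (q.m (t, 0) * q.m (t, 0) + d.β t * d.β t) / 2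

/-- The normal velocity on the top, up to a constant. -/
def topN (L : ℝ) (d : BD) (q : Flow) (s : ℝ × ℝ → ℝ) (x : ℝ) : ℝ :=
  bern d q (s (x, L)) - (q.m (x, L) * q.m (x, L) + q.n (x, L) * q.n (x, L)) / 2 + d.T x

/-- `q'` solves the linearised problem with vorticity transported by `q`. -/
def Step (L : ℝ) (d : BD) (q q' : Flow) : Prop :=
  ∃ s c, Lag L q.m q.n d.β s ∧ (∀ z ∈ strip L, q'.w z = kap d q (s z)) ∧
    RSol L q'.w d.β (fun x => topN L d q s x + c) d.j q'.m q'.n q'.mx q'.nx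

lemma BD.Good.mono {d : BD} (h : d.Good a δ) (hδ : δ ≤ N) : d.Good a N :=
  ⟨h.pβ, h.pA, h.pT, h.hβ.mono hδ, h.hA.mono hδ, h.hT.mono hδ, h.hj.trans hδ⟩

lemma H1.const_add {f f' : ℝ → ℝ} (c : ℝ) (h : H1 a N f f') :
    H1 a (|c| + N) (fun x => c + f x) f' :=
  ⟨fun x => (h.1 x).const_add c,
    fun x => (abs_add_le _ _).trans (add_le_add le_rfl (h.2.1 x)), h.2.2.mono (by
      linarith [abs_nonneg c])⟩

lemma Good.kap_h1 {d : BD} {q : Flow} (ha : a ∈ Ioo (0 : ℝ) 1) (hL : 0 < L) (hd : d.Good a δ)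
    (hδN : δ ≤ N) (hN : N ≤ 1 / 8) (hq : Good L a N q) :
    ∃ κ', H1 a (435200 * (δ + N ^ 2)) (kap d q) κ' := by
  have hδ : 0 ≤ δ := hd.hβ.nonneg
  have m0 : (0 : ℝ) ∈ Icc 0 L := ⟨le_rfl, hL.le⟩
  have g1 : H1 a 2 (fun t => 1 + d.β t) d.β' :=
    ((hd.hβ.h1 ha).const_add 1).mono (by rw [abs_one]; linarith)
  have gi := g1.inv ha (by norm_num) fun t => by
    have := (abs_le.1 (hd.hβ.2.1 t)).1; linarith
  have s0 := hq.sm 0 m0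
  have e1 := (s0.h1 ha).mul ha s0.2.2
  have e2 := (hd.hβ.h1 ha).mul ha hd.hβ.2.2
  have := gi.mul ha (hd.hA.2.2.add (e1.add e2))
  refine ⟨_, this.mono ?_⟩
  nlinarith

lemma Good.abs_n_le {q : Flow} (hq : Good L a N q) {z : ℝ × ℝ} (hz : z ∈ strip L) : |q.n z| ≤ N :=
  (hq.sn z.2 hz.2).2.1 z.1

lemma Lag.deriv_ho {d : BD} {q : Flow} {s : ℝ × ℝ → ℝ} (ha : a ∈ Ioo (0 : ℝ) 1)
    (hd : d.Good a N) (hN : N ≤ 1 / 8) (hq : Good L a N q) (hs : Lag L q.m q.n d.β s) {y : ℝ}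
    (hy : y ∈ Icc 0 L) :
    Ho a 160 univ fun x => (1 + d.β (s (x, y)))⁻¹ * (1 + q.n (x, y)) := by
  have hN0 : 0 ≤ N := hd.hβ.nonneg
  have hb : ∀ x, |d.β x| ≤ 1 / 2 := fun x => (hd.hβ.2.1 x).trans (by linarith)
  have g1 : Ho a 2 univ (fun t => 1 + d.β t) :=
    ((Ho.const (a := a) (S := univ) (1 : ℝ)).add ((hd.hβ.h1 ha).ho ha)).mono (by
      rw [norm_one]; linarith)
  have g2 : Ho a 2 univ (fun x => 1 + q.n (x, y)) :=
    ((Ho.const (a := a) (S := univ) (1 : ℝ)).add (((hq.sn y hy).h1 ha).ho ha)).mono (by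
      rw [norm_one]; linarith)
  have gi := g1.inv fun t _ => by have := (abs_le.1 (hb t)).1; linarith
  have gs := gi.comp_lip (T := univ) (s := fun x => s (x, y)) (K := 4) ha (mapsTo_univ _ _)
    (by norm_num) fun x _ x' _ => hs.lip hb
      (fun z hz => (hq.abs_n_le hz).trans (by linarith)) hy x x'
  exact (gs.mul g2).mono (by norm_num)

lemma Good.hasDerivAt_bern {d : BD} {q : Flow} (hL : 0 < L) (hd : d.Good a N) (hN : N ≤ 1 / 8)
    (hq : Good L a N q) (t : ℝ) :
    HasDerivAt (bern d q) ((1 + d.β t) * kap d q t) t := by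
  have m0 : (0 : ℝ) ∈ Icc 0 L := ⟨le_rfl, hL.le⟩
  have hb : 0 < 1 + d.β t := by
    have := (abs_le.1 (hd.hβ.2.1 t)).1; linarith
  have h1 := hq.hm.slice_x m0 (x := t)
  have h2 := hd.hβ.1 t
  have := (hd.hA.1 t).add (((h1.mul h1).add (h2.mul h2)).div_const 2)
  refine this.congr_deriv ?_
  simp only [kap, mul_inv_cancel_left₀ hb.ne']
  ring

lemma Good.hasDerivAt_topN {d : BD} {q : Flow} {s : ℝ × ℝ → ℝ} (hL : 0 < L) (hd : d.Good a N)
    (hN : N ≤ 1 / 8) (hq : Good L a N q) (hs : Lag L q.m q.n d.β s) (x : ℝ) :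
    HasDerivAt (topN L d q s) (kap d q (s (x, L)) * (1 + q.n (x, L))
      - (q.m (x, L) * q.mx (x, L) + q.n (x, L) * q.nx (x, L)) + d.T' x) x := by
  have mL : L ∈ Icc 0 L := ⟨hL.le, le_rfl⟩
  have hb : 0 < 1 + d.β (s (x, L)) := by
    have := (abs_le.1 (hd.hβ.2.1 (s (x, L)))).1; linarith
  have h1 := hq.hm.slice_x mL (x := x)
  have h2 := hq.hn.slice_x mL (x := x)
  have h3 := (hq.hasDerivAt_bern hL hd hN (s (x, L))).comp x (hs.hs.slice_x mL (x := x))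
  have := (h3.sub (((h1.mul h1).add (h2.mul h2)).div_const 2)).add (hd.hT.1 x)
  refine this.congr_deriv ?_
  have e : ∀ b k n : ℝ, 0 < b → b * k * (b⁻¹ * n) = k * n := fun b k n hb => by field_simp
  rw [e _ _ _ hb]
  ring

lemma Good.per_kap {d : BD} {q : Flow} (hd : d.Good a N) (hq : Good L a N q) : Per (kap d q) :=
  fun x => by
    have h1 := hd.pA.deriv_of hd.hA.1 x
    have h2 := hd.pβ.deriv_of hd.hβ.1 x
    simp only [kap, hd.pβ x, h1, h2, hq.pm x 0, hq.pmx x 0]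

lemma Good.per_topN {d : BD} {q : Flow} {s : ℝ × ℝ → ℝ} (hd : d.Good a N) (hq : Good L a N q)
    (hs : Lag L q.m q.n d.β s) : Per (topN L d q s) := fun x => by
  simp only [topN, bern, hs.sp x L, hd.pβ _, hd.pA _, hd.pT x, hq.pm _ _, hq.pn _ _]

/-- The iteration is well defined and preserves small balls. -/
theorem exists_Step (ha : a ∈ Ioo (0 : ℝ) 1) (hL : 0 < L) :
    ∃ C ≥ 0, ∀ (N δ : ℝ) (d : BD) (q : Flow),
    δ ≤ N → N ≤ 1 / 8 → d.Good a δ → Good L a N q → (∀ x, q.n (x, 0) = d.β x) →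
    ∃ q', Good L a (C * (δ + N ^ 2)) q' ∧ Step L d q q' := by
  obtain ⟨C, hC, H⟩ := exists_Good ha hL
  set B2 : ℝ := 2 * 160 ^ 2 * 435200 with hB2
  set B3 : ℝ := 16 * B2 + 34 with hB3
  refine ⟨C * B3, by positivity, fun N δ d q hδN hN hd hq h0 => ?_⟩
  have hdN := hd.mono hδN
  have hδ : 0 ≤ δ := hd.hβ.nonneg
  have hN0 : 0 ≤ N := hδ.trans hδN
  have mL : L ∈ Icc 0 L := ⟨hL.le, le_rfl⟩
  have hb : ∀ x, |d.β x| ≤ 1 / 2 := fun x => (hd.hβ.2.1 x).trans (by linarith)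
  set η := δ + N ^ 2 with hη
  have hη0 : 0 ≤ η := by positivity
  obtain ⟨s, hs⟩ := exists_Lag hL hq.hm hq.hn hq.pm hq.pn h0 hb
  obtain ⟨κ', hκ⟩ := hq.kap_h1 ha hL hd hδN hN
  have pκ := hq.per_kap hdN
  have pκ' := pκ.deriv_of hκ.1
  have gw := hs.hs.comp hκ.1
  have sw : ∀ y ∈ Icc 0 L, H1 a (B2 * η) (fun x => kap d q (s (x, y)))
      fun x => κ' (s (x, y)) * ((1 + d.β (s (x, y)))⁻¹ * (1 + q.n (x, y))) := fun y hy =>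
    (hκ.comp ha (by norm_num) (fun x => hs.hs.slice_x hy) (hs.deriv_ho ha hdN hN hq hy)).mono
      (by rw [hB2]; linarith)
  have n1 : H1 a 2 (fun x => 1 + q.n (x, L)) fun x => q.nx (x, L) :=
    (((hq.sn L mL).h1 ha).const_add 1).mono (by rw [abs_one]; linarith)
  have t1 := (((sw L mL).mul ha n1).sub ((((hq.sm L mL).h1 ha).mul ha (hq.sm L mL).2.2).add
    (((hq.sn L mL).h1 ha).mul ha (hq.sn L mL).2.2))).add hd.hT.2.2
  have dt := hq.hasDerivAt_topN hL hdN hN hs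
  have pt := hq.per_topN hdN hs
  have hcβ := continuous_of_deriv hd.hβ.1
  have hct : Continuous (topN L d q s) := continuous_of_deriv dt
  set c := (∫ x in (0 : ℝ)..1, d.β x) - ∫ x in (0 : ℝ)..1, topN L d q s x with hc
  have ib : |∫ x in (0 : ℝ)..1, d.β x| ≤ δ := by
    simpa using intervalIntegral.norm_integral_le_of_norm_le_const (a := (0 : ℝ)) (b := 1)
      fun x _ => hd.hβ.2.1 x
  have hi : ∀ c', ∫ x in (0 : ℝ)..1, (topN L d q s x + c')
      = (∫ x in (0 : ℝ)..1, topN L d q s x) + c' :=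
    fun c' => by
      rw [intervalIntegral.integral_add (hct.intervalIntegrable _ _) (by simp)]; simp
  have t1' := t1.mono (K := (16 * B2 + 33) * η) (by nlinarith)
  have bt : ∀ x, |topN L d q s x + -∫ x in (0 : ℝ)..1, topN L d q s x| ≤ (16 * B2 + 33) * η :=
    Per.abs_le_of_integral_eq_zero
      (f := fun x => topN L d q s x + -∫ x in (0 : ℝ)..1, topN L d q s x)
      (fun x => by simp only [pt x]) (fun x => (dt x).add_const _)
      (fun x => t1'.2.1 x) (by rw [hi]; ring)
  have cw : ContinuousOn (fun z => κ' (s z) * ((1 + d.β (s z))⁻¹ * (1 + q.n z))) (strip L) := by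
    have cs := hs.hs.continuousOn
    have cκ := hκ.continuous_deriv ha
    refine (cκ.comp_continuousOn cs).mul (ContinuousOn.mul (ContinuousOn.inv₀
      (continuousOn_const.add (hcβ.comp_continuousOn cs)) fun z _ => ?_)
      (continuousOn_const.add hq.hn.continuousOn))
    have := (abs_le.1 (hb (s z))).1
    exact (by linarith : 0 < 1 + d.β (s z)).ne'
  have t2 : H2 a (B3 * η) (fun x => topN L d q s x + c) _ _ :=
    ⟨fun x => (dt x).add_const c, fun x => ?_, t1.mono (by nlinarith)⟩
  · obtain ⟨q', ew, ewx, gq, rq⟩ := H (B3 * η) (fun z => kap d q (s z))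
      (fun z => κ' (s z) * ((1 + d.β (s z))⁻¹ * (1 + q.n z))) _ d.β _ d.β' _ d.β'' _ d.j gw
      (fun x y => by simp only [hs.sp x y, pκ _]) cw
      (fun x y => by simp only [hs.sp x y, pκ' _, hd.pβ _, hq.pn x y])
      (fun y hy => (sw y hy).mono (by nlinarith)) hd.pβ (fun x => by simp only [pt x])
      (hd.hβ.mono (by nlinarith)) t2 (by rw [hi, hc]; ring) (hd.hj.trans (by nlinarith))
    exact ⟨q', by rw [mul_assoc]; exact gq, s, c, hs, fun z _ => by rw [ew], by rw [ew]; exact rq⟩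
  · have e : topN L d q s x + c = (topN L d q s x + -∫ x in (0 : ℝ)..1, topN L d q s x)
        + ∫ x in (0 : ℝ)..1, d.β x := by rw [hc]; ring
    show ‖topN L d q s x + c‖ ≤ _
    rw [e]
    refine (norm_add_le _ _).trans ?_
    have := bt x
    simp only [Real.norm_eq_abs]
    nlinarith

end Iteration

section Contraction

variable {L a N D : ℝ} {d : BD} {q r q' r' : Flow} {s u : ℝ × ℝ → ℝ}

lemma RSol.mean (hL : 0 < L) {ω : ℝ × ℝ → ℝ} {b0 b1 : ℝ → ℝ} {j : ℝ} {μ ν μx νx : ℝ × ℝ → ℝ}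
    (h : RSol L ω b0 b1 j μ ν μx νx) : ∫ x in (0 : ℝ)..1, b0 x = ∫ x in (0 : ℝ)..1, b1 x := by
  have := integral_div_eq h.hμ h.hν (fun y _ => by simpa using h.pμ 0 y)
    (by simpa using continuousOn_const) (right_mem_Icc.2 hL.le)
  simp only [h.h0, h.h1, add_neg_cancel, MeasureTheory.integral_zero] at this
  linarith

lemma RSol.congr_vort {ω ω' : ℝ × ℝ → ℝ} {b0 b1 : ℝ → ℝ} {j : ℝ} {μ ν μx νx : ℝ × ℝ → ℝ}
    (h : RSol L ω b0 b1 j μ ν μx νx) (e : EqOn ω' ω (strip L)) : RSol L ω' b0 b1 j μ ν μx νx :=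
  { h with hμ := h.hμ.congr (fun _ _ => rfl) (fun _ _ => rfl) fun z hz => by simp only [e hz] }

/-- `q` and `r` differ by at most `D` in `C^{1,a}`. -/
def Close (L a D : ℝ) (q r : Flow) : Prop :=
  ∀ y ∈ Icc 0 L, H1 a D (fun x => q.m (x, y) - r.m (x, y)) (fun x => q.mx (x, y) - r.mx (x, y)) ∧
    H1 a D (fun x => q.n (x, y) - r.n (x, y)) (fun x => q.nx (x, y) - r.nx (x, y)) ∧
    Ho a D univ fun x => q.w (x, y) - r.w (x, y)

lemma Ho.mul_sub_mul {f g f' g' : ℝ → ℝ} {K : ℝ} (hf : Ho a K univ fun x => f x - g x)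
    (hf' : Ho a N univ f') (hg : Ho a N univ g) (hg' : Ho a K univ fun x => f' x - g' x) :
    Ho a (4 * N * K) univ fun x => f x * f' x - g x * g' x :=
  (((hf.mul hf').add (hg.mul hg')).congr (fun x _ => by ring)).mono (by linarith)

lemma Good.mmx_sub (ha : a ∈ Ioo (0 : ℝ) 1) (hq : Good L a N q) (hr : Good L a N r)
    (hD : Close L a D q r) {y : ℝ} (hy : y ∈ Icc 0 L) :
    Ho a (32 * N * D) univ fun x => q.m (x, y) * q.mx (x, y) - r.m (x, y) * r.mx (x, y) := by
  have hN := (hq.sm y hy).nonneg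
  obtain ⟨h1, -, -⟩ := hD y hy
  have h0 := h1.nonneg
  exact (Ho.mul_sub_mul (N := 4 * N) (h1.ho ha) (((hq.sm y hy).2.2.ho ha).mono (by linarith))
    ((((hr.sm y hy).h1 ha).ho ha).mono (by linarith)) (h1.2.2.mono (by linarith))).mono
      (by linarith)

lemma Good.nnx_sub (ha : a ∈ Ioo (0 : ℝ) 1) (hq : Good L a N q) (hr : Good L a N r)
    (hD : Close L a D q r) {y : ℝ} (hy : y ∈ Icc 0 L) :
    Ho a (32 * N * D) univ fun x => q.n (x, y) * q.nx (x, y) - r.n (x, y) * r.nx (x, y) := by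
  have hN := (hq.sm y hy).nonneg
  obtain ⟨-, h1, -⟩ := hD y hy
  have h0 := h1.nonneg
  exact (Ho.mul_sub_mul (N := 4 * N) (h1.ho ha) (((hq.sn y hy).2.2.ho ha).mono (by linarith))
    ((((hr.sn y hy).h1 ha).ho ha).mono (by linarith)) (h1.2.2.mono (by linarith))).mono
      (by linarith)

lemma Good.kap_comp_sub (ha : a ∈ Ioo (0 : ℝ) 1) (hL : 0 < L) (hd : d.Good a N) (hN : N ≤ 1 / 8)
    (hq : Good L a N q) (hr : Good L a N r) (hD : Close L a D q r) (hs : Lag L q.m q.n d.β s)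
    (hu : Lag L r.m r.n d.β u) {y : ℝ} (hy : y ∈ Icc 0 L) :
    Ho a ((2560 + 6963200 * (4 + 32 * L)) * (N * D)) univ
      fun x => kap d q (s (x, y)) - kap d r (u (x, y)) := by
  have m0 : (0 : ℝ) ∈ Icc 0 L := left_mem_Icc.2 hL.le
  have hN0 : 0 ≤ N := hd.hβ.nonneg
  have hD0 : 0 ≤ D := (hD 0 m0).1.nonneg
  have hb : ∀ x, |d.β x| ≤ 1 / 2 := fun x => (hd.hβ.2.1 x).trans (by linarith)
  have hbd : ∀ x, |d.β' x| ≤ 1 := fun x => (hd.hβ.2.2.2.1 x).trans (by linarith)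
  have ls := hs.lip hb (fun z hz => (hq.abs_n_le hz).trans (by linarith)) hy
  have lu := hu.lip hb (fun z hz => (hr.abs_n_le hz).trans (by linarith)) hy
  have dm : ∀ z ∈ strip L, |q.m z - r.m z| ≤ D := fun z hz => (hD z.2 hz.2).1.2.1 z.1
  have dn : ∀ z ∈ strip L, |q.n z - r.n z| ≤ D := fun z hz => (hD z.2 hz.2).2.1.2.1 z.1
  have hθ : Ho a ((4 + 32 * L) * D) univ fun x => s (x, y) - u (x, y) := by
    refine (Ho.of_lip ha (N := (2 + 16 * L) * D) (fun x _ => ?_) fun x _ x' _ => ?_).mono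
      (by linarith)
    · refine (hs.abs_sub_le hL hu (continuous_of_deriv hd.hβ.1) hb dm (mem_strip.2 hy)).trans ?_
      nlinarith [mul_nonneg hL.le hD0]
    · refine (lip_of_deriv (N := (2 + 16 * L) * D)
        (fun x => (hs.hs.slice_x hy).sub (hu.hs.slice_x hy)) (fun x => ?_) x x').trans ?_
      · exact hs.abs_deriv_sub_le hL hu hd.hβ.1 hbd hb dm dn
          (fun z hz => (hr.abs_n_le hz).trans (by linarith)) (mem_strip.2 hy)
      · rw [Real.norm_eq_abs]
        have : 0 ≤ (2 + 16 * L) * D := by positivity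
        nlinarith [mul_nonneg this (abs_nonneg (x - x'))]
  have g1 : Ho a 2 univ (fun t => 1 + d.β t) :=
    ((Ho.const (a := a) (S := univ) (1 : ℝ)).add ((hd.hβ.h1 ha).ho ha)).mono (by
      rw [norm_one]; linarith)
  have gi := g1.inv fun t _ => by have := (abs_le.1 (hb t)).1; linarith
  have p1 : Ho a (640 * (N * D)) univ fun t => kap d q t - kap d r t :=
    ((gi.mul (hq.mmx_sub ha hr hD m0)).congr (fun t _ => by simp only [kap]; ring)).mono
      (by linarith)
  have p2 := p1.comp_lip ha (T := univ) (s := fun x => s (x, y)) (K := 4) (mapsTo_univ _ _)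
    (by norm_num) fun x _ x' _ => ls x x'
  obtain ⟨κ', hκ⟩ := hr.kap_h1 ha hL hd le_rfl hN
  have p3 := Ho.comp_sub_comp ha (hκ.mono (K := 870400 * N) (by nlinarith))
    (by norm_num : (1 : ℝ) ≤ 4)
    ls lu hθ
  exact ((p2.add p3).congr (fun x _ => by ring)).mono (by linarith)

lemma Good.topN_sub (ha : a ∈ Ioo (0 : ℝ) 1) (hL : 0 < L) (hd : d.Good a N) (hN : N ≤ 1 / 8)
    (hq : Good L a N q) (hr : Good L a N r) (hD : Close L a D q r)
    (hu : Lag L r.m r.n d.β u) {E : ℝ} (hE : Ho a (E * (N * D)) univ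
      fun x => kap d q (s (x, L)) - kap d r (u (x, L))) :
    Ho a ((4 * E + 27852864) * (N * D)) univ fun x =>
      (kap d q (s (x, L)) * (1 + q.n (x, L))
      - (q.m (x, L) * q.mx (x, L) + q.n (x, L) * q.nx (x, L)) + d.T' x) -
      (kap d r (u (x, L)) * (1 + r.n (x, L))
      - (r.m (x, L) * r.mx (x, L) + r.n (x, L) * r.nx (x, L)) + d.T' x) := by
  have mL : L ∈ Icc 0 L := right_mem_Icc.2 hL.le
  have hN0 : 0 ≤ N := hd.hβ.nonneg
  have hb : ∀ x, |d.β x| ≤ 1 / 2 := fun x => (hd.hβ.2.1 x).trans (by linarith)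
  have lu := hu.lip hb (fun z hz => (hr.abs_n_le hz).trans (by linarith)) mL
  have n1 : Ho a 2 univ (fun x => 1 + q.n (x, L)) :=
    ((Ho.const (a := a) (S := univ) (1 : ℝ)).add (((hq.sn L mL).h1 ha).ho ha)).mono (by
      rw [norm_one]; linarith)
  obtain ⟨κ', hκ⟩ := hr.kap_h1 ha hL hd le_rfl hN
  have k1 := ((hκ.mono (K := 870400 * N) (by nlinarith)).ho ha).comp_lip ha (T := univ)
    (s := fun x => u (x, L)) (K := 4) (mapsTo_univ _ _) (by norm_num) fun x _ x' _ => lu x x'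
  exact ((((hE.mul n1).add (k1.mul ((hD L mL).2.1.ho ha))).sub ((hq.mmx_sub ha hr hD mL).add
    (hq.nnx_sub ha hr hD mL))).congr (fun x _ => by ring)).mono (by linarith)

lemma H1.zero (hN : 0 ≤ N) : H1 a N (fun _ => (0 : ℝ)) fun _ => 0 :=
  ⟨fun x => hasDerivAt_const x 0, fun x => by rwa [norm_zero],
    (Ho.const (0 : ℝ)).mono (by rwa [norm_zero])⟩

/-- The iteration is a contraction of small balls. -/
theorem exists_Close (ha : a ∈ Ioo (0 : ℝ) 1) (hL : 0 < L) : ∃ C ≥ 0, ∀ (N D : ℝ) (d : BD)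
    (q r q' r' : Flow), N ≤ 1 / 8 → d.Good a N → Good L a N q → Good L a N r → Close L a D q r →
    Step L d q q' → Step L d r r' → Close L a (C * (N * D)) q' r' := by
  obtain ⟨C, hC, H⟩ := exists_RSol ha hL
  set E1 := 2560 + 6963200 * (4 + 32 * L) with hE1
  set E2 := 4 * E1 + 27852864 with hE2
  have hE1p : 0 ≤ E1 := by positivity
  refine ⟨C * E2 + E1, by positivity, fun N D d q r q' r' hN hd hq hr hD hq' hr' => ?_⟩
  obtain ⟨s, c, hs, ws, Rs⟩ := hq'
  obtain ⟨u, e, hu, wu, Ru⟩ := hr'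
  have hND : 0 ≤ N * D := mul_nonneg hd.hβ.nonneg (hD 0 (left_mem_Icc.2 hL.le)).1.nonneg
  have mL : L ∈ Icc 0 L := right_mem_Icc.2 hL.le
  have R := (Rs.sub hL Ru).congr_vort (ω' := fun z => kap d q (s z) - kap d r (u z))
    fun z hz => by simp only [ws z hz, wu z hz]
  simp only [sub_self] at R
  have hω := fun y hy => hq.kap_comp_sub ha hL hd hN hr hD hs hu (y := y) hy
  have ht := hq.topN_sub ha hL hd hN hr hD hu (hω L mL)
  have dq := fun x => (hq.hasDerivAt_topN hL hd hN hs x).add_const c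
  have dr := fun x => (hr.hasDerivAt_topN hL hd hN hu x).add_const e
  have pq := hq.per_topN hd hs
  have pr := hr.per_topN hd hu
  have p1 : Per fun x => topN L d q s x + c - (topN L d r u x + e) := fun x => by
    simp only [pq x, pr x]
  have h1 : H1 a (E2 * (N * D)) (fun x => topN L d q s x + c - (topN L d r u x + e)) _ :=
    ⟨fun x => (dq x).sub (dr x), fun x => Per.abs_le_of_integral_eq_zero p1
      (fun x => (dq x).sub (dr x)) (fun x => ht.1 x trivial) (by rw [← R.mean hL]; simp) x, ht⟩
  have ck : ∀ (q : Flow) (s : ℝ × ℝ → ℝ), Good L a N q → Lag L q.m q.n d.β s →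
      ContinuousOn (fun z => kap d q (s z)) (strip L) := fun q s hq hs => by
    obtain ⟨κ', hκ⟩ := hq.kap_h1 ha hL hd le_rfl hN
    exact (continuous_of_deriv hκ.1).comp_continuousOn hs.hs.continuousOn
  obtain ⟨μ, ν, μx, νx, R', hμx, hνx, hμ, hν⟩ := H (E2 * (N * D))
    (fun z => kap d q (s z) - kap d r (u z)) (fun _ => 0) _ (fun _ => 0) _ 0
    ((ck q s hq hs).sub (ck r u hr hu)) (fun x y => by
      simp only [hs.sp x y, hu.sp x y, hq.per_kap hd _, hr.per_kap hd _])
    (fun y hy => (hω y hy).mono (by rw [hE2]; nlinarith)) (fun _ => rfl)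
    p1 (H1.zero (by positivity)) h1
    (by rw [p1.integral_half, ← R.mean hL]; simp) (by rw [abs_zero]; positivity)
  obtain ⟨e1, e2, e3, e4⟩ := R.unique hL R'
  have hle : C * (E2 * (N * D)) ≤ (C * E2 + E1) * (N * D) := by nlinarith
  intro y hy
  have hy' : ∀ x, (x, y) ∈ strip L := fun x => mem_strip.2 hy
  refine ⟨⟨fun x => R.hμ.slice_x hy, fun x => ?_, ?_⟩, ⟨fun x => R.hν.slice_x hy, fun x => ?_, ?_⟩,
    ((hω y hy).congr fun x _ => ?_).mono (by
      have : 0 ≤ C * E2 := by positivity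
      nlinarith)⟩
  · have := e1 (hy' x)
    dsimp only at this ⊢
    rw [this]
    exact (hμ _ (hy' x)).trans hle
  · exact ((hμx.slice hy).congr fun x _ => e3 (hy' x)).mono hle
  · have := e2 (hy' x)
    dsimp only at this ⊢
    rw [this]
    exact (hν _ (hy' x)).trans hle
  · exact ((hνx.slice hy).congr fun x _ => e4 (hy' x)).mono hle
  · rw [ws _ (hy' x), wu _ (hy' x)]

end Contraction

section FixedPoint

variable {L a N D : ℝ} {d : BD} {q r t : Flow} {δ : ℕ → ℝ}

lemma H1.lim {F F' : ℕ → ℝ → ℝ} {f f' : ℝ → ℝ} (h : ∀ n, H1 a N (F n) (F' n))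
    (hl : ∀ x, Filter.Tendsto (fun n => F n x) Filter.atTop (nhds (f x)))
    (hu : TendstoUniformly F' f' Filter.atTop) : H1 a N f f' :=
  ⟨hasDerivAt_of_tendstoUniformly hu (.of_forall fun n => (h n).1) hl,
    fun x => le_of_tendsto (hl x).norm (.of_forall fun n => (h n).2.1 x),
    Ho.lim (fun n => (h n).2.2) fun x _ => hu.tendsto_at x⟩

lemma TendstoUniformlyOn.slice {F : ℕ → ℝ × ℝ → ℝ} {f : ℝ × ℝ → ℝ}
    (h : TendstoUniformlyOn F f Filter.atTop (strip L)) {y : ℝ} (hy : y ∈ Icc 0 L) :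
    TendstoUniformly (fun n x => F n (x, y)) (fun x => f (x, y)) Filter.atTop := by
  rw [Metric.tendstoUniformly_iff]
  rw [Metric.tendstoUniformlyOn_iff] at h
  exact fun ε hε => (h ε hε).mono fun n hn x => hn _ (mem_strip.2 hy)

/-- If functions with bounded Hölder derivatives converge uniformly, so do the derivatives. -/
lemma exists_lim_deriv (ha : a ∈ Ioo (0 : ℝ) 1) (hN : 0 ≤ N) {F F' : ℕ → ℝ × ℝ → ℝ}
    (h : ∀ n, ∀ y ∈ Icc 0 L, H1 a N (fun x => F n (x, y)) fun x => F' n (x, y))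
    (hδ : ∀ n, 0 < δ n) (hδ0 : Filter.Tendsto δ Filter.atTop (nhds 0))
    (hF : ∀ n m, n ≤ m → ∀ z ∈ strip L, |F n z - F m z| ≤ δ n) :
    ∃ g, TendstoUniformlyOn F' g Filter.atTop (strip L) ∧ ∀ z, z ∉ strip L → g z = 0 := by
  have hs : Filter.Tendsto (fun n => √(δ n)) Filter.atTop (nhds 0) := by
    simpa using hδ0.sqrt
  have hp : ∀ n, 0 ≤ 2 * √(δ n) + 2 * N * √(δ n) ^ a := fun n => by positivity
  refine exists_tendstoUniformlyOn (δ := fun n => 2 * √(δ n) + 2 * N * √(δ n) ^ a)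
    (fun n m hnm z hz => le_add_of_le_of_nonneg ?_ (hp m)) ?_
  · have hd := (h n z.2 hz.2).sub (h m z.2 hz.2)
    have := deriv_small hd.1 (fun x y => hd.2.2.2 x trivial y trivial) (by linarith) ha.1
      (fun x => hF n m hnm (x, z.2) (mem_strip.2 hz.2)) z.1 (Real.sqrt_pos.2 (hδ n))
    refine this.trans (le_of_eq ?_)
    rw [mul_div_assoc, Real.div_sqrt]
    ring
  · have h2 : Filter.Tendsto (fun n => √(δ n) ^ a) Filter.atTop (nhds 0) := by
      simpa [Real.zero_rpow ha.1.ne'] using hs.rpow_const (.inr ha.1.le)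
    simpa using (hs.const_mul 2).add (h2.const_mul (2 * N))

lemma Good.mono {N' : ℝ} (h : Good L a N q) (hN : N ≤ N') : Good L a N' q :=
  { h with
    sm := fun y hy => (h.sm y hy).mono hN
    sn := fun y hy => (h.sn y hy).mono hN
    sw := fun y hy => (h.sw y hy).mono hN
    jm := h.jm.mono hN
    jn := h.jn.mono hN }

lemma Close.mono {D' : ℝ} (h : Close L a D q r) (hD : D ≤ D') : Close L a D' q r := fun y hy =>
  ⟨(h y hy).1.mono hD, (h y hy).2.1.mono hD, (h y hy).2.2.mono hD⟩

lemma H1.congr {f f' g g' : ℝ → ℝ} (h : H1 a N f f') (e : ∀ x, g x = f x) (e' : ∀ x, g' x = f' x) :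
    H1 a N g g' := by
  rwa [show g = f from funext e, show g' = f' from funext e']

lemma Close.refl (hD : 0 ≤ D) : Close L a D q q := fun y _ => by
  have := H1.zero (a := a) hD
  simpa using ⟨this, this.2.2⟩

lemma Close.trans {D' : ℝ} (h : Close L a D q r) (h' : Close L a D' r t) :
    Close L a (D + D') q t := fun y hy =>
  ⟨((h y hy).1.add (h' y hy).1).congr (fun x => by ring) fun x => by ring,
    ((h y hy).2.1.add (h' y hy).2.1).congr (fun x => by ring) fun x => by ring,
    ((h y hy).2.2.add (h' y hy).2.2).congr fun x _ => by ring⟩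

lemma Good.close (ha : a ∈ Ioo (0 : ℝ) 1) (hq : Good L a N q) (hr : Good L a N r) :
    Close L a (4 * N) q r := fun y hy =>
  ⟨(((hq.sm y hy).h1 ha).sub ((hr.sm y hy).h1 ha)).mono (by linarith),
    (((hq.sn y hy).h1 ha).sub ((hr.sn y hy).h1 ha)).mono (by linarith),
    (((hq.sw y hy).ho ha).sub ((hr.sw y hy).ho ha)).mono (by linarith)⟩

lemma exists_Good_lim (ha : a ∈ Ioo (0 : ℝ) 1) (hN : 0 ≤ N) {Q : ℕ → Flow}
    (hQ : ∀ n, Good L a N (Q n)) (hδ : ∀ n, 0 < δ n)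
    (hδ0 : Filter.Tendsto δ Filter.atTop (nhds 0))
    (hc : ∀ k m, k ≤ m → Close L a (δ k) (Q k) (Q m)) :
    ∃ q, Good L a N q ∧ ∀ n, Close L a (δ n) (Q n) q := by
  have ex : ∀ F : Flow → ℝ × ℝ → ℝ, (∀ n m, n ≤ m → ∀ z ∈ strip L, |F (Q n) z - F (Q m) z| ≤ δ n) →
      ∃ g, TendstoUniformlyOn (fun n => F (Q n)) g Filter.atTop (strip L) ∧
        ∀ z, z ∉ strip L → g z = 0 := fun F h =>
    exists_tendstoUniformlyOn (fun n m hnm z hz => le_add_of_le_of_nonneg (h n m hnm z hz)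
      (hδ m).le) hδ0
  have cm := fun n m hnm (z : ℝ × ℝ) (hz : z ∈ strip L) => (hc n m hnm z.2 hz.2).1.2.1 z.1
  have cn := fun n m hnm (z : ℝ × ℝ) (hz : z ∈ strip L) => (hc n m hnm z.2 hz.2).2.1.2.1 z.1
  have cmx := fun n m hnm (z : ℝ × ℝ) (hz : z ∈ strip L) =>
    (hc n m hnm z.2 hz.2).1.2.2.1 z.1 trivial
  have cnx := fun n m hnm (z : ℝ × ℝ) (hz : z ∈ strip L) =>
    (hc n m hnm z.2 hz.2).2.1.2.2.1 z.1 trivial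
  have cw := fun n m hnm (z : ℝ × ℝ) (hz : z ∈ strip L) => (hc n m hnm z.2 hz.2).2.2.1 z.1 trivial
  obtain ⟨m, um, m0⟩ := ex Flow.m cm
  obtain ⟨n, un, n0⟩ := ex Flow.n cn
  obtain ⟨mx, umx, mx0⟩ := ex Flow.mx cmx
  obtain ⟨nx, unx, nx0⟩ := ex Flow.nx cnx
  obtain ⟨w, uw, w0⟩ := ex Flow.w cw
  obtain ⟨mxx, umxx, mxx0⟩ := exists_lim_deriv ha hN (fun n y hy => ((hQ n).sm y hy).2.2) hδ hδ0 cmx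
  obtain ⟨nxx, unxx, nxx0⟩ := exists_lim_deriv ha hN (fun n y hy => ((hQ n).sn y hy).2.2) hδ hδ0 cnx
  obtain ⟨wx, uwx, wx0⟩ := exists_lim_deriv ha hN (fun n y hy => (hQ n).sw y hy) hδ hδ0 cw
  refine ⟨⟨m, n, mx, nx, mxx, nxx, w, wx⟩, ?_, fun k y hy => ?_⟩
  · have tm := fun z hz => um.tendsto_at (x := z) hz
    have tn := fun z hz => un.tendsto_at (x := z) hz
    have tmx := fun z hz => umx.tendsto_at (x := z) hz
    have tnx := fun z hz => unx.tendsto_at (x := z) hz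
    have tw := fun z hz => uw.tendsto_at (x := z) hz
    have twx := fun z hz => uwx.tendsto_at (x := z) hz
    exact {
      hm := G1.lim (fun n => (hQ n).hm) tm umx (unx.sub uw)
      hn := G1.lim (fun n => (hQ n).hn) tn unx umx.neg
      hmx := G1.lim (fun n => (hQ n).hmx) tmx umxx (unxx.sub uwx)
      hnx := G1.lim (fun n => (hQ n).hnx) tnx unxx umxx.neg
      pm := PerX.lim (fun n => (hQ n).pm) tm m0
      pn := PerX.lim (fun n => (hQ n).pn) tn n0
      pw := PerX.lim (fun n => (hQ n).pw) tw w0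
      pmx := PerX.lim (fun n => (hQ n).pmx) tmx mx0
      pnx := PerX.lim (fun n => (hQ n).pnx) tnx nx0
      pwx := PerX.lim (fun n => (hQ n).pwx) twx wx0
      sm := fun y hy => ⟨hasDerivAt_of_tendstoUniformly (TendstoUniformlyOn.slice umx hy)
          (.of_forall fun n => ((hQ n).sm y hy).1) fun x => tm _ (mem_strip.2 hy),
        fun x => le_of_tendsto (tm _ (mem_strip.2 hy)).norm
          (.of_forall fun n => ((hQ n).sm y hy).2.1 x),
        H1.lim (fun n => ((hQ n).sm y hy).2.2) (fun x => tmx _ (mem_strip.2 hy))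
          (TendstoUniformlyOn.slice umxx hy)⟩
      sn := fun y hy => ⟨hasDerivAt_of_tendstoUniformly (TendstoUniformlyOn.slice unx hy)
          (.of_forall fun n => ((hQ n).sn y hy).1) fun x => tn _ (mem_strip.2 hy),
        fun x => le_of_tendsto (tn _ (mem_strip.2 hy)).norm
          (.of_forall fun n => ((hQ n).sn y hy).2.1 x),
        H1.lim (fun n => ((hQ n).sn y hy).2.2) (fun x => tnx _ (mem_strip.2 hy))
          (TendstoUniformlyOn.slice unxx hy)⟩
      sw := fun y hy => H1.lim (fun n => (hQ n).sw y hy) (fun x => tw _ (mem_strip.2 hy))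
        (TendstoUniformlyOn.slice uwx hy)
      jm := Ho.lim (fun n => (hQ n).jm) fun z hz => umxx.tendsto_at hz
      jn := Ho.lim (fun n => (hQ n).jn) fun z hz => unxx.tendsto_at hz }
  · have hc' := fun i => hc k (k + i) (Nat.le_add_right _ _) y hy
    have sub : ∀ {F : ℕ → ℝ × ℝ → ℝ} {f : ℝ × ℝ → ℝ} (g : ℝ × ℝ → ℝ) (x : ℝ),
        TendstoUniformlyOn F f Filter.atTop (strip L) →
        Filter.Tendsto (fun i => g (x, y) - F (k + i) (x, y)) Filter.atTop
          (nhds (g (x, y) - f (x, y))) := fun g x h =>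
      ((h.tendsto_at (mem_strip.2 hy)).comp
        (Filter.tendsto_atTop_mono (Nat.le_add_left · k) Filter.tendsto_id)).const_sub _
    have ds := fun z => (G1.lim (fun n => (hQ n).hm) (fun z hz => um.tendsto_at hz) umx
      (unx.sub uw)).slice_x hy (x := z)
    have dn := fun z => (G1.lim (fun n => (hQ n).hn) (fun z hz => un.tendsto_at hz) unx
      umx.neg).slice_x hy (x := z)
    refine ⟨⟨fun x => ((hQ k).hm.slice_x hy).sub (ds x), fun x => ?_, ?_⟩,
      ⟨fun x => ((hQ k).hn.slice_x hy).sub (dn x), fun x => ?_, ?_⟩, ?_⟩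
    · exact le_of_tendsto (sub _ x um).norm (.of_forall fun i => (hc' i).1.2.1 x)
    · exact Ho.lim (fun i => (hc' i).1.2.2) fun x _ => sub _ x umx
    · exact le_of_tendsto (sub _ x un).norm (.of_forall fun i => (hc' i).2.1.2.1 x)
    · exact Ho.lim (fun i => (hc' i).2.1.2.2) fun x _ => sub _ x unx
    · exact Ho.lim (fun i => (hc' i).2.2) fun x _ => sub _ x uw

lemma Close.eqOn {Q : ℕ → Flow} (hδ0 : Filter.Tendsto δ Filter.atTop (nhds 0))
    (hq : ∀ n, Close L a (δ n) (Q n) q) (hr : ∀ n, Close L a (δ n) (Q n) r) :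
    (EqOn q.m r.m (strip L) ∧ EqOn q.n r.n (strip L)) ∧ EqOn q.mx r.mx (strip L) ∧
      EqOn q.nx r.nx (strip L) ∧ EqOn q.w r.w (strip L) := by
  have key : ∀ F : Flow → ℝ × ℝ → ℝ, (∀ D q r, Close L a D q r → ∀ z ∈ strip L,
      |F q z - F r z| ≤ D) →
      EqOn (F q) (F r) (strip L) := fun F h z hz => by
    have lim : ∀ {u : Flow}, (∀ n, Close L a (δ n) (Q n) u) →
        Filter.Tendsto (fun n => F (Q n) z) Filter.atTop (nhds (F u z)) := fun hu =>
      tendsto_iff_norm_sub_tendsto_zero.2 (squeeze_zero (fun _ => norm_nonneg _)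
        (fun n => h _ _ _ (hu n) z hz) hδ0)
    exact tendsto_nhds_unique (lim hq) (lim hr)
  exact ⟨⟨key _ fun D q r h z hz => (h z.2 hz.2).1.2.1 z.1,
    key _ fun D q r h z hz => (h z.2 hz.2).2.1.2.1 z.1⟩,
    key _ fun D q r h z hz => (h z.2 hz.2).1.2.2.1 z.1 trivial,
    key _ fun D q r h z hz => (h z.2 hz.2).2.1.2.2.1 z.1 trivial,
    key _ fun D q r h z hz => (h z.2 hz.2).2.2.1 z.1 trivial⟩

lemma RSol.congr (hL : 0 < L) {ω ω' : ℝ × ℝ → ℝ} {b0 b1 : ℝ → ℝ} {j : ℝ}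
    {μ ν μx νx : ℝ × ℝ → ℝ} (h : RSol L ω b0 b1 j μ ν μx νx) (hq : Good L a N q)
    (e : (EqOn q.m μ (strip L) ∧ EqOn q.n ν (strip L)) ∧ EqOn q.mx μx (strip L) ∧
      EqOn q.nx νx (strip L) ∧ EqOn ω' ω (strip L)) : RSol L ω' b0 b1 j q.m q.n q.mx q.nx where
  hμ := h.hμ.congr e.1.1 e.2.1 fun z hz => by simp only [e.2.2.1 hz, e.2.2.2 hz]
  hν := h.hν.congr e.1.2 e.2.2.1 fun z hz => by simp only [e.2.1 hz]
  pμ := hq.pm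
  pν := hq.pn
  pμx := hq.pmx
  pνx := hq.pnx
  h0 x := (e.1.2 (mem_strip.2 ⟨le_rfl, hL.le⟩)).trans (h.h0 x)
  h1 x := (e.1.2 (mem_strip.2 ⟨hL.le, le_rfl⟩)).trans (h.h1 x)
  hj := by
    rw [← h.hj]
    refine intervalIntegral.integral_congr fun y hy => ?_
    rw [uIcc_of_le hL.le] at hy
    exact e.1.1 (mem_strip.2 hy)

/-- The iteration has a unique fixed point among small flows. -/
theorem exists_fixedPoint (ha : a ∈ Ioo (0 : ℝ) 1) (hL : 0 < L) : ∃ N0 > 0, ∃ B ≥ 1, N0 ≤ 1 / 8 ∧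
    (∀ (δ : ℝ) (d : BD), B * δ ≤ N0 → d.Good a δ → ∃ q, Good L a (B * δ) q ∧ Step L d q q) ∧
    ∀ (d : BD) (q r : Flow), d.Good a N0 → Good L a N0 q → Good L a N0 r → Step L d q q →
      Step L d r r → EqOn q.m r.m (strip L) ∧ EqOn q.n r.n (strip L) := by
  obtain ⟨C1, hC1, S1⟩ := exists_Step ha hL
  obtain ⟨C2, hC2, S2⟩ := exists_Close ha hL
  obtain ⟨C3, hC3, S3⟩ := exists_Good ha hL
  set B := 1 + 2 * C1 + C3 with hB
  set N0 := min (1 / 8) (min (1 / (2 * (C2 + 1))) (1 / (2 * (C1 + 1) * B))) with hN0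
  have hBp : 1 ≤ B := by rw [hB]; linarith
  have hN1 : N0 ≤ 1 / 8 := min_le_left _ _
  have hN2 : C2 * N0 ≤ 1 / 2 := by
    have : N0 ≤ 1 / (2 * (C2 + 1)) := (min_le_right _ _).trans (min_le_left _ _)
    rw [le_div_iff₀ (by positivity)] at this
    have : 0 < N0 := by positivity
    nlinarith
  have hN3 : C1 * B * N0 ≤ 1 / 2 := by
    have : N0 ≤ 1 / (2 * (C1 + 1) * B) := (min_le_right _ _).trans (min_le_right _ _)
    rw [le_div_iff₀ (by positivity)] at this
    have : 0 < N0 := by positivity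
    nlinarith [mul_pos (by linarith : 0 < B) this]
  have hN0p : 0 < N0 := by positivity
  have contr : ∀ N D d q r q' r', N ≤ N0 → d.Good a N → Good L a N q → Good L a N r →
      Close L a D q r → Step L d q q' → Step L d r r' → Close L a (D / 2) q' r' := by
    intro N D d q r q' r' hN hd hq hr hD hq' hr'
    have hD0 := (hD 0 (left_mem_Icc.2 hL.le)).1.nonneg
    refine (S2 N D d q r q' r' (hN.trans hN1) hd hq hr hD hq' hr').mono ?_
    nlinarith [mul_le_mul_of_nonneg_left hN hC2]
  have hpow : Filter.Tendsto (fun n : ℕ => (1 / 2 : ℝ) ^ n) Filter.atTop (nhds 0) :=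
    tendsto_pow_atTop_nhds_zero_of_lt_one (by norm_num) (by norm_num)
  refine ⟨N0, hN0p, B, hBp, hN1, fun δ d hδ hd => ?_, fun d q r hd hq hr fq fr => ?_⟩
  · set N := B * δ with hN
    have hδ0 : 0 ≤ δ := hd.hβ.nonneg
    have hδN : δ ≤ N := by nlinarith
    have hNp : 0 ≤ N := hδ0.trans hδN
    have hdN := hd.mono hδN
    have hCN : C1 * (δ + N ^ 2) ≤ N := by
      have h1 : C1 * N ^ 2 ≤ δ / 2 := by
        have : C1 * N ^ 2 = C1 * B * N * δ := by rw [hN]; ring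
        rw [this]
        have : C1 * B * N ≤ C1 * B * N0 := by gcongr
        nlinarith
      rw [hB] at hN
      nlinarith [mul_nonneg hC3 hδ0]
    have hz : G1 L (fun _ => (0 : ℝ)) (fun _ => 0) fun _ => 0 := G1.const 0
    obtain ⟨q0, -, -, g0, r0⟩ := S3 δ (fun _ => 0) _ _ d.β d.β _ _ _ _ d.j hz (fun _ _ => rfl)
      continuousOn_const (fun _ _ => rfl) (fun _ _ => H1.zero hδ0) hd.pβ hd.pβ hd.hβ hd.hβ rfl hd.hj
    have next : ∀ q : {q // Good L a N q ∧ ∀ x, q.n (x, 0) = d.β x},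
        ∃ q' : {q // Good L a N q ∧ ∀ x, q.n (x, 0) = d.β x}, Step L d q.1 q'.1 := fun q => by
      obtain ⟨q', gq, st⟩ := S1 N δ d q.1 hδN (hδ.trans hN1) hd q.2.1 q.2.2
      have ⟨_, _, _, _, R⟩ := st
      exact ⟨⟨q', gq.mono hCN, R.h0⟩, st⟩
    choose T hT using next
    let Q : ℕ → {q // Good L a N q ∧ ∀ x, q.n (x, 0) = d.β x} := fun n =>
      T^[n] ⟨q0, g0.mono (by rw [hN, hB]; nlinarith), r0.h0⟩
    have hQ : ∀ n, Step L d (Q n).1 (Q (n + 1)).1 := fun n => by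
      simp only [Q, Function.iterate_succ_apply']
      exact hT _
    have gQ : ∀ n, Good L a N (Q n).1 := fun n => (Q n).2.1
    have h1 : ∀ n, Close L a (4 * N * (1 / 2) ^ n) (Q n).1 (Q (n + 1)).1 := fun n => by
      induction n with
      | zero => exact ((gQ 0).close ha (gQ 1)).mono (by norm_num)
      | succ n ih =>
        exact (contr _ _ _ _ _ _ _ hδ hdN (gQ n) (gQ (n + 1)) ih (hQ n) (hQ (n + 1))).mono
          (by rw [pow_succ]; linarith)
    have h2 : ∀ n i, Close L a (8 * N * (1 / 2) ^ n - 8 * N * (1 / 2) ^ (n + i)) (Q n).1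
        (Q (n + i)).1 := fun n i => by
      induction i with
      | zero =>
        simpa using Close.refl le_rfl
      | succ i ih =>
        exact (ih.trans (h1 (n + i))).mono (by rw [← add_assoc, pow_succ]; linarith)
    obtain ⟨q, gq, cq⟩ := exists_Good_lim (δ := fun n => (8 * N + 1) * (1 / 2) ^ n) ha hNp gQ
      (fun n => by positivity) (by simpa using hpow.const_mul (8 * N + 1)) fun k m hkm => by
        obtain ⟨i, rfl⟩ := Nat.exists_eq_add_of_le hkm
        refine (h2 k i).mono ?_
        have : 0 ≤ 8 * N * (1 / 2 : ℝ) ^ (k + i) := by positivity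
        have : 0 ≤ (1 / 2 : ℝ) ^ k := by positivity
        nlinarith
    have q00 : ∀ x, q.n (x, 0) = d.β x := fun x => by
      have : ∀ n, |d.β x - q.n (x, 0)| ≤ (8 * N + 1) * (1 / 2) ^ n := fun n => by
        rw [← (Q n).2.2]
        exact (cq n 0 (left_mem_Icc.2 hL.le)).2.1.2.1 x
      have := ge_of_tendsto' (hpow.const_mul (8 * N + 1)) this
      rw [mul_zero, abs_nonpos_iff] at this
      linarith
    obtain ⟨q', gq', st⟩ := S1 N δ d q hδN (hδ.trans hN1) hd gq q00
    have cq' : ∀ n, Close L a ((8 * N + 1) * (1 / 2) ^ (n + 1)) (Q (n + 1)).1 q' := fun n =>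
      (contr _ _ _ _ _ _ _ hδ hdN (gQ n) gq (cq n) (hQ n) st).mono (by rw [pow_succ]; linarith)
    have e := Close.eqOn (Q := fun n => (Q (n + 1)).1)
      (δ := fun n => (8 * N + 1) * (1 / 2) ^ (n + 1))
      (by simpa using (hpow.comp (Filter.tendsto_add_atTop_nat 1)).const_mul (8 * N + 1))
      (fun n => cq (n + 1)) cq'
    obtain ⟨s, c, hs, ws, R⟩ := st
    exact ⟨q, gq, s, c, hs, fun z hz => (e.2.2.2 hz).trans (ws z hz), R.congr hL gq e⟩
  · have h1 : ∀ n : ℕ, Close L a (4 * N0 * (1 / 2) ^ n) q r := fun n => by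
      induction n with
      | zero => exact (hq.close ha hr).mono (by norm_num)
      | succ n ih =>
        exact (contr _ _ _ _ _ _ _ le_rfl hd hq hr ih fq fr).mono (by rw [pow_succ]; linarith)
    have h2 : ∀ n : ℕ, Close L a (4 * N0 * (1 / 2) ^ n) q q := fun n => .refl (by positivity)
    exact (Close.eqOn (Q := fun _ => q) (by simpa using hpow.const_mul (4 * N0)) h2 h1).1

end FixedPoint

section Norms

variable {X E : Type*} [NormedAddCommGroup X] [NormedSpace ℝ X] [NormedAddCommGroup E]
  [NormedSpace ℝ E] {L a N : ℝ}

lemma Ho.of_hNorm_le {k : ℕ} (ha : 0 < a) (hN : 0 ≤ N) {s : Set X} {f : X → E}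
    (h : hNorm k a s f ≤ ENNReal.ofReal N) :
    (∀ i ≤ k, ∀ x ∈ s, ‖iteratedFDerivWithin ℝ i f s x‖ ≤ N) ∧
      Ho a N s (iteratedFDerivWithin ℝ k f s) := by
  have h1 : ∀ i ≤ k, ∀ x ∈ s, ‖iteratedFDerivWithin ℝ i f s x‖ ≤ N := fun i hi x hx => by
    have e : (‖iteratedFDerivWithin ℝ i f s x‖₊ : ℝ≥0∞) ≤ ENNReal.ofReal N :=
      (le_iSup₂ (f := fun x (_ : x ∈ s) => (‖iteratedFDerivWithin ℝ i f s x‖₊ : ℝ≥0∞)) x hx).trans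
        ((Finset.single_le_sum
          (f := fun i => ⨆ x ∈ s, (‖iteratedFDerivWithin ℝ i f s x‖₊ : ℝ≥0∞))
          (fun _ _ => zero_le) (Finset.mem_range.2 (by omega))).trans
          (le_self_add.trans h))
    rw [← enorm_eq_nnnorm, ← ofReal_norm] at e
    exact (ENNReal.ofReal_le_ofReal_iff hN).1 e
  refine ⟨h1, h1 k le_rfl, fun x hx y hy => ?_⟩
  have e : ENNReal.ofReal (‖iteratedFDerivWithin ℝ k f s x - iteratedFDerivWithin ℝ k f s y‖
      / ‖x - y‖ ^ a) ≤ ENNReal.ofReal N :=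
    (le_iSup₂ (f := fun y (_ : y ∈ s) => ENNReal.ofReal
      (‖iteratedFDerivWithin ℝ k f s x - iteratedFDerivWithin ℝ k f s y‖ / ‖x - y‖ ^ a)) y hy).trans
    ((le_iSup₂ (f := fun x (_ : x ∈ s) => ⨆ y ∈ s, ENNReal.ofReal
      (‖iteratedFDerivWithin ℝ k f s x - iteratedFDerivWithin ℝ k f s y‖ / ‖x - y‖ ^ a)) x hx).trans
      (le_add_self.trans h))
  rcases eq_or_ne x y with rfl | hxy
  · simp [Real.zero_rpow ha.ne']
  · have : 0 < ‖x - y‖ ^ a := Real.rpow_pos_of_pos (norm_pos_iff.2 (sub_ne_zero.2 hxy)) _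
    exact (div_le_iff₀ this).1 ((ENNReal.ofReal_le_ofReal_iff hN).1 e)

lemma hNorm_le {k : ℕ} (hN : 0 ≤ N) {s : Set X} {f : X → E}
    (h1 : ∀ i ≤ k, ∀ x ∈ s, ‖iteratedFDerivWithin ℝ i f s x‖ ≤ N)
    (h2 : Ho a N s (iteratedFDerivWithin ℝ k f s)) :
    hNorm k a s f ≤ ENNReal.ofReal ((k + 2) * N) := by
  have e1 : (Finset.range (k + 1)).sum
      (fun i => ⨆ x ∈ s, (‖iteratedFDerivWithin ℝ i f s x‖₊ : ℝ≥0∞))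
      ≤ ENNReal.ofReal ((k + 1) * N) := by
    refine (Finset.sum_le_card_nsmul _ _ (ENNReal.ofReal N)
      fun i hi => iSup₂_le fun x hx => ?_).trans
      (le_of_eq ?_)
    · rw [← enorm_eq_nnnorm, ← ofReal_norm]
      exact ENNReal.ofReal_le_ofReal (h1 i (by have := Finset.mem_range.1 hi; omega) x hx)
    · rw [Finset.card_range, nsmul_eq_mul, ENNReal.ofReal_mul (by positivity)]
      congr 1
      rw [← ENNReal.ofReal_natCast]
      push_cast; rfl
  have e2 : hSemi a s (iteratedFDerivWithin ℝ k f s) ≤ ENNReal.ofReal N :=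
    iSup₂_le fun x hx => iSup₂_le fun y hy => ENNReal.ofReal_le_ofReal
      (div_le_of_le_mul₀ (by positivity) hN (h2.2 x hx y hy))
  calc hNorm k a s f ≤ _ := add_le_add e1 e2
    _ = _ := by rw [← ENNReal.ofReal_add (by positivity) hN]; congr 1; ring

lemma H2.of_hNorm_le (ha : 0 < a) (hN : 0 ≤ N) {f : ℝ → ℝ} (hf : ContDiffOn ℝ 2 f univ)
    (h : hNorm 2 a univ f ≤ ENNReal.ofReal N) : H2 a N f (deriv f) (deriv (deriv f)) := by
  rw [contDiffOn_univ] at hf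
  obtain ⟨h1, h2⟩ := Ho.of_hNorm_le ha hN h
  simp only [iteratedFDerivWithin_univ] at h1 h2
  have hf' : ContDiff ℝ 1 (deriv f) := ((contDiff_succ_iff_deriv (n := 1)).1 hf).2.2
  refine ⟨fun x => (hf.differentiable (by norm_num) x).hasDerivAt, fun x => ?_,
    fun x => (hf'.differentiable (by norm_num) x).hasDerivAt, fun x => ?_, fun x _ => ?_,
    fun x _ y _ => ?_⟩
  · simpa using h1 0 (by norm_num) x (mem_univ _)
  · have := h1 1 (by norm_num) x (mem_univ _)
    rwa [norm_iteratedFDeriv_eq_norm_iteratedDeriv, iteratedDeriv_one] at this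
  · have := h1 2 (by norm_num) x (mem_univ _)
    rwa [norm_iteratedFDeriv_eq_norm_iteratedDeriv, iteratedDeriv_succ, iteratedDeriv_one] at this
  · have e : ∀ x, deriv (deriv f) x = iteratedFDeriv ℝ 2 f x (fun _ => 1) := fun x => by
      rw [← iteratedDeriv_eq_iteratedFDeriv, iteratedDeriv_succ, iteratedDeriv_one]
    rw [e, e, ← sub_apply]
    refine (ContinuousMultilinearMap.le_opNorm _ _).trans ?_
    simpa using h2.2 x (mem_univ _) y (mem_univ _)

/-- `f` is of class `C^{1,a}` on the closed strip, with partial derivatives `fx`, `fy`. -/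
structure C1a (L a N : ℝ) (f fx fy : ℝ × ℝ → E) : Prop where
  g : G1 L f fx fy
  b : ∀ z ∈ strip L, ‖f z‖ ≤ N
  hx : Ho a N (strip L) fx
  hy : Ho a N (strip L) fy

/-- `f` is of class `C^{2,a}` on the closed strip, with the given partial derivatives. -/
structure C2a (L a N : ℝ) (f fx fy fxx fxy fyy : ℝ × ℝ → E) : Prop where
  g : G1 L f fx fy
  b : ∀ z ∈ strip L, ‖f z‖ ≤ N
  cx : C1a L a N fx fxx fxy
  cy : C1a L a N fy fxy fyy

lemma lin_self (T : ℝ × ℝ →L[ℝ] E) : lin (T (1, 0)) (T (0, 1)) = T := by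
  ext <;> simp

lemma G1.of_differentiableOn {f : ℝ × ℝ → E} (hf : DifferentiableOn ℝ f (strip L)) :
    G1 L f (fun z => fderivWithin ℝ f (strip L) z (1, 0))
      (fun z => fderivWithin ℝ f (strip L) z (0, 1)) := fun z hz => by
  rw [lin_self]; exact (hf z hz).hasFDerivWithinAt

lemma G1.fderivWithin_eq (hL : 0 < L) {f fx fy : ℝ × ℝ → E} (h : G1 L f fx fy) {z : ℝ × ℝ}
    (hz : z ∈ strip L) : fderivWithin ℝ f (strip L) z = lin (fx z) (fy z) :=
  (h z hz).fderivWithin (uniqueDiffOn_strip hL z hz)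

lemma G1.pdx_eq (hL : 0 < L) {f fx fy : ℝ × ℝ → ℝ} (h : G1 L f fx fy) {z : ℝ × ℝ}
    (hz : z ∈ strip L) : pdx L f z = fx z := by
  simp [pdx, h.fderivWithin_eq hL hz]

lemma G1.pdy_eq (hL : 0 < L) {f fx fy : ℝ × ℝ → ℝ} (h : G1 L f fx fy) {z : ℝ × ℝ}
    (hz : z ∈ strip L) : pdy L f z = fy z := by
  simp [pdy, h.fderivWithin_eq hL hz]

lemma closure_interior_strip (hL : 0 < L) : closure (interior (strip L)) = strip L := by
  rw [strip, interior_prod_eq, closure_prod_eq, interior_univ, closure_univ, interior_Icc,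
    closure_Ioo hL.ne]

lemma C2a.of_hNorm_le (hL : 0 < L) (ha : 0 < a) (hN : 0 ≤ N) {f : ℝ × ℝ → E}
    (hf : ContDiffOn ℝ 2 f (strip L)) (h : hNorm 2 a (strip L) f ≤ ENNReal.ofReal N) :
    ∃ fx fy fxx fxy fyy, C2a L a N f fx fy fxx fxy fyy := by
  have hs := uniqueDiffOn_strip hL
  obtain ⟨h1, h2⟩ := Ho.of_hNorm_le ha hN h
  set D := fderivWithin ℝ f (strip L) with hD
  set D2 := fderivWithin ℝ D (strip L) with hD2
  have hDd : DifferentiableOn ℝ D (strip L) :=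
    ((contDiffOn_succ_iff_fderivWithin (n := 1) hs).1 hf).2.2.differentiableOn (by norm_num)
  have g2 := G1.of_differentiableOn hDd
  have e2 : ∀ z ∈ strip L, ∀ u v : ℝ × ℝ,
      D2 z u v = iteratedFDerivWithin ℝ 2 f (strip L) z ![u, v] :=
    fun z hz u v => by rw [iteratedFDerivWithin_two_apply f hs hz]; simp [hD2, hD]
  have b1 : ∀ z ∈ strip L, ∀ u : ℝ × ℝ, ‖u‖ = 1 → ‖D z u‖ ≤ N := fun z hz u hu => by
    have := h1 1 (by norm_num) z hz
    rw [norm_iteratedFDerivWithin_one f (hs z hz)] at this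
    refine (ContinuousLinearMap.le_opNorm _ _).trans ?_
    rwa [hu, mul_one]
  have b2 : ∀ u v : ℝ × ℝ, ‖u‖ = 1 → ‖v‖ = 1 → Ho a N (strip L) fun z => D2 z u v :=
    fun u v hu hv => ⟨fun z hz => by
      simp only [e2 z hz]
      refine (ContinuousMultilinearMap.le_opNorm _ _).trans ?_
      simpa [Fin.prod_univ_two, hu, hv] using h2.1 z hz, fun z hz w hw => by
      simp only [e2 z hz, e2 w hw]
      rw [← sub_apply]
      refine (ContinuousMultilinearMap.le_opNorm _ _).trans ?_
      simpa [Fin.prod_univ_two, hu, hv] using h2.2 z hz w hw⟩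
  have sym : ∀ z ∈ strip L, D2 z (0, 1) (1, 0) = D2 z (1, 0) (0, 1) := fun z hz =>
    ((hf z hz).isSymmSndFDerivWithinAt (by simp) hs (by rwa [closure_interior_strip hL])
      hz).eq _ _
  have n1 : ‖((1 : ℝ), (0 : ℝ))‖ = 1 := by simp [Prod.norm_def]
  have n2 : ‖((0 : ℝ), (1 : ℝ))‖ = 1 := by simp [Prod.norm_def]
  refine ⟨fun z => D z (1, 0), fun z => D z (0, 1), fun z => D2 z (1, 0) (1, 0),
    fun z => D2 z (0, 1) (1, 0), fun z => D2 z (0, 1) (0, 1),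
    G1.of_differentiableOn (hf.differentiableOn (by norm_num)), fun z hz => ?_,
    ⟨g2.clm (ContinuousLinearMap.apply ℝ E ((1 : ℝ), (0 : ℝ))), fun z hz => b1 z hz _ n1,
      b2 _ _ n1 n1, b2 _ _ n2 n1⟩,
    ⟨(g2.clm (ContinuousLinearMap.apply ℝ E ((0 : ℝ), (1 : ℝ)))).congr (fun _ _ => rfl) sym
      (fun _ _ => rfl), fun z hz => b1 z hz _ n2, b2 _ _ n2 n1, b2 _ _ n2 n2⟩⟩
  simpa using h1 0 (by norm_num) z hz

lemma C2a.nonneg (hL : 0 ≤ L) {f fx fy fxx fxy fyy : ℝ × ℝ → E}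
    (h : C2a L a N f fx fy fxx fxy fyy) : 0 ≤ N :=
  (norm_nonneg _).trans (h.b (0, 0) (mem_strip.2 ⟨le_rfl, hL⟩))

lemma Ho.lin {S : Set (ℝ × ℝ)} {f g : ℝ × ℝ → E} (hf : Ho a N S f) (hg : Ho a N S g) :
    Ho a (2 * N) S fun z => EulerBVP.lin (f z) (g z) :=
  ⟨fun z hz => (norm_lin_le _ _).trans (by linarith [hf.1 z hz, hg.1 z hz]),
    fun z hz w hw => by
      rw [← lin_sub]
      exact (norm_lin_le _ _).trans (by linarith [hf.2 z hz w hw, hg.2 z hz w hw])⟩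

lemma G1.contDiffOn_one (hL : 0 < L) {f fx fy : ℝ × ℝ → E} (h : G1 L f fx fy)
    (hx : ContinuousOn fx (strip L)) (hy : ContinuousOn fy (strip L)) :
    ContDiffOn ℝ 1 f (strip L) := by
  rw [show (1 : WithTop ℕ∞) = 0 + 1 by norm_num,
    contDiffOn_succ_iff_fderivWithin (uniqueDiffOn_strip hL)]
  refine ⟨fun z hz => (h z hz).differentiableWithinAt, fun h => by simp at h, ?_⟩
  rw [contDiffOn_zero]
  refine ContinuousOn.congr (f := fun z => EulerBVP.lin (fx z) (fy z)) ?_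
    fun z hz => h.fderivWithin_eq hL hz
  exact ((ContinuousLinearMap.smulRightL ℝ (ℝ × ℝ) E
    (ContinuousLinearMap.fst ℝ ℝ ℝ)).continuous.comp_continuousOn hx).add
    ((ContinuousLinearMap.smulRightL ℝ (ℝ × ℝ) E
      (ContinuousLinearMap.snd ℝ ℝ ℝ)).continuous.comp_continuousOn hy)

lemma G1.lin {f fx fy g gx gy : ℝ × ℝ → E} (hf : G1 L f fx fy) (hg : G1 L g gx gy) :
    G1 L (fun z => EulerBVP.lin (f z) (g z)) (fun z => EulerBVP.lin (fx z) (gx z))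
      (fun z => EulerBVP.lin (fy z) (gy z)) := by
  have := (hf.clm (ContinuousLinearMap.smulRightL ℝ (ℝ × ℝ) E (ContinuousLinearMap.fst ℝ ℝ ℝ))).add
    (hg.clm (ContinuousLinearMap.smulRightL ℝ (ℝ × ℝ) E (ContinuousLinearMap.snd ℝ ℝ ℝ)))
  exact this

lemma C2a.contDiffOn (hL : 0 < L) (ha : 0 < a) {f fx fy fxx fxy fyy : ℝ × ℝ → E}
    (h : C2a L a N f fx fy fxx fxy fyy) : ContDiffOn ℝ 2 f (strip L) := by
  rw [show (2 : WithTop ℕ∞) = 1 + 1 by norm_num,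
    contDiffOn_succ_iff_fderivWithin (uniqueDiffOn_strip hL)]
  refine ⟨fun z hz => (h.g z hz).differentiableWithinAt, fun h => by simp at h, ?_⟩
  have hc : ∀ {k : ℝ × ℝ → E}, Ho a N (strip L) k → ContinuousOn k (strip L) := fun hk =>
    hk.continuousOn ha
  refine ContDiffOn.congr (f := fun z => lin (fx z) (fy z)) ?_
    fun z hz => h.g.fderivWithin_eq hL hz
  have h1 := h.cx.g.contDiffOn_one hL (hc h.cx.hx) (hc h.cx.hy)
  have h2 := h.cy.g.contDiffOn_one hL (hc h.cy.hx) (hc h.cy.hy)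
  unfold lin
  exact (contDiffOn_const.smulRight h1).add (contDiffOn_const.smulRight h2)

lemma C2a.hNorm_le (hL : 0 < L) {f fx fy fxx fxy fyy : ℝ × ℝ → E}
    (h : C2a L a N f fx fy fxx fxy fyy) : hNorm 2 a (strip L) f ≤ ENNReal.ofReal (16 * N) := by
  have hs := uniqueDiffOn_strip hL
  have hN := h.nonneg hL.le
  have e2 : ∀ z ∈ strip L, ∀ m : Fin 2 → ℝ × ℝ, iteratedFDerivWithin ℝ 2 f (strip L) z m
      = lin (lin (fxx z) (fxy z)) (lin (fxy z) (fyy z)) (m 0) (m 1) := fun z hz m => by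
    rw [iteratedFDerivWithin_two_apply f hs hz, fderivWithin_congr
      (fun w hw => h.g.fderivWithin_eq hL hw) (h.g.fderivWithin_eq hL hz),
      (h.cx.g.lin h.cy.g).fderivWithin_eq hL hz]
  have hH : Ho a (2 * (2 * N)) (strip L) fun z => lin (lin (fxx z) (fxy z)) (lin (fxy z) (fyy z)) :=
    (h.cx.hx.lin h.cx.hy).lin (h.cy.hx.lin h.cy.hy)
  have hH2 : Ho a (4 * N) (strip L) (iteratedFDerivWithin ℝ 2 f (strip L)) := by
    refine ⟨fun z hz => ContinuousMultilinearMap.opNorm_le_bound (by positivity) fun m => ?_,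
      fun z hz w hw => ContinuousMultilinearMap.opNorm_le_bound (by positivity) fun m => ?_⟩
    · rw [e2 z hz, Fin.prod_univ_two, ← mul_assoc]
      refine (ContinuousLinearMap.le_opNorm₂ _ _ _).trans ?_
      gcongr
      linarith [hH.1 z hz]
    · rw [sub_apply, e2 z hz, e2 w hw, Fin.prod_univ_two, ← mul_assoc,
        ← sub_apply, ← sub_apply]
      refine (ContinuousLinearMap.le_opNorm₂ _ _ _).trans ?_
      gcongr
      refine (hH.2 z hz w hw).trans (le_of_eq (by ring))
  refine (EulerBVP.hNorm_le (N := 4 * N) (by positivity) (fun i hi z hz => ?_) hH2).trans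
    (le_of_eq (congrArg _ (by push_cast; ring)))
  interval_cases i
  · rw [norm_iteratedFDerivWithin_zero]; linarith [h.b z hz]
  · rw [norm_iteratedFDerivWithin_one f (hs z hz), h.g.fderivWithin_eq hL hz]
    exact (norm_lin_le _ _).trans (by linarith [h.cx.b z hz, h.cy.b z hz])
  · exact hH2.1 z hz

end Norms

section Normalized

variable {L a N : ℝ} {m n mx my nx ny mxx mxy myy nxx nxy nyy π : ℝ × ℝ → ℝ} {d : BD}

/-- The steady Euler equations for the velocity `(m, 1 + n)` and the pressure `π`, with boundary
data `d`. -/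
structure NSol (L C : ℝ) (d : BD) (m n mx my nx π : ℝ × ℝ → ℝ) : Prop where
  hm : G1 L m mx my
  hn : G1 L n nx (fun z => - mx z)
  hπ : G1 L π (fun z => -(m z * mx z + (1 + n z) * my z))
    (fun z => -(m z * nx z + (1 + n z) * -mx z))
  pm : PerX m
  pn : PerX n
  pπ : ∀ x, ∀ y ∈ Icc 0 L, π (x + 1, y) = π (x, y)
  h0 : ∀ x, n (x, 0) = d.β x
  hA : ∀ x, π (x, 0) = C + d.A x - d.β x
  hT : ∃ c, ∀ x, π (x, L) = c - d.T x
  hj : ∫ y in (0 : ℝ)..L, m (0, y) = d.j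

lemma G1.per_partials (hL : 0 < L) {f fx fy : ℝ × ℝ → ℝ} (h : G1 L f fx fy)
    (hp : ∀ x, ∀ y ∈ Icc 0 L, f (x + 1, y) = f (x, y)) :
    (∀ x, ∀ y ∈ Icc 0 L, fx (x + 1, y) = fx (x, y)) ∧
      ∀ x, ∀ y ∈ Icc 0 L, fy (x + 1, y) = fy (x, y) := by
  have := G1.unique hL ((h.translate 1).congr (fun z hz => (hp z.1 z.2 hz.2).symm)
    (fun _ _ => rfl) (fun _ _ => rfl)) h
  exact ⟨fun x y hy => this.1 (mem_strip.2 hy), fun x y hy => this.2 (mem_strip.2 hy)⟩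

/-- The Bernoulli function and its gradient. -/
lemma NSol.bernoulli {C : ℝ} (h : NSol L C d m n mx my nx π) :
    G1 L (fun z => π z + (m z * m z + (1 + n z) * (1 + n z)) / 2)
      (fun z => (nx z - my z) * (1 + n z)) (fun z => -((nx z - my z) * m z)) := by
  have g := ((G1.const 1).add h.hn)
  exact (h.hπ.add (((h.hm.mul h.hm).add (g.mul g)).const_smul (1 / 2))).congr
    (fun z _ => by simp only [smul_eq_mul]; ring) (fun z _ => by simp only [smul_eq_mul]; ring)
    (fun z _ => by simp only [smul_eq_mul]; ring)

/-- A quantity whose gradient is orthogonal to the velocity vanishes if it does at the bottom. -/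
lemma eq_zero_of_transport {D G : ℝ × ℝ → ℝ} (hm : G1 L m mx my)
    (hn : G1 L n nx (fun z => - mx z)) (pm : PerX m) (hb : ∀ z ∈ strip L, 0 < 1 + n z)
    (hG : G1 L G (fun z => D z * (1 + n z)) (fun z => - (D z * m z)))
    (pG : ∀ x, ∀ y ∈ Icc 0 L, G (x + 1, y) = G (x, y)) (G0 : ∀ x, G (x, 0) = 0)
    {z : ℝ × ℝ} (hz : z ∈ strip L) : G z = 0 := by
  have g := ((G1.const (L := L) (1 : ℝ)).add hn)
  have hzy : z.2 ∈ Icc 0 L := hz.2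
  have g1 := (hG.mul hG).mul hm
  have g2 := (hG.mul hG).mul g
  have hdiv : ∀ z ∈ strip L, ((D z * (1 + n z) * G z + G z * (D z * (1 + n z))) * m z
      + G z * G z * mx z) + ((-(D z * m z) * G z + G z * -(D z * m z)) * (1 + n z)
      + G z * G z * (0 + - mx z)) = 0 := fun z _ => by ring
  have key := integral_div_eq g1 g2 (fun y hy => by
      have e1 := pG 0 y hy
      have e2 := pm 0 y
      rw [zero_add] at e1 e2
      rw [e1, e2]) ((continuousOn_const (c := (0 : ℝ))).congr hdiv) hzy
  rw [MeasureTheory.setIntegral_eq_zero_of_forall_eq_zero (fun w hw =>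
    hdiv w ⟨trivial, hw.1.2, hw.2.2.trans hzy.2⟩)] at key
  simp only [G0, mul_zero, zero_mul, intervalIntegral.integral_zero, sub_zero] at key
  have hfr : G z = G (Int.fract z.1, z.2) := by
    have := (PerX.clampY (hzy.1.trans hzy.2) pG).fract z.1 z.2
    rwa [clampY_eqOn G (mem_strip.2 hzy), clampY_eqOn G (mem_strip.2 hzy)] at this
  rw [hfr]
  by_contra hne
  refine (ne_of_gt (intervalIntegral.integral_pos zero_lt_one
    (continuous_of_deriv fun x => g2.slice_x (x := x) hzy).continuousOn (fun x _ =>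
      mul_nonneg (mul_self_nonneg _) (hb _ (mem_strip.2 hzy)).le) ⟨Int.fract z.1,
      ⟨Int.fract_nonneg _, (Int.fract_lt_one _).le⟩,
      mul_pos (mul_self_pos.2 hne) (hb _ (mem_strip.2 hzy))⟩)) key.symm

lemma H2.of_C2a {f fx fy fxx fxy fyy : ℝ × ℝ → ℝ} (h : C2a L a N f fx fy fxx fxy fyy) {y : ℝ}
    (hy : y ∈ Icc 0 L) :
    H2 a N (fun x => f (x, y)) (fun x => fx (x, y)) fun x => fxx (x, y) :=
  ⟨fun _ => h.g.slice_x hy, fun _ => h.b _ (mem_strip.2 hy), fun _ => h.cx.g.slice_x hy,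
    fun _ => h.cx.b _ (mem_strip.2 hy), h.cx.hx.slice hy⟩

lemma NSol.exists_step {C : ℝ} (hL : 0 < L) (hN : 2 * N ≤ 1 / 8) (h : NSol L C d m n mx my nx π)
    (hd : d.Good a N) (cm : C2a L a N m mx my mxx mxy myy)
    (cn : C2a L a N n nx (fun z => - mx z) nxx nxy nyy) :
    ∃ q, Good L a (2 * N) q ∧ Step L d q q ∧ q.m = m ∧ q.n = n := by
  have m0 : (0 : ℝ) ∈ Icc 0 L := ⟨le_rfl, hL.le⟩
  have mL : L ∈ Icc 0 L := ⟨hL.le, le_rfl⟩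
  have hN0 := cm.nonneg hL.le
  have hβ : ∀ x, |d.β x| ≤ 1 / 2 := fun x => (hd.hβ.2.1 x).trans (by linarith)
  have hd2 : d.Good a (2 * N) := hd.mono (by linarith)
  have hβ1 : ∀ x, 0 < 1 + d.β x := fun x => by linarith [(abs_le.1 (hβ x)).1]
  have hn1 : ∀ z ∈ strip L, 0 < 1 + n z := fun z hz => by
    have := (abs_le.1 (cn.b z hz)).1; linarith
  have hnxy : EqOn nxy (fun z => - mxx z) (strip L) := (G1.unique hL cn.cy.g cm.cx.g.neg).1
  have pmx := h.hm.per_partials hL fun x y _ => h.pm x y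
  have pnx := h.hn.per_partials hL fun x y _ => h.pn x y
  have pmxx := cm.cx.g.per_partials hL pmx.1
  have pnxx := cn.cx.g.per_partials hL pnx.1
  set q : Flow := ⟨m, n, clampY L mx, clampY L nx, clampY L mxx, clampY L nxx,
    clampY L fun z => nx z - my z, clampY L fun z => nxx z - mxy z⟩ with hq
  have emx : EqOn q.mx mx (strip L) := clampY_eqOn _
  have enx : EqOn q.nx nx (strip L) := clampY_eqOn _
  have emxx : EqOn q.mxx mxx (strip L) := clampY_eqOn _
  have enxx : EqOn q.nxx nxx (strip L) := clampY_eqOn _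
  have ew : EqOn q.w (fun z => nx z - my z) (strip L) := clampY_eqOn fun z => nx z - my z
  have ewx : EqOn q.wx (fun z => nxx z - mxy z) (strip L) :=
    clampY_eqOn fun z => nxx z - mxy z
  have slm : ∀ y ∈ Icc 0 L, H2 a N (fun x => q.m (x, y)) (fun x => q.mx (x, y))
      fun x => q.mxx (x, y) := fun y hy => by
    have := H2.of_C2a cm hy
    simpa only [emx (mem_strip.2 hy), emxx (mem_strip.2 hy)] using this
  have sln : ∀ y ∈ Icc 0 L, H2 a N (fun x => q.n (x, y)) (fun x => q.nx (x, y))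
      fun x => q.nxx (x, y) := fun y hy => by
    have := H2.of_C2a cn hy
    simpa only [enx (mem_strip.2 hy), enxx (mem_strip.2 hy)] using this
  have pw : ∀ x, ∀ y ∈ Icc 0 L, nx (x + 1, y) - my (x + 1, y) = nx (x, y) - my (x, y) :=
    fun x y hy => by rw [pnx.1 x y hy, pmx.2 x y hy]
  have pwx : ∀ x, ∀ y ∈ Icc 0 L, nxx (x + 1, y) - mxy (x + 1, y) = nxx (x, y) - mxy (x, y) :=
    fun x y hy => by rw [pnxx.1 x y hy, pmxx.2 x y hy]
  have gq : Good L a (2 * N) q := by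
    refine ⟨h.hm.congr (fun _ _ => rfl) emx fun z hz => ?_, h.hn.congr (fun _ _ => rfl) enx
      fun z hz => ?_, cm.cx.g.congr emx emxx fun z hz => ?_, cn.cx.g.congr enx enxx fun z hz => ?_,
      h.pm, h.pn, PerX.clampY (f := fun z => nx z - my z) hL.le pw, PerX.clampY hL.le pmx.1,
      PerX.clampY hL.le pnx.1, PerX.clampY (f := fun z => nxx z - mxy z) hL.le pwx,
      fun y hy => (slm y hy).mono (by linarith), fun y hy => (sln y hy).mono (by linarith),
      fun y hy => ?_, (cm.cx.hx.congr emxx).mono (by linarith),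
      (cn.cx.hx.congr enxx).mono (by linarith)⟩
    · simp only [enx hz, ew hz]; ring
    · simp only [emx hz]
    · simp only [enxx hz, ewx hz]; ring
    · simp only [emxx hz, hnxy hz]
    · have e1 : (fun x => q.w (x, y)) = fun x => nx (x, y) - my (x, y) :=
        funext fun x => ew (mem_strip.2 hy)
      have e2 : (fun x => q.wx (x, y)) = fun x => nxx (x, y) - mxy (x, y) :=
        funext fun x => ewx (mem_strip.2 hy)
      rw [e1, e2, two_mul]
      exact ⟨fun x => (cn.cx.g.slice_x hy).sub (cm.cy.g.slice_x hy), fun x =>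
        (norm_sub_le _ _).trans (add_le_add (cn.cx.b _ (mem_strip.2 hy))
          (cm.cy.b _ (mem_strip.2 hy))), (cn.cx.hx.slice hy).sub (cm.cy.hx.slice hy)⟩
  refine ⟨q, gq, ?_, rfl, rfl⟩
  obtain ⟨s, hs⟩ := exists_Lag hL h.hm h.hn h.pm h.pn h.h0 hβ
  have gH := h.bernoulli
  set H := fun z => π z + (m z * m z + (1 + n z) * (1 + n z)) / 2 with hH
  have hbern : ∀ t, H (t, 0) = C + 1 / 2 + bern d q t := fun t => by
    simp only [hH, bern, hq, h.hA, h.h0]; ring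
  have gG := gH.sub ((hs.hs.comp fun t => gq.hasDerivAt_bern hL hd2 hN t).add
    (G1.const (C + 1 / 2)))
  have hG : ∀ z ∈ strip L, H z - (bern d q (s z) + (C + 1 / 2)) = 0 := fun z hz => by
    refine eq_zero_of_transport (D := fun z => (nx z - my z) - kap d q (s z)) h.hm h.hn h.pm hn1
      (gG.congr (fun _ _ => rfl) (fun z _ => ?_) fun z _ => ?_) (fun x y hy => ?_) (fun x => ?_) hz
    · field_simp [(hβ1 (s z)).ne']; ring
    · field_simp [(hβ1 (s z)).ne']; ring
    · have p1 : bern d q (s (x + 1, y)) = bern d q (s (x, y)) := by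
        simp only [bern, hs.sp, hd.pA _, hd.pβ _, gq.pm _ _]
      simp only [hH, h.pπ x y hy, h.pm _ _, h.pn _ _, p1]
    · simp only [hs.s0, hbern]; ring
  have hw : ∀ z ∈ strip L, nx z - my z = kap d q (s z) := fun z hz => by
    have e := (G1.unique hL gG ((G1.const (0 : ℝ)).congr hG (fun _ _ => rfl) fun _ _ => rfl)).1 hz
    have hb := (hβ1 (s z)).ne'
    have e2 : (nx z - my z - kap d q (s z)) * (1 + n z) = 0 := by
      refine Eq.trans ?_ e
      field_simp; ring
    exact sub_eq_zero.1 ((mul_eq_zero.1 e2).resolve_right (hn1 z hz).ne')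
  obtain ⟨c, hc⟩ := h.hT
  refine ⟨s, C - c, hs, fun z hz => (ew hz).trans (hw z hz), gq.hm, gq.hn, gq.pm, gq.pn, gq.pmx,
    gq.pnx, h.h0, fun x => ?_, h.hj⟩
  have := hG _ (mem_strip.2 mL : (x, L) ∈ strip L)
  simp only [hH, hc] at this
  simp only [topN, hq] at this ⊢
  linarith

end Normalized

section Reconstruct

variable {L a N K : ℝ}

lemma C1a.mono {E : Type*} [NormedAddCommGroup E] [NormedSpace ℝ E] {f fx fy : ℝ × ℝ → E}
    (h : C1a L a N f fx fy) (hK : N ≤ K) : C1a L a K f fx fy :=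
  ⟨h.g, fun z hz => (h.b z hz).trans hK, h.hx.mono hK, h.hy.mono hK⟩

lemma C2a.mono {E : Type*} [NormedAddCommGroup E] [NormedSpace ℝ E]
    {f fx fy fxx fxy fyy : ℝ × ℝ → E} (h : C2a L a N f fx fy fxx fxy fyy) (hK : N ≤ K) :
    C2a L a K f fx fy fxx fxy fyy :=
  ⟨h.g, fun z hz => (h.b z hz).trans hK, h.cx.mono hK, h.cy.mono hK⟩

/-- The vorticity, transported along the streamlines, is of class `C^{1,a}` on the strip. -/
lemma Good.kap_comp {d : BD} {q : Flow} {s : ℝ × ℝ → ℝ} (ha : a ∈ Ioo (0 : ℝ) 1) (hL : 0 < L)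
    (hN : N ≤ 1 / 8) (hd : d.Good a N) (hq : Good L a N q) (hs : Lag L q.m q.n d.β s) :
    ∃ wx wy, G1 L (fun z => kap d q (s z)) wx wy ∧ Ho a (10 ^ 9 * N) (strip L) wx ∧
      Ho a (10 ^ 9 * N) (strip L) wy := by
  have hN0 : 0 ≤ N := hd.hβ.nonneg
  obtain ⟨κ', hκ⟩ := hq.kap_h1 ha hL hd le_rfl hN
  replace hκ : H1 a (489600 * N) (kap d q) κ' := hκ.mono (by nlinarith)
  have hβ : ∀ x, |d.β x| ≤ 1 / 2 := fun x => (hd.hβ.2.1 x).trans (by linarith)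
  have hβ1 : ∀ x, 1 / 2 ≤ 1 + d.β x := fun x => by linarith [(abs_le.1 (hβ x)).1]
  have bm : ∀ z ∈ strip L, |q.m z| ≤ N := fun z hz => (hq.sm z.2 hz.2).2.1 z.1
  have bn : ∀ z ∈ strip L, |q.n z| ≤ N := fun z hz => hq.abs_n_le hz
  have bmx : ∀ z ∈ strip L, |q.mx z| ≤ N := fun z hz => (hq.sm z.2 hz.2).2.2.2.1 z.1
  have bnx : ∀ z ∈ strip L, |q.nx z| ≤ N := fun z hz => (hq.sn z.2 hz.2).2.2.2.1 z.1
  have bw : ∀ z ∈ strip L, |q.w z| ≤ N := fun z hz => (hq.sw z.2 hz.2).2.1 z.1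
  have bmy : ∀ z ∈ strip L, |q.nx z - q.w z| ≤ 2 * N := fun z hz =>
    (abs_sub _ _).trans (by linarith [bnx z hz, bw z hz])
  have ls : ∀ z ∈ strip L, ∀ w ∈ strip L, ‖s z - s w‖ ≤ 8 * ‖z - w‖ := fun z hz w hw =>
    (hs.hs.dist_le (N := 4) (fun z hz => abs_inv_mul_le (hβ _) ((bn z hz).trans (by linarith)))
      (fun z hz => by
        rw [Real.norm_eq_abs, abs_mul, abs_neg, abs_inv, abs_of_pos (by linarith [hβ1 (s z)])]
        have : (1 + d.β (s z))⁻¹ ≤ 2 := by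
          rw [inv_le_comm₀ (by linarith [hβ1 (s z)]) (by norm_num)]; linarith [hβ1 (s z)]
        nlinarith [bm z hz, abs_nonneg (q.m z)]) hz hw).trans (by linarith)
  have mt : MapsTo s (strip L) univ := fun _ _ => trivial
  have hinv : Ho a 22 (strip L) fun z => (1 + d.β (s z))⁻¹ :=
    (((Ho.const (1 : ℝ)).add (((hd.hβ.h1 ha).ho ha).comp_lip ha mt (by norm_num) ls)).mono
      (by rw [norm_one]; linarith : _ ≤ (5 : ℝ))).inv (fun z _ => hβ1 _) |>.mono (by norm_num)
  have hm : Ho a 1 (strip L) q.m := by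
    refine (Ho.of_lip (N := 2 * N) ha (fun z hz => (bm z hz).trans (by linarith))
      fun z hz w hw => (hq.hm.dist_le (N := 2 * N) (fun z hz => (bmx z hz).trans (by linarith)) bmy
        hz hw).trans (le_of_eq (by ring))).mono (by linarith)
  have hn : Ho a 1 (strip L) q.n := by
    refine (Ho.of_lip (N := 2 * N) ha (fun z hz => (bn z hz).trans (by linarith))
      fun z hz w hw => (hq.hn.dist_le (N := 2 * N) (fun z hz => (bnx z hz).trans (by linarith))
        (fun z hz => by rw [norm_neg]; exact (bmx z hz).trans (by linarith))
        hz hw).trans (le_of_eq (by ring))).mono (by linarith)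
  have hsx := hinv.mul ((Ho.const (1 : ℝ)).add hn)
  have hsy := hinv.mul hm.neg
  have hk := hκ.2.2.comp_lip ha mt (by norm_num) ls
  refine ⟨_, _, hs.hs.comp hκ.1, (hk.mul hsx).mono ?_, (hk.mul hsy).mono ?_⟩
  · rw [norm_one]; linarith
  · linarith

lemma Good.exists_nsol {d : BD} {q : Flow} (ha : a ∈ Ioo (0 : ℝ) 1) (hL : 0 < L)
    (hN : N ≤ 1 / 8) (hd : d.Good a N) (hq : Good L a N q) (hst : Step L d q q) (C : ℝ) :
    ∃ my mxy myy nxy nyy π, C2a L a (10 ^ 10 * N) q.m q.mx my q.mxx mxy myy ∧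
      C2a L a (10 ^ 10 * N) q.n q.nx (fun z => - q.mx z) q.nxx nxy nyy ∧
      NSol L C d q.m q.n q.mx my q.nx π ∧ PerX π := by
  obtain ⟨s, c, hs, hw, hR⟩ := hst
  have hN0 : 0 ≤ N := hd.hβ.nonneg
  have m0 : (0 : ℝ) ∈ Icc 0 L := ⟨le_rfl, hL.le⟩
  have mL : L ∈ Icc 0 L := ⟨hL.le, le_rfl⟩
  have hβ1 : ∀ x, 0 < 1 + d.β x := fun x => by
    linarith [(abs_le.1 ((hd.hβ.2.1 x : |d.β x| ≤ N))).1]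
  obtain ⟨wx, wy, gw, hwx, hwy⟩ := hq.kap_comp ha hL hN hd hs
  replace gw : G1 L q.w wx wy := gw.congr hw (fun _ _ => rfl) fun _ _ => rfl
  have ewx : EqOn q.wx wx (strip L) := fun z hz =>
    ((hq.sw z.2 hz.2).1 z.1).unique (gw.slice_x hz.2)
  have hxy : Ho a (10 ^ 10 * N) (strip L) fun z => q.nxx z - q.wx z :=
    ((hq.jn.sub hwx).congr fun z hz => by simp only [ewx hz]).mono (by linarith)
  have bm : ∀ z ∈ strip L, |q.m z| ≤ N := fun z hz => (hq.sm z.2 hz.2).2.1 z.1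
  have bmx : ∀ z ∈ strip L, |q.mx z| ≤ N := fun z hz => (hq.sm z.2 hz.2).2.2.2.1 z.1
  have bnx : ∀ z ∈ strip L, |q.nx z| ≤ N := fun z hz => (hq.sn z.2 hz.2).2.2.2.1 z.1
  have bw : ∀ z ∈ strip L, |q.w z| ≤ N := fun z hz => (hq.sw z.2 hz.2).2.1 z.1
  have cy : C1a L a (10 ^ 10 * N) (fun z => q.nx z - q.w z) (fun z => q.nxx z - q.wx z)
      fun z => -q.mxx z - wy z :=
    ⟨(hq.hnx.sub gw).congr (fun _ _ => rfl) (fun z hz => by simp only [ewx hz]) fun _ _ => rfl,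
      fun z hz => (abs_sub _ _).trans (by linarith [bnx z hz, bw z hz]), hxy,
      (hq.jm.neg.sub hwy).mono (by linarith)⟩
  have cm : C2a L a (10 ^ 10 * N) q.m q.mx (fun z => q.nx z - q.w z) q.mxx
      (fun z => q.nxx z - q.wx z) fun z => -q.mxx z - wy z :=
    ⟨hq.hm, fun z hz => (bm z hz).trans (by linarith), ⟨hq.hmx,
      fun z hz => (bmx z hz).trans (by linarith), hq.jm.mono (by linarith), hxy⟩, cy⟩
  have cn : C2a L a (10 ^ 10 * N) q.n q.nx (fun z => -q.mx z) q.nxx (fun z => -q.mxx z)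
      fun z => -(q.nxx z - q.wx z) :=
    ⟨hq.hn, fun z hz => (hq.abs_n_le hz).trans (by linarith), ⟨hq.hnx,
      fun z hz => (bnx z hz).trans (by linarith), hq.jn.mono (by linarith),
      hq.jm.neg.mono (by linarith)⟩, ⟨hq.hmx.neg, fun z hz => by
        rw [norm_neg]; exact (bmx z hz).trans (by linarith), hq.jm.neg.mono (by linarith),
        hxy.neg⟩⟩
  set π := clampY L fun z => C + 1 / 2 + bern d q (s z)
    - (q.m z * q.m z + (1 + q.n z) * (1 + q.n z)) / 2 with hπ
  have eπ : EqOn π (fun z => C + 1 / 2 + bern d q (s z)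
    - (q.m z * q.m z + (1 + q.n z) * (1 + q.n z)) / 2) (strip L) := clampY_eqOn fun z =>
      C + 1 / 2 + bern d q (s z) - (q.m z * q.m z + (1 + q.n z) * (1 + q.n z)) / 2
  have pπ : PerX π := PerX.clampY (f := fun z => C + 1 / 2 + bern d q (s z)
    - (q.m z * q.m z + (1 + q.n z) * (1 + q.n z)) / 2) hL.le fun x y _ => by
      simp only [bern, hs.sp, hd.pA _, hd.pβ _, hq.pm _ _, hq.pn _ _]
  have g := ((G1.const (L := L) (1 : ℝ)).add hq.hn)
  have gπ := (((G1.const (L := L) (C + 1 / 2)).add (hs.hs.comp fun t =>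
    hq.hasDerivAt_bern hL hd hN t)).sub (((hq.hm.mul hq.hm).add (g.mul g)).const_smul (1 / 2)))
  refine ⟨_, _, _, _, _, π, cm, cn, ⟨hq.hm, hq.hn, gπ.congr (fun z hz => ?_) (fun z hz => ?_)
    (fun z hz => ?_), hq.pm, hq.pn, fun x y _ => pπ x y, hR.h0, fun x => ?_, ⟨C - 1 / 2 + 1 / 2 - c,
      fun x => ?_⟩, hR.hj⟩, pπ⟩
  · rw [eπ hz]; simp only [smul_eq_mul]; ring
  · have := (hβ1 (s z)).ne'
    simp only [smul_eq_mul, hw z hz]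
    field_simp; ring
  · have := (hβ1 (s z)).ne'
    simp only [smul_eq_mul, hw z hz]
    field_simp; ring
  · rw [eπ (mem_strip.2 m0)]
    simp only [bern, hs.s0, hR.h0]; ring
  · rw [eπ (mem_strip.2 mL)]
    have := hR.h1 x
    simp only [topN] at this
    simp only
    linarith

end Reconstruct

section Calculus

variable {E F : Type*} [NormedAddCommGroup E] [NormedSpace ℝ E] [NormedAddCommGroup F]
  [NormedSpace ℝ F] {L a N K : ℝ} {f fx fy fxx fxy fyy g gx gy gxx gxy gyy : ℝ × ℝ → E}

lemma C1a.congr {fx' fy' : ℝ × ℝ → E} (h : C1a L a N f fx fy) (e : EqOn g f (strip L))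
    (ex : EqOn fx' fx (strip L)) (ey : EqOn fy' fy (strip L)) : C1a L a N g fx' fy' :=
  ⟨h.g.congr e ex ey, fun z hz => by rw [e hz]; exact h.b z hz, h.hx.congr ex, h.hy.congr ey⟩

lemma C1a.add (h : C1a L a N f fx fy) (k : C1a L a K g gx gy) :
    C1a L a (N + K) (fun z => f z + g z) (fun z => fx z + gx z) fun z => fy z + gy z :=
  ⟨h.g.add k.g, fun z hz => (norm_add_le _ _).trans (add_le_add (h.b z hz) (k.b z hz)),
    h.hx.add k.hx, h.hy.add k.hy⟩

lemma C1a.neg (h : C1a L a N f fx fy) :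
    C1a L a N (fun z => -f z) (fun z => -fx z) fun z => -fy z :=
  ⟨h.g.neg, fun z hz => by rw [norm_neg]; exact h.b z hz, h.hx.neg, h.hy.neg⟩

lemma C1a.const_smul (c : ℝ) (h : C1a L a N f fx fy) :
    C1a L a (|c| * N) (fun z => c • f z) (fun z => c • fx z) fun z => c • fy z :=
  ⟨h.g.const_smul c, fun z hz => by
    rw [norm_smul, Real.norm_eq_abs]; gcongr; exact h.b z hz, h.hx.const_smul c, h.hy.const_smul c⟩

lemma C1a.clm (T : E →L[ℝ] F) (hT : ‖T‖ ≤ 1) (h : C1a L a N f fx fy) :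
    C1a L a N (fun z => T (f z)) (fun z => T (fx z)) fun z => T (fy z) :=
  ⟨h.g.clm T, fun z hz => (T.le_of_opNorm_le hT _).trans (by simpa using h.b z hz),
    h.hx.clm T hT, h.hy.clm T hT⟩

lemma C1a.ho (ha : a ∈ Ioo (0 : ℝ) 1) (h : C1a L a N f fx fy) : Ho a (2 * N) (strip L) f :=
  Ho.of_lip ha h.b fun _ hz _ hw => h.g.dist_le h.hx.1 h.hy.1 hz hw

lemma C1a.mul {f fx fy g gx gy : ℝ × ℝ → ℝ} (ha : a ∈ Ioo (0 : ℝ) 1) (hL : 0 ≤ L)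
    (h : C1a L a N f fx fy) (k : C1a L a K g gx gy) :
    C1a L a (8 * N * K) (fun z => f z * g z) (fun z => fx z * g z + f z * gx z)
      fun z => fy z * g z + f z * gy z := by
  have hN : 0 ≤ N := (norm_nonneg _).trans (h.b (0, 0) (mem_strip.2 ⟨le_rfl, hL⟩))
  have hK : 0 ≤ K := (norm_nonneg _).trans (k.b (0, 0) (mem_strip.2 ⟨le_rfl, hL⟩))
  refine ⟨h.g.mul k.g, fun z hz => ?_, ((h.hx.mul (k.ho ha)).add ((h.ho ha).mul k.hx)).mono
    (by linarith), ((h.hy.mul (k.ho ha)).add ((h.ho ha).mul k.hy)).mono (by linarith)⟩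
  rw [norm_mul]
  nlinarith [mul_le_mul (h.b z hz) (k.b z hz) (norm_nonneg _) hN, mul_nonneg hN hK]

lemma C2a.c1a (ha : a ∈ Ioo (0 : ℝ) 1) (hL : 0 ≤ L) (h : C2a L a N f fx fy fxx fxy fyy) :
    C1a L a (2 * N) f fx fy :=
  ⟨h.g, fun z hz => (h.b z hz).trans (by linarith [h.nonneg hL]), h.cx.ho ha, h.cy.ho ha⟩

lemma C2a.add (h : C2a L a N f fx fy fxx fxy fyy) (k : C2a L a K g gx gy gxx gxy gyy) :
    C2a L a (N + K) (fun z => f z + g z) (fun z => fx z + gx z) (fun z => fy z + gy z)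
      (fun z => fxx z + gxx z) (fun z => fxy z + gxy z) fun z => fyy z + gyy z :=
  ⟨h.g.add k.g, fun z hz => (norm_add_le _ _).trans (add_le_add (h.b z hz) (k.b z hz)),
    h.cx.add k.cx, h.cy.add k.cy⟩

lemma C2a.const_smul (c : ℝ) (h : C2a L a N f fx fy fxx fxy fyy) :
    C2a L a (|c| * N) (fun z => c • f z) (fun z => c • fx z) (fun z => c • fy z)
      (fun z => c • fxx z) (fun z => c • fxy z) fun z => c • fyy z :=
  ⟨h.g.const_smul c, fun z hz => by
    rw [norm_smul, Real.norm_eq_abs]; gcongr; exact h.b z hz, h.cx.const_smul c, h.cy.const_smul c⟩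

lemma C2a.neg (h : C2a L a N f fx fy fxx fxy fyy) :
    C2a L a N (fun z => -f z) (fun z => -fx z) (fun z => -fy z) (fun z => -fxx z)
      (fun z => -fxy z) fun z => -fyy z :=
  ⟨h.g.neg, fun z hz => by rw [norm_neg]; exact h.b z hz, h.cx.neg, h.cy.neg⟩

lemma C2a.clm (T : E →L[ℝ] F) (hT : ‖T‖ ≤ 1) (h : C2a L a N f fx fy fxx fxy fyy) :
    C2a L a N (fun z => T (f z)) (fun z => T (fx z)) (fun z => T (fy z)) (fun z => T (fxx z))
      (fun z => T (fxy z)) fun z => T (fyy z) :=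
  ⟨h.g.clm T, fun z hz => (T.le_of_opNorm_le hT _).trans (by simpa using h.b z hz),
    h.cx.clm T hT, h.cy.clm T hT⟩

lemma C2a.congr_y {fy' : ℝ × ℝ → E} (h : C2a L a N f fx fy fxx fxy fyy)
    (ey : EqOn fy' fy (strip L)) : C2a L a N f fx fy' fxx fxy fyy :=
  ⟨h.g.congr (fun _ _ => rfl) (fun _ _ => rfl) ey, h.b, h.cx,
    h.cy.congr ey (fun _ _ => rfl) fun _ _ => rfl⟩

lemma G1.prodMk {g gx gy : ℝ × ℝ → F} (h : G1 L f fx fy) (k : G1 L g gx gy) :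
    G1 L (fun z => (f z, g z)) (fun z => (fx z, gx z)) fun z => (fy z, gy z) := fun z hz => by
  have : EulerBVP.lin (fx z, gx z) (fy z, gy z)
      = (EulerBVP.lin (fx z) (fy z)).prod (EulerBVP.lin (gx z) (gy z)) := by
    ext <;> simp
  rw [this]; exact (h z hz).prodMk (k z hz)

lemma Ho.prodMk {G H : Type*} [NormedAddCommGroup G] [NormedAddCommGroup H]
    {f : ℝ × ℝ → G} {g : ℝ × ℝ → H} (h : Ho a N (strip L) f) (k : Ho a N (strip L) g) :
    Ho a N (strip L) fun z => (f z, g z) :=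
  ⟨fun z hz => max_le (h.1 z hz) (k.1 z hz),
    fun z hz w hw => max_le (h.2 z hz w hw) (k.2 z hz w hw)⟩

lemma C1a.prodMk {g gx gy : ℝ × ℝ → F} (h : C1a L a N f fx fy) (k : C1a L a N g gx gy) :
    C1a L a N (fun z => (f z, g z)) (fun z => (fx z, gx z)) fun z => (fy z, gy z) :=
  ⟨h.g.prodMk k.g, fun z hz => max_le (h.b z hz) (k.b z hz), h.hx.prodMk k.hx, h.hy.prodMk k.hy⟩

lemma C2a.prodMk {g gx gy gxx gxy gyy : ℝ × ℝ → F} (h : C2a L a N f fx fy fxx fxy fyy)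
    (k : C2a L a N g gx gy gxx gxy gyy) :
    C2a L a N (fun z => (f z, g z)) (fun z => (fx z, gx z)) (fun z => (fy z, gy z))
      (fun z => (fxx z, gxx z)) (fun z => (fxy z, gxy z)) fun z => (fyy z, gyy z) :=
  ⟨h.g.prodMk k.g, fun z hz => max_le (h.b z hz) (k.b z hz), h.cx.prodMk k.cx, h.cy.prodMk k.cy⟩

lemma C2a.memC (hL : 0 < L) (ha : 0 < a) (h : C2a L a N f fx fy fxx fxy fyy) :
    MemC 2 a (strip L) f :=
  ⟨h.contDiffOn hL ha, (h.hNorm_le hL).trans_lt ENNReal.ofReal_lt_top⟩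

lemma MemC.exists_C2a (hL : 0 < L) (ha : 0 < a) (h : MemC 2 a (strip L) f) :
    ∃ N fx fy fxx fxy fyy, C2a L a N f fx fy fxx fxy fyy :=
  ⟨_, C2a.of_hNorm_le hL ha ENNReal.toReal_nonneg h.1 (ENNReal.ofReal_toReal h.2.ne).ge⟩

/-- Symmetry of the second partial derivatives. -/
lemma G1.symm (hL : 0 < L) {fyx : ℝ × ℝ → E} (h : G1 L f fx fy) (hx : G1 L fx fxx fxy)
    (hy : G1 L fy fyx fyy) : EqOn fxy fyx (strip L) := fun z hz => by
  have hne : (interior (strip L)).Nonempty := by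
    rw [← closure_nonempty_iff, closure_interior_strip hL]; exact ⟨z, hz⟩
  have := (convex_strip L).second_derivative_within_at_symmetric hne
    (fun w hw => (h w (interior_subset hw)).hasFDerivAt (mem_interior_iff_mem_nhds.1 hw)) hz
    (((hx.lin hy) z hz).mono interior_subset) (0, 1) (1, 0)
  simpa using this

/-- A function that is periodic in the first variable differs little from its value at the
origin. -/
lemma G1.norm_sub_le (hL : 0 < L) (h : G1 L f fx fy)
    (hp : ∀ x, ∀ y ∈ Icc 0 L, f (x + 1, y) = f (x, y)) (hx : ∀ z ∈ strip L, ‖fx z‖ ≤ N)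
    (hy : ∀ z ∈ strip L, ‖fy z‖ ≤ N) {z : ℝ × ℝ} (hz : z ∈ strip L) :
    ‖f z - f (0, 0)‖ ≤ 2 * N * (1 + L) := by
  have hzy : z.2 ∈ Icc 0 L := hz.2
  have hfr : f z = f (Int.fract z.1, z.2) := by
    have := (PerX.clampY hL.le hp).fract z.1 z.2
    rwa [clampY_eqOn f (mem_strip.2 hzy), clampY_eqOn f (mem_strip.2 hzy)] at this
  rw [hfr]
  have hN : 0 ≤ N := (norm_nonneg _).trans (hx z hz)
  refine (h.dist_le hx hy (mem_strip.2 hzy) (mem_strip.2 ⟨le_rfl, hL.le⟩)).trans ?_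
  gcongr
  rw [Prod.mk_sub_mk, sub_zero, sub_zero]
  refine max_le ?_ ?_
  · rw [Real.norm_of_nonneg (Int.fract_nonneg _)]; linarith [Int.fract_lt_one z.1]
  · rw [Real.norm_of_nonneg hzy.1]; linarith [hzy.2]

end Calculus

section Pressure

variable {L a N C : ℝ} {m n mx my nx ny mxx mxy myy nxx nxy nyy π : ℝ × ℝ → ℝ} {d : BD}

lemma NSol.exists_C2a_pressure (ha : a ∈ Ioo (0 : ℝ) 1) (hL : 0 < L)
    (h : NSol L C d m n mx my nx π) (cm : C2a L a N m mx my mxx mxy myy)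
    (cn : C2a L a N n nx (fun z => -mx z) nxx nxy nyy) :
    ∃ K πx πy πxx πxy πyy, C2a L a K π πx πy πxx πxy πyy := by
  have hN := cm.nonneg hL.le
  have c1 : C1a L a 1 (fun _ => (1 : ℝ)) (fun _ => 0) fun _ => 0 :=
    ⟨G1.const 1, fun _ _ => by simp, (Ho.const (0 : ℝ)).mono (by simp),
      (Ho.const (0 : ℝ)).mono (by simp)⟩
  have g := c1.add (cn.c1a ha hL.le)
  have px := (((cm.c1a ha hL.le).mul ha hL.le cm.cx).add (g.mul ha hL.le cm.cy)).neg
  have py := (((cm.c1a ha hL.le).mul ha hL.le cn.cx).add (g.mul ha hL.le cn.cy)).neg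
  have sym := h.hπ.symm hL px.g py.g
  replace py := py.congr (fun _ _ => rfl) sym fun _ _ => rfl
  set K := 8 * (2 * N) * N + 8 * (1 + 2 * N) * N with hK
  have hK0 : 0 ≤ K := by positivity
  have hle : K ≤ |π (0, 0)| + 2 * K * (1 + L) := by
    nlinarith [abs_nonneg (π (0, 0)), mul_nonneg hK0 hL.le]
  refine ⟨|π (0, 0)| + 2 * K * (1 + L), _, _, _, _, _, h.hπ, fun z hz => ?_, px.mono hle,
    py.mono hle⟩
  have := h.hπ.norm_sub_le hL h.pπ px.b py.b hz
  have e : π z = π (0, 0) + (π z - π (0, 0)) := by ring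
  rw [e]
  exact (norm_add_le _ _).trans (add_le_add le_rfl this)

/-- Solutions of the normalized problem close to the uniform flow are unique. -/
lemma NSol.unique (hL : 0 < L) {N₀ : ℝ} (hN : 2 * N ≤ N₀) (hN₀ : N₀ ≤ 1 / 8)
    (huniq : ∀ d q r, d.Good a N₀ → Good L a N₀ q → Good L a N₀ r → Step L d q q → Step L d r r →
      EqOn q.m r.m (strip L) ∧ EqOn q.n r.n (strip L))
    {m' n' mx' my' nx' mxx' mxy' myy' nxx' nxy' nyy' π' : ℝ × ℝ → ℝ}
    (h : NSol L C d m n mx my nx π) (h' : NSol L C d m' n' mx' my' nx' π') (hd : d.Good a N)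
    (cm : C2a L a N m mx my mxx mxy myy) (cn : C2a L a N n nx (fun z => -mx z) nxx nxy nyy)
    (cm' : C2a L a N m' mx' my' mxx' mxy' myy')
    (cn' : C2a L a N n' nx' (fun z => -mx' z) nxx' nxy' nyy') :
    EqOn m m' (strip L) ∧ EqOn n n' (strip L) ∧ EqOn π π' (strip L) := by
  have hN0 := cm.nonneg hL.le
  obtain ⟨q, gq, sq, rfl, rfl⟩ := h.exists_step hL (hN.trans hN₀) hd cm cn
  obtain ⟨r, gr, sr, rfl, rfl⟩ := h'.exists_step hL (hN.trans hN₀) hd cm' cn'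
  have gd : d.Good a (2 * N) := hd.mono (by linarith)
  obtain ⟨em, en⟩ := huniq d q r (hd.mono (by linarith)) (gq.mono hN) (gr.mono hN) sq sr
  obtain ⟨ex, ey⟩ := G1.unique hL h.hm (h'.hm.congr em (fun _ _ => rfl) fun _ _ => rfl)
  have enx := (G1.unique hL h.hn (h'.hn.congr en (fun _ _ => rfl) fun _ _ => rfl)).1
  refine ⟨em, en, fun z hz => ?_⟩
  have gπ := (h.hπ.sub h'.hπ).congr (fun _ _ => rfl) (fx' := fun _ => 0) (fy' := fun _ => 0)
    (fun z hz => by simp only [em hz, en hz, ex hz, ey hz, sub_self])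
    (fun z hz => by simp only [em hz, en hz, ex hz, enx hz, sub_self])
  have := gπ.eq_const hz (mem_strip.2 ⟨le_rfl, hL.le⟩ : ((0 : ℝ), (0 : ℝ)) ∈ strip L)
  simp only [h.hA, h'.hA, sub_self] at this
  linarith

end Pressure

section Scaling

variable {L a c e C : ℝ} {v v₀ : ℝ × ℝ → ℝ × ℝ} {p p₀ : ℝ × ℝ → ℝ}
  {m n π mx my nx ny πx πy m₀ n₀ π₀ : ℝ × ℝ → ℝ} {hm hp fm : ℝ → ℝ} {J : ℝ} {d : BD}

/-- The solution `(v, p)` is `(m, 1 + n)`, `π` in units where the reference speed is `c`. -/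
def Scaled (c : ℝ) (v : ℝ × ℝ → ℝ × ℝ) (p m n π : ℝ × ℝ → ℝ) : Prop :=
  (∀ z, v z = (c * m z, c * (1 + n z))) ∧ ∀ z, p z = c ^ 2 * π z

lemma scaled_div (hc : c ≠ 0) (v : ℝ × ℝ → ℝ × ℝ) (p : ℝ × ℝ → ℝ) :
    Scaled c v p (fun z => c⁻¹ * (v z).1) (fun z => c⁻¹ * (v z).2 - 1)
      fun z => (c ^ 2)⁻¹ * p z :=
  ⟨fun z => by ext <;> field_simp; ring, fun z => by field_simp⟩

lemma Scaled.c1 (h : Scaled c v p m n π) (hm : G1 L m mx my) :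
    G1 L (EulerBVP.c1 v) (fun z => c * mx z) fun z => c * my z :=
  (hm.const_smul c).congr (fun z _ => by simp only [EulerBVP.c1, h.1 z, smul_eq_mul])
    (fun _ _ => rfl) fun _ _ => rfl

lemma Scaled.c2 (h : Scaled c v p m n π) (hn : G1 L n nx ny) :
    G1 L (EulerBVP.c2 v) (fun z => c * nx z) fun z => c * ny z :=
  (((G1.const (1 : ℝ)).add hn).const_smul c).congr
    (fun z _ => by simp only [EulerBVP.c2, h.1 z, smul_eq_mul])
    (fun _ _ => by simp only [smul_eq_mul, zero_add]) fun _ _ => by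
      simp only [smul_eq_mul, zero_add]

lemma Scaled.pressure (h : Scaled c v p m n π) (hπ : G1 L π πx πy) :
    G1 L p (fun z => c ^ 2 * πx z) fun z => c ^ 2 * πy z :=
  (hπ.const_smul (c ^ 2)).congr (fun z _ => by simp only [h.2 z, smul_eq_mul])
    (fun _ _ => rfl) fun _ _ => rfl

lemma Scaled.euler_iff (hL : 0 < L) (hc : c ≠ 0) (h : Scaled c v p m n π) (hm : G1 L m mx my)
    (hn : G1 L n nx ny) (hπ : G1 L π πx πy) :
    Euler L v p ↔ ∀ z ∈ strip L, m z * mx z + (1 + n z) * my z = -πx z ∧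
      m z * nx z + (1 + n z) * ny z = -πy z ∧ mx z + ny z = 0 := by
  have hc2 : c ^ 2 ≠ 0 := pow_ne_zero 2 hc
  refine forall₂_congr fun z hz => and_congr ?_ (and_congr ?_ ?_)
  · rw [(h.c1 hm).pdx_eq hL hz, (h.c1 hm).pdy_eq hL hz, (h.pressure hπ).pdx_eq hL hz, h.1 z]
    exact ⟨fun h => mul_left_cancel₀ hc2 (by linear_combination h),
      fun h => by linear_combination c ^ 2 * h⟩
  · rw [(h.c2 hn).pdx_eq hL hz, (h.c2 hn).pdy_eq hL hz, (h.pressure hπ).pdy_eq hL hz, h.1 z]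
    exact ⟨fun h => mul_left_cancel₀ hc2 (by linear_combination h),
      fun h => by linear_combination c ^ 2 * h⟩
  · rw [divF, (h.c1 hm).pdx_eq hL hz, (h.c2 hn).pdy_eq hL hz, ← mul_add, mul_eq_zero,
      or_iff_right hc]

lemma Scaled.fluxC_eq (h : Scaled c v p m n π) :
    fluxC L v = -(c * ∫ y in (0 : ℝ)..L, m (0, y)) := by
  simp only [fluxC, h.1, intervalIntegral.integral_const_mul]

/-- A potential flow close to the uniform flow `(0, 1)`. -/
structure Base (L a e C : ℝ) (m n mx my mxx mxy myy nxx nxy nyy π : ℝ × ℝ → ℝ) : Prop where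
  cm : C2a L a e m mx my mxx mxy myy
  cn : C2a L a e n my (fun z => -mx z) nxx nxy nyy
  pm : PerX m
  pn : PerX n
  hπ : ∀ z ∈ strip L, π z = C - (m z * m z + n z * n z) / 2 - n z

lemma exists_base (ha : a ∈ Ioo (0 : ℝ) 1) (hL : 0 < L) {ε : ℝ} (hε : 0 ≤ ε) (hvp : VP L 2 a v₀ p₀)
    (hE : Euler L v₀ p₀) (hcurl : ∀ z ∈ strip L, curlF L v₀ z = 0)
    (hc : (v₀ (0, 0)).2 ≠ 0) (h1 : hNorm 2 a (strip L) (c1 v₀) ≤ ENNReal.ofReal ε) :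
    ∃ C m n mx my mxx mxy myy nxx nxy nyy π, Scaled (v₀ (0, 0)).2 v₀ p₀ m n π ∧
      Base L a (2 * (1 + L) * (|(v₀ (0, 0)).2|⁻¹ * ε)) C m n mx my mxx mxy myy nxx nxy nyy π := by
  obtain ⟨pv, pp, mv, mp⟩ := hvp
  set c := (v₀ (0, 0)).2 with hcdef
  set m := fun z => c⁻¹ * (v₀ z).1
  set n := fun z => c⁻¹ * (v₀ z).2 - 1
  set π := fun z => (c ^ 2)⁻¹ * p₀ z
  have sc : Scaled c v₀ p₀ m n π := scaled_div hc v₀ p₀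
  have e0 : 0 ≤ |c|⁻¹ * ε := by positivity
  have hle : |c|⁻¹ * ε ≤ 2 * (1 + L) * (|c|⁻¹ * ε) := by nlinarith [mul_nonneg hL.le e0]
  obtain ⟨fx, fy, fxx, fxy, fyy, cf⟩ := C2a.of_hNorm_le (f := c1 v₀) hL ha.1 hε
    (contDiff_fst.comp_contDiffOn mv.1) h1
  have cm := cf.const_smul c⁻¹
  obtain ⟨K, gx, gy, gxx, gxy, gyy, cg⟩ := mv.exists_C2a hL ha.1
  have cn := (cg.clm (ContinuousLinearMap.snd ℝ ℝ ℝ)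
    (ContinuousLinearMap.norm_snd_le ℝ ℝ ℝ)).const_smul c⁻¹
  obtain ⟨_, qx, qy, _, _, _, cq⟩ := mp.exists_C2a hL ha.1
  have gπ : G1 L π _ _ := cq.g.const_smul (c ^ 2)⁻¹
  have gm : G1 L m _ _ := cm.g
  have gn : G1 L n _ _ := (cn.g.sub (G1.const 1)).congr (fun _ _ => rfl)
    (fun _ _ => (sub_zero _).symm) fun _ _ => (sub_zero _).symm
  rw [abs_inv] at cm
  set mx := fun z => c⁻¹ • fx z
  set my := fun z => c⁻¹ • fy z
  set nx := fun z => c⁻¹ • ContinuousLinearMap.snd ℝ ℝ ℝ (gx z)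
  set ny := fun z => c⁻¹ • ContinuousLinearMap.snd ℝ ℝ ℝ (gy z)
  set πx := fun z => (c ^ 2)⁻¹ • qx z
  set πy := fun z => (c ^ 2)⁻¹ • qy z
  have hE' := (sc.euler_iff hL hc gm gn gπ).1 hE
  have ex : EqOn my nx (strip L) := fun z hz => by
    have := hcurl z hz
    rw [curlF, (sc.c2 gn).pdx_eq hL hz, (sc.c1 gm).pdy_eq hL hz, ← mul_sub] at this
    exact (sub_eq_zero.1 ((mul_eq_zero.1 this).resolve_left hc)).symm
  have ey : EqOn (fun z => -mx z) ny (strip L) := fun z hz => by linarith [(hE' z hz).2.2]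
  have gn' : G1 L n my fun z => -mx z := gn.congr (fun _ _ => rfl) ex ey
  have pm : PerX m := fun x y => by simp only [m, pv x y]
  have pn : PerX n := fun x y => by simp only [n, pv x y]
  have pπ : PerX π := fun x y => by simp only [π, pp x y]
  have n0 : n (0, 0) = 0 := by simp only [n, ← hcdef, inv_mul_cancel₀ hc, sub_self]
  have c1x : C1a L a (|c|⁻¹ * ε) my (fun z => c⁻¹ • ContinuousLinearMap.snd ℝ ℝ ℝ (gxx z))
      fun z => c⁻¹ • ContinuousLinearMap.snd ℝ ℝ ℝ (gxy z) := by
    have := G1.unique hL (cn.cx.g.congr ex (fun _ _ => rfl) fun _ _ => rfl) cm.cy.g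
    exact cm.cy.congr (fun _ _ => rfl) this.1 this.2
  have c1y : C1a L a (|c|⁻¹ * ε) (fun z => -mx z)
      (fun z => c⁻¹ • ContinuousLinearMap.snd ℝ ℝ ℝ (gxy z))
      fun z => c⁻¹ • ContinuousLinearMap.snd ℝ ℝ ℝ (gyy z) := by
    have := G1.unique hL (cn.cy.g.congr ey (fun _ _ => rfl) fun _ _ => rfl) cm.cx.neg.g
    exact cm.cx.neg.congr (fun _ _ => rfl) this.1 this.2
  have cn' : C2a L a (2 * (1 + L) * (|c|⁻¹ * ε)) n my (fun z => -mx z) _ _ _ :=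
    ⟨gn', fun z hz => by
      have := gn'.norm_sub_le hL (fun x y _ => pn x y) c1x.b c1y.b hz
      rw [n0, sub_zero] at this
      linarith, c1x.mono hle, c1y.mono hle⟩
  have gB := (gπ.add (((gm.mul gm).add (gn'.mul gn')).const_smul (1 / 2))).add gn'
  refine ⟨π (0, 0) + (m (0, 0) * m (0, 0) + n (0, 0) * n (0, 0)) / 2 + n (0, 0), m, n, mx, my,
    _, _, _, _, _, _, π, sc, cm.mono hle, cn', pm, pn, fun z hz => ?_⟩
  have := (gB.congr (fun _ _ => rfl) (fx' := fun _ => 0) (fy' := fun _ => 0) (fun z hz => ?_)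
    fun z hz => ?_).eq_const hz (mem_strip.2 ⟨le_rfl, hL.le⟩ : ((0 : ℝ), (0 : ℝ)) ∈ strip L)
  · simp only [smul_eq_mul] at this
    linarith
  · have := (hE' z hz).1
    simp only [smul_eq_mul]
    linarith
  · have h2 := (hE' z hz).2.1
    have hx := ex hz
    have hy := ey hz
    simp only at hx hy
    rw [← hx, ← hy] at h2
    simp only [smul_eq_mul]
    linarith

/-- The boundary data `d` of the normalized problem correspond to `hm`, `hp`, `fm`, `J`. -/
structure Data (L c : ℝ) (m n : ℝ × ℝ → ℝ) (hm hp fm : ℝ → ℝ) (J : ℝ) (d : BD) : Prop where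
  hβ : ∀ x, d.β x = n (x, 0) - c⁻¹ * fm x
  hA : ∀ x, d.A x = (c ^ 2)⁻¹ * hm x - c⁻¹ * fm x
    - (m (x, 0) * m (x, 0) + n (x, 0) * n (x, 0)) / 2
  hT : ∀ x, d.T x = n (x, L) - (c ^ 2)⁻¹ * hp x
    + (m (x, L) * m (x, L) + n (x, L) * n (x, L)) / 2
  hj : d.j = -(c⁻¹ * J)

lemma Base.exists_data (ha : a ∈ Ioo (0 : ℝ) 1) (hL : 0 < L)
    {mxx mxy myy nxx nxy nyy : ℝ × ℝ → ℝ} (h : Base L a e C m n mx my mxx mxy myy nxx nxy nyy π)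
    (he : e ≤ 1) {s : ℝ} (hc : c ≠ 0)
    {hm' hm'' hp' hp'' fm' fm'' : ℝ → ℝ} (pm : Per hm) (pp : Per hp) (pf : Per fm)
    (sm : H2 a s hm hm' hm'') (sp : H2 a s hp hp' hp'') (sf : H2 a s fm fm' fm'')
    (sJ : |J + c * ∫ y in (0 : ℝ)..L, m (0, y)| ≤ s) :
    ∃ d : BD, d.Good a ((33 + L) * e + (|c|⁻¹ + |c|⁻¹ ^ 2) * s) ∧ Data L c m n hm hp fm J d := by
  have m0 : (0 : ℝ) ∈ Icc 0 L := ⟨le_rfl, hL.le⟩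
  have mL : L ∈ Icc 0 L := ⟨hL.le, le_rfl⟩
  have e0 := h.cm.nonneg hL.le
  have hs := sm.nonneg
  have hc0 : 0 ≤ |c|⁻¹ := by positivity
  have hcs : 0 ≤ |c|⁻¹ * s := by positivity
  have hcs2 : 0 ≤ |c|⁻¹ ^ 2 * s := by positivity
  have hLe : 0 ≤ L * e := by positivity
  have hee : e * e ≤ e := by nlinarith
  have q : ∀ {y}, y ∈ Icc 0 L → ∃ f' f'', H2 a (32 * e)
      (fun x => (1 / 2 : ℝ) • (m (x, y) * m (x, y) + n (x, y) * n (x, y))) f' f'' := fun hy =>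
    ⟨_, _, ((((H2.of_C2a h.cm hy).mul ha (H2.of_C2a h.cm hy)).add
      ((H2.of_C2a h.cn hy).mul ha (H2.of_C2a h.cn hy))).const_smul (1 / 2)).mono (by
        rw [abs_of_pos one_half_pos]; linarith)⟩
  obtain ⟨q0', q0'', q0⟩ := q m0
  obtain ⟨qL', qL'', qL⟩ := q mL
  have gf := sf.const_smul c⁻¹
  have gm := sm.const_smul (c ^ 2)⁻¹
  have gp := sp.const_smul (c ^ 2)⁻¹
  rw [abs_inv] at gf gm gp
  rw [abs_pow, ← inv_pow] at gm gp
  refine ⟨⟨_, _, _, _, _, _, _, _, _, -(c⁻¹ * J)⟩, ⟨fun x => ?_, fun x => ?_, fun x => ?_,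
    ((H2.of_C2a h.cn m0).sub gf).mono (by linarith), ((gm.sub gf).sub q0).mono (by linarith),
    (((H2.of_C2a h.cn mL).sub gp).add qL).mono (by linarith), ?_⟩, fun x => rfl, fun x => ?_,
    fun x => ?_, rfl⟩
  · simp only [h.pn _ _, pf x]
  · simp only [h.pn _ _, h.pm _ _, pm x, pf x]
  · simp only [h.pn _ _, h.pm _ _, pp x]
  · have hI : |∫ y in (0 : ℝ)..L, m (0, y)| ≤ L * e := by
      have := intervalIntegral.norm_integral_le_of_norm_le_const (a := 0) (b := L) (C := e)
        (f := fun y => m (0, y)) fun y hy => h.cm.b _ (mem_strip.2 (by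
          rw [uIoc_of_le hL.le] at hy; exact ⟨hy.1.le, hy.2⟩))
      rw [sub_zero, abs_of_pos hL, Real.norm_eq_abs] at this
      linarith
    have e1 : -(c⁻¹ * J) = (∫ y in (0 : ℝ)..L, m (0, y))
        - c⁻¹ * (J + c * ∫ y in (0 : ℝ)..L, m (0, y)) := by field_simp; ring
    change |-(c⁻¹ * J)| ≤ _
    rw [e1]
    refine (abs_sub _ _).trans ?_
    rw [abs_mul, abs_inv]
    nlinarith [mul_le_mul_of_nonneg_left sJ hc0]
  · simp only [smul_eq_mul]; ring
  · simp only [smul_eq_mul]; ring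

end Scaling

section Correspondence

variable {L a c e C M : ℝ} {v v₀ : ℝ × ℝ → ℝ × ℝ} {p p₀ : ℝ × ℝ → ℝ}
  {m₀ n₀ mx my mxx mxy myy nxx nxy nyy π₀ : ℝ × ℝ → ℝ} {hm hp fm : ℝ → ℝ} {J : ℝ} {d : BD}

lemma SolCmod.of_solC (hL : 0 < L) (ha : 0 < a) (hv : MemC 2 a (strip L) p₀)
    (hh : Differentiable ℝ hp) (h : SolC L a M v₀ p₀ hm hp fm J v p) :
    SolCmod L a M v₀ p₀ hm hp fm J v p := by
  obtain ⟨h1, h2, h3, h4, h5, h6⟩ := h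
  obtain ⟨K, fx, fy, fxx, fxy, fyy, cp⟩ := hv.exists_C2a hL ha
  refine ⟨h1, h2, h3, h4, fun x => ?_, h6⟩
  rw [show (fun t => p (t, L)) = fun t => p₀ (t, L) + hp t from funext h5]
  exact deriv_add (cp.g.slice_x ⟨hL.le, le_rfl⟩).differentiableAt (hh x)

lemma SolCmod.exists_const (hL : 0 < L) (ha : 0 < a) (hv : MemC 2 a (strip L) p₀)
    (hh : Differentiable ℝ hp) (h : SolCmod L a M v₀ p₀ hm hp fm J v p) (x : ℝ) :
    p (x, L) = p₀ (x, L) + hp x + (p (0, L) - p₀ (0, L) - hp 0) := by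
  obtain ⟨K, fx, fy, fxx, fxy, fyy, cp⟩ := hv.exists_C2a hL ha
  obtain ⟨K', gx, gy, gxx, gxy, gyy, cq⟩ := h.1.2.2.2.exists_C2a hL ha
  have mL : L ∈ Icc 0 L := ⟨hL.le, le_rfl⟩
  have hd : ∀ x, HasDerivAt (fun x => p (x, L) - p₀ (x, L) - hp x) 0 x := fun x => by
    have h1 := cq.g.slice_x (x := x) mL
    have h2 := cp.g.slice_x (x := x) mL
    refine ((h1.sub h2).sub (hh x).hasDerivAt).congr_deriv ?_
    have := h.2.2.2.2.1 x
    rw [h1.deriv, h2.deriv] at this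
    rw [this]; ring
  have := is_const_of_deriv_eq_zero (fun x => (hd x).differentiableAt) (fun x => (hd x).deriv) x 0
  linarith

/-- Solutions of the boundary value problem solve the normalized problem. -/
lemma Base.nsol_of_sol (hL : 0 < L) (ha : 0 < a) (hM : 0 ≤ M) (hc : c ≠ 0)
    (sc₀ : Scaled c v₀ p₀ m₀ n₀ π₀)
    (hb : Base L a e C m₀ n₀ mx my mxx mxy myy nxx nxy nyy π₀)
    (hv₀ : MemC 2 a (strip L) v₀) (hp₀ : MemC 2 a (strip L) p₀) (hh : Differentiable ℝ hp)
    (hd : Data L c m₀ n₀ hm hp fm J d) (h : SolCmod L a M v₀ p₀ hm hp fm J v p) :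
    ∃ m n mx' my' nx' mxx' mxy' myy' nxx' nxy' nyy' π, Scaled c v p m n π ∧
      C2a L a (e + |c|⁻¹ * M) m mx' my' mxx' mxy' myy' ∧
      C2a L a (e + |c|⁻¹ * M) n nx' (fun z => -mx' z) nxx' nxy' nyy' ∧
      NSol L C d m n mx' my' nx' π := by
  have htop := h.exists_const hL ha hp₀ hh
  obtain ⟨⟨pv, pp, mv, mp⟩, hE, hn, h0, -, hf, hJ⟩ := h
  have m0 : (0 : ℝ) ∈ Icc 0 L := ⟨le_rfl, hL.le⟩
  have mL : L ∈ Icc 0 L := ⟨hL.le, le_rfl⟩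
  set m := fun z => c⁻¹ * (v z).1
  set n := fun z => c⁻¹ * (v z).2 - 1
  set π := fun z => (c ^ 2)⁻¹ * p z
  have sc : Scaled c v p m n π := scaled_div hc v p
  obtain ⟨wx, wy, wxx, wxy, wyy, cw⟩ := C2a.of_hNorm_le hL ha hM (mv.1.sub hv₀.1) hn
  have cm := hb.cm.add ((cw.clm (ContinuousLinearMap.fst ℝ ℝ ℝ)
    (ContinuousLinearMap.norm_fst_le ℝ ℝ ℝ)).const_smul c⁻¹)
  have cn := hb.cn.add ((cw.clm (ContinuousLinearMap.snd ℝ ℝ ℝ)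
    (ContinuousLinearMap.norm_snd_le ℝ ℝ ℝ)).const_smul c⁻¹)
  have em : (fun z => m₀ z + c⁻¹ • ContinuousLinearMap.fst ℝ ℝ ℝ (v z - v₀ z)) = m := by
    funext z
    simp only [m, ContinuousLinearMap.coe_fst', Prod.fst_sub, sc₀.1 z, smul_eq_mul]
    field_simp; ring
  have en : (fun z => n₀ z + c⁻¹ • ContinuousLinearMap.snd ℝ ℝ ℝ (v z - v₀ z)) = n := by
    funext z
    simp only [n, ContinuousLinearMap.coe_snd', Prod.snd_sub, sc₀.1 z, smul_eq_mul]
    field_simp; ring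
  rw [em, abs_inv] at cm
  rw [en, abs_inv] at cn
  obtain ⟨_, qx, qy, _, _, _, cq⟩ := mp.exists_C2a hL ha
  have gπ : G1 L π _ _ := cq.g.const_smul (c ^ 2)⁻¹
  have hE' := (sc.euler_iff hL hc cm.g cn.g gπ).1 hE
  set ux := fun z => mx z + c⁻¹ • ContinuousLinearMap.fst ℝ ℝ ℝ (wx z)
  have ey : EqOn (fun z => -ux z) (fun z => -mx z + c⁻¹ • ContinuousLinearMap.snd ℝ ℝ ℝ (wy z))
    (strip L) := fun z hz => by
      have := (hE' z hz).2.2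
      simp only at this ⊢
      linarith
  have cn' := cn.congr_y ey
  refine ⟨m, n, ux, _, _, _, _, _, _, _, _, π, sc, cm, cn', cm.g, cn'.g, gπ.congr (fun _ _ => rfl)
    (fun z hz => ?_) fun z hz => ?_, fun x y => by simp only [m, pv x y],
    fun x y => by simp only [n, pv x y], fun x y _ => by simp only [π, pp x y], fun x => ?_,
    fun x => ?_, ⟨C + (c ^ 2)⁻¹ * (p (0, L) - p₀ (0, L) - hp 0), fun x => ?_⟩, ?_⟩
  · linarith [(hE' z hz).1]
  · have h1 := (hE' z hz).2.1
    have h2 := ey hz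
    simp only at h1 h2 ⊢
    rw [h2]; linarith
  · have := hf x
    rw [sc₀.1] at this
    simp only at this
    simp only [hd.hβ, n]
    rw [show (v (x, 0)).2 = c * (1 + n₀ (x, 0)) - fm x by linarith]
    field_simp; ring
  · simp only [π, h0, sc₀.2, hb.hπ _ (mem_strip.2 m0 : (x, (0 : ℝ)) ∈ strip L), hd.hA, hd.hβ]
    field_simp; ring
  · simp only [π]
    rw [htop x]
    simp only [sc₀.2 (x, L), hb.hπ _ (mem_strip.2 mL : (x, L) ∈ strip L), hd.hT]
    field_simp; ring
  · rw [sc.fluxC_eq] at hJ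
    rw [hd.hj, ← hJ]
    field_simp

/-- Solutions of the normalized problem solve the boundary value problem. -/
lemma Base.sol_of_nsol (hL : 0 < L) (ha : a ∈ Ioo (0 : ℝ) 1) (hc : c ≠ 0)
    (sc₀ : Scaled c v₀ p₀ m₀ n₀ π₀)
    (hb : Base L a e C m₀ n₀ mx my mxx mxy myy nxx nxy nyy π₀)
    (hv₀ : MemC 2 a (strip L) v₀) (hp₀ : MemC 2 a (strip L) p₀) (hh : Differentiable ℝ hp)
    (hd : Data L c m₀ n₀ hm hp fm J d) {N : ℝ}
    {m n mx' my' nx' mxx' mxy' myy' nxx' nxy' nyy' π : ℝ × ℝ → ℝ}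
    (cm : C2a L a N m mx' my' mxx' mxy' myy')
    (cn : C2a L a N n nx' (fun z => -mx' z) nxx' nxy' nyy')
    (hs : NSol L C d m n mx' my' nx' π) (pπ : PerX π) (hM : 16 * (|c| * (N + e)) ≤ M) :
    ∃ v p, SolCmod L a M v₀ p₀ hm hp fm J v p := by
  have m0 : (0 : ℝ) ∈ Icc 0 L := ⟨le_rfl, hL.le⟩
  have mL : L ∈ Icc 0 L := ⟨hL.le, le_rfl⟩
  set v := fun z => (c * m z, c * (1 + n z)) with hv
  set p := fun z => c ^ 2 * π z with hpdef
  have sc : Scaled c v p m n π := ⟨fun _ => rfl, fun _ => rfl⟩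
  have cw := ((cm.add hb.cm.neg).prodMk (cn.add hb.cn.neg)).const_smul c
  have ew : (fun z => c • (m z + -m₀ z, n z + -n₀ z)) = fun z => v z - v₀ z := by
    funext z
    rw [sc₀.1 z]
    ext <;> simp [hv] <;> ring
  rw [ew] at cw
  obtain ⟨_, fx, fy, _, _, _, cv⟩ := hv₀.exists_C2a hL ha.1
  have cv' := cw.add cv
  simp only [sub_add_cancel] at cv'
  obtain ⟨_, gx, gy, _, _, _, cp⟩ := hp₀.exists_C2a hL ha.1
  obtain ⟨_, qx, qy, _, _, _, cπ⟩ := hs.exists_C2a_pressure ha hL cm cn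
  obtain ⟨k, hk⟩ := hs.hT
  refine ⟨v, p, ⟨fun x y => by simp only [hv, hs.pm x y, hs.pn x y],
    fun x y => by simp only [hpdef, pπ x y], cv'.memC hL ha.1,
      (cπ.const_smul (c ^ 2)).memC hL ha.1⟩,
    (sc.euler_iff hL hc hs.hm hs.hn hs.hπ).2 fun z _ => ⟨by ring, by ring, by ring⟩,
    (cw.hNorm_le hL).trans (ENNReal.ofReal_le_ofReal hM), fun x => ?_, fun x => ?_, fun x => ?_, ?_⟩
  · simp only [hpdef, hs.hA, sc₀.2, hb.hπ _ (mem_strip.2 m0 : (x, (0 : ℝ)) ∈ strip L), hd.hA, hd.hβ]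
    field_simp; ring
  · have e : (fun t => p (t, L)) = fun t => p₀ (t, L) + hp t + c ^ 2 * (k - C) := funext fun t => by
      simp only [hpdef, hk, sc₀.2, hb.hπ _ (mem_strip.2 mL : (t, L) ∈ strip L), hd.hT]
      field_simp; ring
    rw [e, deriv_add_const]
    exact deriv_add (cp.g.slice_x mL).differentiableAt (hh x)
  · simp only [hv, hs.h0, hd.hβ, sc₀.1]
    field_simp; ring
  · rw [sc.fluxC_eq, hs.hj, hd.hj]
    field_simp

end Correspondence

section Main

variable {L a c e C M : ℝ} {v₀ : ℝ × ℝ → ℝ × ℝ} {p₀ : ℝ × ℝ → ℝ}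
  {m₀ n₀ mx my mxx mxy myy nxx nxy nyy π₀ : ℝ × ℝ → ℝ} {hm hp fm : ℝ → ℝ} {J : ℝ} {d : BD}

/-- Uniqueness for the solvable variant of the boundary value problem. -/
lemma Base.eqOn_of_sol (hL : 0 < L) (ha : 0 < a) (hM : 0 ≤ M) (hc : c ≠ 0)
    (sc₀ : Scaled c v₀ p₀ m₀ n₀ π₀)
    (hb : Base L a e C m₀ n₀ mx my mxx mxy myy nxx nxy nyy π₀)
    (hv₀ : MemC 2 a (strip L) v₀) (hp₀ : MemC 2 a (strip L) p₀) (hh : Differentiable ℝ hp)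
    (hd : Data L c m₀ n₀ hm hp fm J d) {N : ℝ} (hN : N ≤ 1 / 8)
    (huniq : ∀ d q r, d.Good a N → Good L a N q → Good L a N r → Step L d q q → Step L d r r →
      EqOn q.m r.m (strip L) ∧ EqOn q.n r.n (strip L))
    (gd : d.Good a (N / 2)) (hNM : e + |c|⁻¹ * M ≤ N / 2)
    {v v' : ℝ × ℝ → ℝ × ℝ} {p p' : ℝ × ℝ → ℝ}
    (h : SolCmod L a M v₀ p₀ hm hp fm J v p) (h' : SolCmod L a M v₀ p₀ hm hp fm J v' p') :
    EqOn v v' (strip L) ∧ EqOn p p' (strip L) := by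
  obtain ⟨m, n, _, _, _, _, _, _, _, _, _, π, sc, cm, cn, hs⟩ :=
    hb.nsol_of_sol hL ha hM hc sc₀ hv₀ hp₀ hh hd h
  obtain ⟨m', n', _, _, _, _, _, _, _, _, _, π', sc', cm', cn', hs'⟩ :=
    hb.nsol_of_sol hL ha hM hc sc₀ hv₀ hp₀ hh hd h'
  obtain ⟨em, en, eπ⟩ := NSol.unique hL (by linarith : 2 * (N / 2) ≤ N) hN huniq hs hs' gd
    (cm.mono hNM) (cn.mono hNM) (cm'.mono hNM) (cn'.mono hNM)
  exact ⟨fun z hz => by rw [sc.1, sc'.1, em hz, en hz],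
    fun z hz => by rw [sc.2, sc'.2, eπ hz]⟩

/-- Given existence and uniqueness for the solvable variant, the original problem is uniquely
solvable exactly when the prescribed pressures agree at one point of the outer boundary. -/
lemma SolCmod.existsUnique_iff (hL : 0 < L) (ha : 0 < a) (hp₀ : MemC 2 a (strip L) p₀)
    (hh : Differentiable ℝ hp)
    (huniq : ∀ v p v' p', SolCmod L a M v₀ p₀ hm hp fm J v p →
      SolCmod L a M v₀ p₀ hm hp fm J v' p' → EqOn v v' (strip L) ∧ EqOn p p' (strip L))
    {vt : ℝ × ℝ → ℝ × ℝ} {pt : ℝ × ℝ → ℝ} (h : SolCmod L a M v₀ p₀ hm hp fm J vt pt) :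
    (∃ v p, SolC L a M v₀ p₀ hm hp fm J v p ∧ ∀ v' p', SolC L a M v₀ p₀ hm hp fm J v' p' →
      EqOn v v' (strip L) ∧ EqOn p p' (strip L)) ↔ hp 0 = pt (0, L) - p₀ (0, L) := by
  constructor
  · rintro ⟨v, p, hs, -⟩
    have := (huniq _ _ _ _ h (.of_solC hL ha hp₀ hh hs)).2 (x := (0, L))
      ⟨mem_univ _, hL.le, le_rfl⟩
    rw [this, hs.2.2.2.2.1]; ring
  · intro h0
    have hx := h.exists_const hL ha hp₀ hh
    obtain ⟨h1, h2, h3, h4, h5, h6⟩ := h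
    exact ⟨vt, pt, ⟨h1, h2, h3, h4, fun x => by rw [hx, h0]; ring, h6⟩, fun v' p' hs' =>
      huniq _ _ _ _ ⟨h1, h2, h3, h4, h5, h6⟩ (.of_solC hL ha hp₀ hh hs')⟩

end Main

theorem euler_bvp_C_compatibility (L a vb : ℝ) (hL : 0 < L) (ha : a ∈ Set.Ioo (0 : ℝ) 1)
    (hvb : 0 < vb) :
    ∃ ε > (0 : ℝ), ∃ M > (0 : ℝ), ∃ K > (0 : ℝ),
      ∀ (v₀ : ℝ × ℝ → ℝ × ℝ) (p₀ : ℝ × ℝ → ℝ),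
        VP L 2 a v₀ p₀ → Euler L v₀ p₀ →
        (∀ z ∈ strip L, curlF L v₀ z = 0) →
        (∀ z ∈ strip L, vb ≤ |(v₀ z).2|) →
        hNorm 2 a (strip L) (c1 v₀) ≤ ENNReal.ofReal ε →
        ∀ (hm hp fm : ℝ → ℝ) (J : ℝ),
          BData 2 a hm → BData 2 a hp → BData 2 a fm →
          hNorm 2 a (Set.univ : Set ℝ) hm + hNorm 2 a (Set.univ : Set ℝ) hp
              + hNorm 2 a (Set.univ : Set ℝ) fm
              + ENNReal.ofReal |J - fluxC L v₀| ≤ ENNReal.ofReal (K * M) →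
          (∃ vt pt, SolCmod L a M v₀ p₀ hm hp fm J vt pt) ∧
          ∀ vt pt, SolCmod L a M v₀ p₀ hm hp fm J vt pt →
            ((∃ v p, SolC L a M v₀ p₀ hm hp fm J v p ∧
                ∀ v' p', SolC L a M v₀ p₀ hm hp fm J v' p' →
                  Set.EqOn v v' (strip L) ∧ Set.EqOn p p' (strip L))
              ↔ hp 0 = pt (0, L) - p₀ (0, L)) := by
  obtain ⟨N, hN, B, hB, hN8, hex, huq⟩ := exists_fixedPoint ha hL
  set κ := 2 * (1 + L) with hκ
  set D := (33 + L) * κ + 1 + vb⁻¹ with hD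
  set P := 10 ^ 10 * (B * D) + κ with hP
  have hκ0 : 0 < κ := by positivity
  have hD0 : 0 < D := by positivity
  have hP0 : 0 < P := by positivity
  set K := (16 * P)⁻¹ with hK
  have hK0 : 0 < K := by positivity
  have hKP : 16 * P * K = 1 := mul_inv_cancel₀ (by positivity)
  set M := vb * N / 4 with hM
  have hM0 : 0 < M := by positivity
  have hKM : 0 ≤ K * M := by positivity
  refine ⟨K * M, by positivity, M, hM0, K, hK0, ?_⟩
  intro v₀ p₀ hvp hE hcurl hlow h1 hm hp fm J bm bp bf hsum
  set c := (v₀ (0, 0)).2 with hcdef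
  have hvc : vb ≤ |c| := hlow (0, 0) ⟨mem_univ _, le_rfl, hL.le⟩
  have hc' : 0 < |c| := hvb.trans_le hvc
  have hc : c ≠ 0 := abs_pos.1 hc'
  obtain ⟨C, m₀, n₀, mx, my, mxx, mxy, myy, nxx, nxy, nyy, π₀, sc₀, hb⟩ :=
    exists_base ha hL hKM hvp hE hcurl hc h1
  rw [← hcdef] at sc₀ hb
  set r := |c|⁻¹ with hr
  have hr0 : 0 < r := by positivity
  have hrc : |c| * r = 1 := mul_inv_cancel₀ hc'.ne'
  have hrv : r ≤ vb⁻¹ := inv_anti₀ hvb hvc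
  have hrM : r * M ≤ N / 4 := by
    have : r * vb ≤ 1 := (mul_le_mul_of_nonneg_left hvc hr0.le).trans_eq (by linarith)
    rw [hM]; nlinarith
  set X := r * (K * M) with hX
  have hX0 : 0 ≤ X := by positivity
  have hPX : 16 * (P * X) = r * M := by linear_combination r * M * hKP
  have hBX : B * (D * X) + κ * X ≤ P * X := by
    have : 0 ≤ B * D * X := by positivity
    rw [hP]; nlinarith
  have hBX0 : D * X ≤ B * (D * X) := le_mul_of_one_le_left (by positivity) hB
  have hDX : 0 ≤ D * X := by positivity
  have hκX : 0 ≤ κ * X := by positivity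
  have sm := H2.of_hNorm_le ha.1 hKM bm.2.1
    ((le_self_add.trans le_self_add).trans (le_self_add.trans hsum))
  have sp := H2.of_hNorm_le ha.1 hKM bp.2.1
    ((le_add_self.trans le_self_add).trans (le_self_add.trans hsum))
  have sf := H2.of_hNorm_le ha.1 hKM bf.2.1 (le_add_self.trans (le_self_add.trans hsum))
  have sJ : |J + c * ∫ y in (0 : ℝ)..L, m₀ (0, y)| ≤ K * M := by
    have := (ENNReal.ofReal_le_ofReal_iff hKM).1 (le_add_self.trans hsum)
    rwa [sc₀.fluxC_eq, sub_neg_eq_add] at this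
  have hh : Differentiable ℝ hp := fun x => (sp.1 x).differentiableAt
  obtain ⟨d, gd, hd⟩ := hb.exists_data ha hL (by linarith) hc bm.1 bp.1 bf.1 sm sp sf sJ
  replace gd : d.Good a (D * X) := gd.mono <| by
    rw [hD]; nlinarith [mul_le_mul_of_nonneg_right hrv hX0]
  have huniq : ∀ v p v' p', SolCmod L a M v₀ p₀ hm hp fm J v p →
      SolCmod L a M v₀ p₀ hm hp fm J v' p' → EqOn v v' (strip L) ∧ EqOn p p' (strip L) :=
    fun _ _ _ _ => hb.eqOn_of_sol hL ha.1 hM0.le hc sc₀ hvp.2.2.1 hvp.2.2.2 hh hd hN8 huq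
      (gd.mono (by linarith)) (by linarith)
  refine ⟨?_, fun vt pt h => h.existsUnique_iff hL ha.1 hvp.2.2.2 hh huniq⟩
  obtain ⟨q, gq, hq⟩ := hex (D * X) d (by linarith) gd
  obtain ⟨_, _, _, _, _, π, cm, cn, hs, pπ⟩ :=
    gq.exists_nsol ha hL (by linarith) (gd.mono hBX0) hq C
  exact hb.sol_of_nsol hL ha hc sc₀ hvp.2.2.1 hvp.2.2.2 hh hd cm cn hs pπ
    (by linear_combination |c| * hPX + M * hrc)
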